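/- For every fixed integer k ≥ 1, set a_k = ∏_{p prime} (1 − (p^k − (p−1)^k)/(p^k (p−1))), a convergent infinite product over all primes. Then Σ_{p ≤ x, p prime} (φ(p−1)/(p−1))^k = a_k · x/log x + O(x/(log x)²) as x → ∞. -/

import Mathlib

/-- The constant `a_k = ∏_p (1 − (p^k − (p−1)^k)/(p^k (p−1)))`, product over all primes. -/
noncomputable def aK (k : ℕ) : ℝ :=
  ∏' p : Nat.Primes,
    (1 - (((p : ℕ) : ℝ) ^ k - (((p : ℕ) : ℝ) - 1) ^ k) /
      (((p : ℕ) : ℝ) ^ k * (((p : ℕ) : ℝ) - 1)))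

namespace PrimeSums

open Complex MeasureTheory Set Filter Topology Asymptotics Finset

section Summatory

/-- A bounded sequence whose partial sums are `κ n + O(B)`. -/
structure HasMean (a : ℕ → ℂ) (κ B : ℝ) : Prop where
  norm_le : ∀ n, ‖a n‖ ≤ 1
  sum_sub_le : ∀ n : ℕ, ‖∑ k ∈ Finset.Icc 1 n, a k - κ * n‖ ≤ B
  one_le : 1 ≤ B
  nonneg : 0 ≤ κ
  le_one : κ ≤ 1

/-- The error term of the summatory function, supported on `t > 1`. -/
noncomputable def errorTerm (a : ℕ → ℂ) (κ : ℝ) : ℝ → ℂ :=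
  (Set.Ioi 1).indicator fun t ↦ ∑ k ∈ Finset.Icc 1 ⌊t⌋₊, a k - κ * t

/-- The part of the Dirichlet series of `a` which is holomorphic for `re s > 0`. -/
noncomputable def regPart (a : ℕ → ℂ) (κ : ℝ) (s : ℂ) : ℂ :=
  s * mellin (errorTerm a κ) (-s)

variable {a : ℕ → ℂ} {κ B : ℝ}

lemma measurable_errorTerm : Measurable (errorTerm a κ) := by
  refine Measurable.indicator ?_ measurableSet_Ioi
  refine Measurable.sub ?_ (by fun_prop)
  exact (measurable_from_nat (f := fun n : ℕ ↦ ∑ k ∈ Finset.Icc 1 n, a k)).comp Nat.measurable_floor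

lemma HasMean.norm_errorTerm_le (h : HasMean a κ B) (t : ℝ) : ‖errorTerm a κ t‖ ≤ 2 * B := by
  have hB := h.one_le
  by_cases ht : t ∈ Set.Ioi (1 : ℝ)
  · rw [errorTerm, Set.indicator_of_mem ht]
    have ht1 : (1 : ℝ) < t := ht
    have h1 := h.sum_sub_le ⌊t⌋₊
    have h2 : ‖((κ : ℂ) * (⌊t⌋₊ : ℂ) - κ * t)‖ ≤ 1 := by
      rw [← mul_sub, norm_mul]
      have e : ‖((⌊t⌋₊ : ℂ) - t)‖ ≤ 1 := by
        have : ((⌊t⌋₊ : ℂ) - t) = ((⌊t⌋₊ - t : ℝ) : ℂ) := by push_cast; ring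
        rw [this, Complex.norm_real, Real.norm_eq_abs, abs_le]
        constructor
        · linarith [Nat.lt_floor_add_one t]
        · linarith [Nat.floor_le (by linarith : 0 ≤ t)]
      have e2 : ‖(κ : ℂ)‖ ≤ 1 := by
        rw [Complex.norm_real, Real.norm_eq_abs, abs_of_nonneg h.nonneg]; exact h.le_one
      calc _ ≤ 1 * 1 := mul_le_mul e2 e (norm_nonneg _) zero_le_one
        _ = 1 := by ring
    calc _ = ‖(∑ k ∈ Finset.Icc 1 ⌊t⌋₊, a k - κ * ⌊t⌋₊) + ((κ : ℂ) * (⌊t⌋₊ : ℂ) - κ * t)‖ := by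
          congr 1; ring
      _ ≤ B + 1 := (norm_add_le _ _).trans (add_le_add h1 h2)
      _ ≤ 2 * B := by linarith
  · rw [errorTerm, Set.indicator_of_notMem ht]; simp; linarith

lemma HasMean.differentiableAt_regPart (h : HasMean a κ B) {s : ℂ} (hs : 0 < s.re) :
    DifferentiableAt ℂ (regPart a κ) s := by
  refine DifferentiableAt.mul differentiableAt_id ?_
  have : DifferentiableAt ℂ (mellin (errorTerm a κ)) (-s) := by
    refine mellin_differentiableAt_of_isBigO_rpow (a := 0) (b := -s.re - 1) ?_ ?_ (by simpa) ?_
      (by simp)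
    · refine LocallyIntegrable.locallyIntegrableOn ?_ _
      refine (locallyIntegrable_const (2 * B)).mono measurable_errorTerm.aestronglyMeasurable ?_
      refine Eventually.of_forall fun t ↦ (h.norm_errorTerm_le t).trans (le_abs_self _)
    · refine IsBigO.of_bound (2 * B) (Eventually.of_forall fun t ↦ ?_)
      simpa using h.norm_errorTerm_le t
    · have : errorTerm a κ =ᶠ[𝓝[>] 0] fun _ ↦ 0 := by
        filter_upwards [nhdsWithin_le_nhds (Iio_mem_nhds (zero_lt_one (α := ℝ)))] with t ht
        exact Set.indicator_of_notMem (fun h : 1 < t ↦ by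
          rw [Set.mem_Iio] at ht; linarith) _
      exact this.trans_isBigO (isBigO_zero _ _)
  exact this.comp s differentiableAt_id.neg

lemma regPart_eq_integral (s : ℂ) :
    regPart a κ s = s * ∫ t in Set.Ioi (1 : ℝ), (t : ℂ) ^ (-s - 1) * errorTerm a κ t := by
  rw [regPart, mellin]
  congr 1
  simp only [smul_eq_mul]
  have : (fun t : ℝ ↦ (t : ℂ) ^ (-s - 1) * errorTerm a κ t) =
      (Set.Ioi (1 : ℝ)).indicator (fun t : ℝ ↦ (t : ℂ) ^ (-s - 1) * errorTerm a κ t) := by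
    ext t
    by_cases ht : t ∈ Set.Ioi (1 : ℝ)
    · rw [Set.indicator_of_mem ht]
    · rw [Set.indicator_of_notMem ht, errorTerm, Set.indicator_of_notMem ht, mul_zero]
  rw [this, setIntegral_indicator measurableSet_Ioi]
  have e : Set.Ioi (0 : ℝ) ∩ Set.Ioi 1 = Set.Ioi 1 :=
    Set.inter_eq_right.mpr (Set.Ioi_subset_Ioi zero_le_one)
  rw [e]
  exact setIntegral_congr_fun measurableSet_Ioi fun t ht ↦ by simp [Set.indicator_of_mem ht]

lemma HasMean.integrableOn (h : HasMean a κ B) {s : ℂ} (hs : 0 < s.re) {y : ℝ} (hy : 0 < y) :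
    IntegrableOn (fun t : ℝ ↦ (t : ℂ) ^ (-s - 1) * errorTerm a κ t) (Set.Ioi y) := by
  have h1 : IntegrableOn (fun t : ℝ ↦ (t : ℂ) ^ (-s - 1)) (Set.Ioi y) :=
    integrableOn_Ioi_cpow_of_lt (by simp; linarith) hy
  exact Integrable.mul_bdd (c := 2 * B) h1 measurable_errorTerm.aestronglyMeasurable
    (Eventually.of_forall fun t ↦ h.norm_errorTerm_le t)

lemma HasMean.summable (h : HasMean a κ B) {s : ℂ} (hs : 1 < s.re) : LSeriesSummable a s :=
  LSeriesSummable_of_bounded_of_one_lt_re (m := 1) (fun n _ ↦ h.norm_le n) hs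

lemma HasMean.LSeries_eq (h : HasMean a κ B) {s : ℂ} (hs : 1 < s.re) :
    LSeries a s = κ * (s / (s - 1)) + regPart a κ s := by
  have hO : (fun n ↦ ∑ k ∈ Finset.Icc 1 n, a k) =O[atTop] fun n ↦ (n : ℝ) ^ (1 : ℝ) := by
    refine IsBigO.of_bound 1 (Eventually.of_forall fun n ↦ ?_)
    refine (norm_sum_le _ _).trans ?_
    calc _ ≤ ∑ k ∈ Finset.Icc 1 n, (1 : ℝ) := Finset.sum_le_sum fun k _ ↦ h.norm_le k
      _ ≤ _ := by simp
  rw [LSeries_eq_mul_integral a zero_le_one hs (h.summable hs) hO, regPart_eq_integral]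
  have hs1 : s - 1 ≠ 0 := by
    intro e; have := congrArg Complex.re e; simp at this; linarith
  have h2 := h.integrableOn (s := s) (by linarith) one_pos
  have h1 : IntegrableOn (fun t : ℝ ↦ (κ : ℂ) * (t : ℂ) ^ (-s)) (Set.Ioi 1) :=
    (integrableOn_Ioi_cpow_of_lt (by simpa using hs) one_pos).const_mul _
  have key : ∫ t in Set.Ioi (1 : ℝ), (∑ k ∈ Finset.Icc 1 ⌊t⌋₊, a k) * (t : ℂ) ^ (-(s + 1)) =
      ∫ t in Set.Ioi (1 : ℝ), ((κ : ℂ) * (t : ℂ) ^ (-s) + (t : ℂ) ^ (-s - 1) * errorTerm a κ t) := by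
    refine setIntegral_congr_fun measurableSet_Ioi fun t ht ↦ ?_
    have ht0 : (t : ℂ) ≠ 0 := by
      have : (1 : ℝ) < t := ht
      exact_mod_cast (by linarith : t ≠ 0)
    have e : (t : ℂ) ^ (-s) = (t : ℂ) ^ (-s - 1) * t := by
      rw [cpow_sub _ _ ht0, cpow_one]; field_simp
    simp only [errorTerm, Set.indicator_of_mem ht, e, show -(s + 1) = -s - 1 by ring]
    ring
  rw [key, integral_add h1 h2, integral_const_mul, integral_Ioi_cpow_of_lt (by simpa using hs)
    one_pos]
  have : -s + 1 ≠ 0 := by intro e; exact hs1 (by linear_combination -e)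
  simp only [ofReal_one, one_cpow]
  field_simp
  ring

lemma sum_cpow_eq (a : ℕ → ℂ) (s : ℂ) (hs : s ≠ 0) (Y : ℕ) :
    s * ∫ t in Set.Ioc (1 : ℝ) Y, (∑ k ∈ Finset.Icc 1 ⌊t⌋₊, a k) * (t : ℂ) ^ (-s - 1) =
    ∑ n ∈ Finset.Icc 1 Y, a n * (n : ℂ) ^ (-s) - (∑ n ∈ Finset.Icc 1 Y, a n) * (Y : ℂ) ^ (-s) := by
  set c : ℕ → ℂ := fun n ↦ if n = 0 then 0 else a n with hc
  have hsum (g : ℕ → ℂ) (m : ℕ) :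
      ∑ k ∈ Finset.Icc 0 m, g k * c k = ∑ k ∈ Finset.Icc 1 m, a k * g k := by
    rw [← Finset.add_sum_Ioc_eq_sum_Icc (Nat.zero_le m)]
    simp only [hc, ↓reduceIte, mul_zero, zero_add]
    refine Finset.sum_congr rfl fun k hk ↦ ?_
    have : k ≠ 0 := by have := (Finset.mem_Ioc.mp hk).1; omega
    simp [this, mul_comm]
  have hsum1 (m : ℕ) : ∑ k ∈ Finset.Icc 0 m, c k = ∑ k ∈ Finset.Icc 1 m, a k := by
    simpa using hsum (fun _ ↦ 1) m
  have hd : ∀ t ∈ Set.Icc (1 : ℝ) Y, HasDerivAt (fun t : ℝ ↦ (t : ℂ) ^ (-s))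
      (-s * (t : ℂ) ^ (-s - 1)) t := fun t ht ↦ by
    have := hasDerivAt_ofReal_cpow_const (x := t) (r := -s) (by linarith [ht.1]) (by simpa)
    simpa using this
  have hcont : ContinuousOn (fun t : ℝ ↦ -s * (t : ℂ) ^ (-s - 1)) (Set.Icc 1 Y) := by
    refine continuousOn_const.mul fun t ht ↦ ?_
    exact (continuousAt_ofReal_cpow_const t _ (Or.inr (by linarith [ht.1]))).continuousWithinAt
  have main := sum_mul_eq_sub_integral_mul₀' (f := fun t : ℝ ↦ (t : ℂ) ^ (-s)) c (by simp [hc]) Y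
    (fun t ht ↦ (hd t ht).differentiableAt)
    ((hcont.integrableOn_Icc).congr_fun (fun t ht ↦ ((hd t ht).deriv).symm) measurableSet_Icc)
  simp only [hsum1] at main
  have e : ∑ k ∈ Finset.Icc 0 Y, ((k : ℝ) : ℂ) ^ (-s) * c k =
      ∑ n ∈ Finset.Icc 1 Y, a n * (n : ℂ) ^ (-s) := by
    rw [hsum (fun k ↦ ((k : ℝ) : ℂ) ^ (-s))]; simp
  rw [e] at main
  rw [main, ← integral_const_mul]
  have : ∫ t in Set.Ioc (1 : ℝ) Y, deriv (fun t : ℝ ↦ (t : ℂ) ^ (-s)) t *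
      ∑ k ∈ Finset.Icc 1 ⌊t⌋₊, a k = - ∫ t in Set.Ioc (1 : ℝ) Y,
      s * ((∑ k ∈ Finset.Icc 1 ⌊t⌋₊, a k) * (t : ℂ) ^ (-s - 1)) := by
    rw [← integral_neg]
    refine setIntegral_congr_fun measurableSet_Ioc fun t ht ↦ ?_
    rw [(hd t ⟨ht.1.le, ht.2⟩).deriv]; ring
  rw [this]
  push_cast
  ring

lemma HasMean.regPart_eq (h : HasMean a κ B) {s : ℂ} (hs : 0 < s.re) {Y : ℕ} (hY : 1 ≤ Y) :
    regPart a κ s = (∑ n ∈ Finset.Icc 1 Y, a n * (n : ℂ) ^ (-s)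
        - (∑ n ∈ Finset.Icc 1 Y, a n) * (Y : ℂ) ^ (-s))
      - κ * (s * ∫ t in (1 : ℝ)..Y, (t : ℂ) ^ (-s))
      + s * ∫ t in Set.Ioi (Y : ℝ), (t : ℂ) ^ (-s - 1) * errorTerm a κ t := by
  have hs0 : s ≠ 0 := by rintro rfl; simp at hs
  have hY1 : (1 : ℝ) ≤ Y := by exact_mod_cast hY
  have hi := h.integrableOn hs one_pos
  rw [regPart_eq_integral, ← Set.Ioc_union_Ioi_eq_Ioi hY1,
    setIntegral_union (Set.Ioc_disjoint_Ioi le_rfl) measurableSet_Ioi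
      (hi.mono_set Set.Ioc_subset_Ioi_self) (hi.mono_set (Set.Ioi_subset_Ioi hY1)),
    mul_add, ← sum_cpow_eq a s hs0 Y]
  congr 1
  rw [intervalIntegral.integral_of_le hY1, mul_left_comm, ← mul_sub,
    ← integral_const_mul (κ : ℂ), ← integral_sub]
  · congr 1
    refine setIntegral_congr_fun measurableSet_Ioc fun t ht ↦ ?_
    have ht1 : (1 : ℝ) < t := ht.1
    have ht0 : (t : ℂ) ≠ 0 := by exact_mod_cast (by linarith : t ≠ 0)
    have e : (t : ℂ) ^ (-s) = (t : ℂ) ^ (-s - 1) * t := by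
      rw [cpow_sub _ _ ht0, cpow_one]; field_simp
    simp only [errorTerm, Set.indicator_of_mem (show t ∈ Set.Ioi 1 from ht1), e]
    ring
  · have hc : ContinuousOn (fun t : ℝ ↦ (t : ℂ) ^ (-s - 1)) (Set.Icc 1 Y) := fun t ht ↦
      (continuousAt_ofReal_cpow_const t _ (Or.inr (by linarith [ht.1]))).continuousWithinAt
    have := integrableOn_mul_sum_Icc a (m := 1) zero_le_one hc.integrableOn_Icc
    refine (this.mono_set Set.Ioc_subset_Icc_self).congr_fun (fun t _ ↦ ?_) measurableSet_Ioc
    simp only [mul_comm]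
  · have hc : ContinuousOn (fun t : ℝ ↦ (κ : ℂ) * (t : ℂ) ^ (-s)) (Set.Icc 1 Y) :=
      continuousOn_const.mul fun t ht ↦
      (continuousAt_ofReal_cpow_const t _ (Or.inr (by linarith [ht.1]))).continuousWithinAt
    exact hc.integrableOn_Icc.mono_set Set.Ioc_subset_Icc_self

end Summatory

section Bounds
variable {a : ℕ → ℂ} {κ B : ℝ}

lemma sum_rpow_neg_le {η σ : ℝ} (hσ : 1 - η ≤ σ) (hη : 0 ≤ η) {Y : ℕ} (hY : 1 ≤ Y) :
    ∑ n ∈ Finset.Icc 1 Y, (n : ℝ) ^ (-σ) ≤ (Y : ℝ) ^ η * (1 + Real.log Y) := by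
  calc ∑ n ∈ Finset.Icc 1 Y, (n : ℝ) ^ (-σ) ≤ ∑ n ∈ Finset.Icc 1 Y, (Y : ℝ) ^ η * (n : ℝ)⁻¹ := by
        refine Finset.sum_le_sum fun n hn ↦ ?_
        obtain ⟨h1, h2⟩ := Finset.mem_Icc.mp hn
        have hn1 : (1 : ℝ) ≤ n := by exact_mod_cast h1
        calc (n : ℝ) ^ (-σ) ≤ (n : ℝ) ^ (η - 1) := Real.rpow_le_rpow_of_exponent_le hn1 (by linarith)
          _ = (n : ℝ) ^ η * (n : ℝ)⁻¹ := by
            rw [Real.rpow_sub (by linarith), Real.rpow_one, div_eq_mul_inv]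
          _ ≤ _ := by
            gcongr
    _ = (Y : ℝ) ^ η * ((harmonic Y : ℚ) : ℝ) := by
        rw [← Finset.mul_sum, harmonic_eq_sum_Icc]; push_cast; rfl
    _ ≤ _ := by gcongr; exact harmonic_le_one_add_log Y

lemma norm_mul_integral_cpow_le {η : ℝ} (hη : 0 < η) {s : ℂ} (hs : 1 - η ≤ s.re)
    {Y : ℕ} (hY : 1 ≤ Y) :
    ‖s * ∫ t in (1 : ℝ)..Y, (t : ℂ) ^ (-s)‖ ≤ 5 * ((Y : ℝ) ^ η * (1 + Real.log Y)) := by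
  have hY1 : (1 : ℝ) ≤ Y := by exact_mod_cast hY
  have hlog := Real.log_nonneg hY1
  have hYη : (1 : ℝ) ≤ (Y : ℝ) ^ η := Real.one_le_rpow hY1 hη.le
  rw [norm_mul]
  rcases le_or_gt ‖s‖ 5 with h5 | h5
  · have : ‖∫ t in (1 : ℝ)..Y, (t : ℂ) ^ (-s)‖ ≤ (Y : ℝ) ^ η * Real.log Y := by
      have hb : ∀ᵐ t, t ∈ Set.Ioc (1 : ℝ) Y → ‖(t : ℂ) ^ (-s)‖ ≤ (Y : ℝ) ^ η * t⁻¹ := by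
        refine Eventually.of_forall fun t ht ↦ ?_
        have ht0 : 0 < t := by linarith [ht.1]
        rw [Complex.norm_cpow_eq_rpow_re_of_pos ht0]
        calc t ^ (-s).re ≤ t ^ (η - 1) :=
              Real.rpow_le_rpow_of_exponent_le ht.1.le (by simp; linarith)
          _ = t ^ η * t⁻¹ := by rw [Real.rpow_sub ht0, Real.rpow_one, div_eq_mul_inv]
          _ ≤ _ := by gcongr; exact ht.2
      have hi : IntervalIntegrable (fun t : ℝ ↦ (Y : ℝ) ^ η * t⁻¹) volume 1 Y := by
        refine (intervalIntegral.intervalIntegrable_inv (fun t ht ↦ ?_) continuousOn_id).const_mul _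
        rw [Set.uIcc_of_le hY1] at ht; simp only [id]; linarith [ht.1]
      refine (intervalIntegral.norm_integral_le_of_norm_le hY1 hb hi).trans ?_
      rw [intervalIntegral.integral_const_mul, integral_inv_of_pos one_pos (by linarith)]
      simp
    calc _ ≤ 5 * ((Y : ℝ) ^ η * Real.log Y) := by gcongr
      _ ≤ _ := by gcongr; linarith
  · have hs1 : s ≠ 1 := by rintro rfl; norm_num at h5
    have h1s : ‖1 - s‖ ≥ ‖s‖ - 1 := by
      rw [norm_sub_rev]; simpa using norm_sub_norm_le s 1
    rw [integral_cpow (Or.inr ⟨fun e ↦ hs1 (by linear_combination -e), by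
      rw [Set.uIcc_of_le hY1]; exact fun h ↦ by linarith [h.1]⟩)]
    rw [norm_div, show -s + 1 = 1 - s by ring]
    have hn : ‖((Y : ℝ) : ℂ) ^ (1 - s) - ((1 : ℝ) : ℂ) ^ (1 - s)‖ ≤ 2 * (Y : ℝ) ^ η := by
      refine (norm_sub_le _ _).trans ?_
      rw [Complex.norm_cpow_eq_rpow_re_of_pos (by linarith)]
      have : (Y : ℝ) ^ (1 - s).re ≤ (Y : ℝ) ^ η :=
        Real.rpow_le_rpow_of_exponent_le hY1 (by simp; linarith)
      simp only [ofReal_one, one_cpow, norm_one]; linarith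
    have hpos : 0 < ‖1 - s‖ := by linarith
    rw [← mul_div_assoc, div_le_iff₀ hpos]
    have : ‖s‖ ≤ 2 * ‖1 - s‖ := by linarith
    calc _ ≤ (2 * ‖1 - s‖) * (2 * (Y : ℝ) ^ η) := by gcongr
      _ ≤ 5 * ((Y : ℝ) ^ η * 1) * ‖1 - s‖ := by nlinarith [mul_pos hpos (by linarith : 0 < (Y : ℝ) ^ η)]
      _ ≤ _ := by gcongr; linarith

lemma HasMean.norm_tail_le (h : HasMean a κ B) {s : ℂ} (hs : 0 < s.re) {Y : ℝ} (hY : 0 < Y) :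
    ‖∫ t in Set.Ioi Y, (t : ℂ) ^ (-s - 1) * errorTerm a κ t‖ ≤ 2 * B * (Y ^ (-s.re) / s.re) := by
  have hi : IntegrableOn (fun t : ℝ ↦ 2 * B * t ^ (-s.re - 1)) (Set.Ioi Y) :=
    (integrableOn_Ioi_rpow_of_lt (by linarith) hY).const_mul _
  refine (norm_integral_le_of_norm_le hi ?_).trans ?_
  · refine (ae_restrict_iff' measurableSet_Ioi).mpr (Eventually.of_forall fun t ht ↦ ?_)
    have ht0 : 0 < t := hY.trans ht
    rw [norm_mul, Complex.norm_cpow_eq_rpow_re_of_pos ht0, mul_comm]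
    have := h.norm_errorTerm_le t
    simp only [sub_re, neg_re, one_re]
    gcongr
  · rw [integral_const_mul, integral_Ioi_rpow_of_lt (by linarith) hY]
    rw [show -s.re - 1 + 1 = -s.re by ring, neg_div_neg_eq]

lemma HasMean.norm_regPart_le (h : HasMean a κ B) {η : ℝ} (hη : 0 < η) (hη2 : η ≤ 1 / 2) {s : ℂ}
    (hs : 1 - η ≤ s.re) (hs3 : s.re ≤ 3) :
    ‖regPart a κ s‖ ≤ 40 * (1 + 1 / η) * (B * (|s.im| + 2)) ^ (2 * η) := by
  have hB := h.one_le
  set Z := B * (|s.im| + 2) with hZ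
  have hZ2 : 2 ≤ Z := by nlinarith [abs_nonneg s.im]
  set Y := ⌈Z⌉₊ with hYdef
  have hZY : Z ≤ Y := Nat.le_ceil Z
  have hYZ : (Y : ℝ) ≤ 2 * Z := by linarith [Nat.ceil_lt_add_one (by linarith : 0 ≤ Z)]
  have hY1 : (1 : ℝ) ≤ Y := by linarith
  have hY : 1 ≤ Y := by exact_mod_cast hY1
  have hσ : 0 < s.re := by linarith
  have hlog := Real.log_nonneg hY1
  set P := (Y : ℝ) ^ η * (1 + Real.log Y) with hP
  have hYη : (1 : ℝ) ≤ (Y : ℝ) ^ η := Real.one_le_rpow hY1 hη.le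
  have hYP : (Y : ℝ) ^ η ≤ P := by rw [hP]; nlinarith
  have hnorm (n : ℕ) (hn : 1 ≤ n) : ‖(n : ℂ) ^ (-s)‖ = (n : ℝ) ^ (-s.re) := by
    rw [Complex.norm_natCast_cpow_of_pos (by omega)]; simp
  have hYs : (Y : ℝ) * (Y : ℝ) ^ (-s.re) ≤ (Y : ℝ) ^ η := by
    nth_rewrite 1 [← Real.rpow_one (Y : ℝ)]
    rw [← Real.rpow_add (by linarith)]
    exact Real.rpow_le_rpow_of_exponent_le hY1 (by linarith)
  have t1 : ‖∑ n ∈ Finset.Icc 1 Y, a n * (n : ℂ) ^ (-s)‖ ≤ P := by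
    refine (norm_sum_le _ _).trans ((Finset.sum_le_sum fun n hn ↦ ?_).trans
      (sum_rpow_neg_le hs hη.le hY))
    rw [norm_mul, hnorm n (Finset.mem_Icc.mp hn).1]
    exact mul_le_of_le_one_left (by positivity) (h.norm_le n)
  have t2 : ‖(∑ n ∈ Finset.Icc 1 Y, a n) * (Y : ℂ) ^ (-s)‖ ≤ P := by
    rw [norm_mul, hnorm Y hY]
    have : ‖∑ n ∈ Finset.Icc 1 Y, a n‖ ≤ Y := by
      refine (norm_sum_le _ _).trans ((Finset.sum_le_sum fun n _ ↦ h.norm_le n).trans (by simp))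
    calc _ ≤ (Y : ℝ) * (Y : ℝ) ^ (-s.re) := by gcongr
      _ ≤ _ := hYs.trans hYP
  have t3 : ‖(κ : ℂ) * (s * ∫ t in (1 : ℝ)..Y, (t : ℂ) ^ (-s))‖ ≤ 5 * P := by
    rw [norm_mul]
    refine (mul_le_of_le_one_left (norm_nonneg _) ?_).trans (norm_mul_integral_cpow_le hη hs hY)
    rw [Complex.norm_real, Real.norm_eq_abs, abs_of_nonneg h.nonneg]; exact h.le_one
  have t4 : ‖s * ∫ t in Set.Ioi (Y : ℝ), (t : ℂ) ^ (-s - 1) * errorTerm a κ t‖ ≤ 6 * P := by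
    rw [norm_mul]
    have hn : ‖s‖ ≤ |s.im| + 3 := by
      refine (Complex.norm_le_abs_re_add_abs_im s).trans ?_
      rw [abs_of_pos hσ]; linarith
    have hdiv : (Y : ℝ) ^ (-s.re) / s.re ≤ 2 * (Y : ℝ) ^ (-s.re) := by
      rw [div_le_iff₀ hσ]
      have : 0 < (Y : ℝ) ^ (-s.re) := by positivity
      nlinarith
    calc _ ≤ (|s.im| + 3) * (2 * B * (2 * (Y : ℝ) ^ (-s.re))) := by
          gcongr
          exact (h.norm_tail_le hσ (by linarith)).trans (by gcongr)
      _ ≤ (3 / 2 * (|s.im| + 2)) * (2 * B * (2 * (Y : ℝ) ^ (-s.re))) := by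
          gcongr; linarith [abs_nonneg s.im]
      _ = 6 * (Z * (Y : ℝ) ^ (-s.re)) := by rw [hZ]; ring
      _ ≤ 6 * (Y * (Y : ℝ) ^ (-s.re)) := by gcongr
      _ ≤ _ := by linarith
  have htot : ‖regPart a κ s‖ ≤ 13 * P := by
    rw [h.regPart_eq hσ hY]
    refine (norm_add_le _ _).trans ?_
    have := (norm_sub_le (∑ n ∈ Finset.Icc 1 Y, a n * (n : ℂ) ^ (-s)
        - (∑ n ∈ Finset.Icc 1 Y, a n) * (Y : ℂ) ^ (-s))
        (κ * (s * ∫ t in (1 : ℝ)..Y, (t : ℂ) ^ (-s))))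
    have := norm_sub_le (∑ n ∈ Finset.Icc 1 Y, a n * (n : ℂ) ^ (-s))
        ((∑ n ∈ Finset.Icc 1 Y, a n) * (Y : ℂ) ^ (-s))
    linarith
  have hPle : P ≤ (1 + 1 / η) * (Y : ℝ) ^ (2 * η) := by
    have hl := Real.log_le_rpow_div (by linarith : (0 : ℝ) ≤ Y) hη
    have e : (Y : ℝ) ^ (2 * η) = (Y : ℝ) ^ η * (Y : ℝ) ^ η := by
      rw [← Real.rpow_add (by linarith)]; ring_nf
    rw [hP, e]
    have : 1 + Real.log Y ≤ (1 + 1 / η) * (Y : ℝ) ^ η := by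
      have : (Y : ℝ) ^ η / η = 1 / η * (Y : ℝ) ^ η := by ring
      nlinarith
    calc _ ≤ (Y : ℝ) ^ η * ((1 + 1 / η) * (Y : ℝ) ^ η) := by gcongr
      _ = _ := by ring
  have hYle : (Y : ℝ) ^ (2 * η) ≤ 2 * Z ^ (2 * η) := by
    calc (Y : ℝ) ^ (2 * η) ≤ (2 * Z) ^ (2 * η) := by gcongr
      _ = 2 ^ (2 * η) * Z ^ (2 * η) := Real.mul_rpow (by norm_num) (by linarith)
      _ ≤ 2 ^ (1 : ℝ) * Z ^ (2 * η) := by gcongr; norm_num; linarith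
      _ = _ := by rw [Real.rpow_one]
  have hpos : 0 < 1 + 1 / η := by positivity
  calc ‖regPart a κ s‖ ≤ 13 * ((1 + 1 / η) * (2 * Z ^ (2 * η))) := by
        refine htot.trans ?_; gcongr; exact hPle.trans (by gcongr)
    _ = 26 * ((1 + 1 / η) * Z ^ (2 * η)) := by ring
    _ ≤ 40 * ((1 + 1 / η) * Z ^ (2 * η)) := by gcongr; norm_num
    _ = _ := by ring

lemma HasMean.norm_deriv_regPart_le (h : HasMean a κ B) {η : ℝ} (hη : 0 < η) (hη2 : η ≤ 1 / 2)
    {s : ℂ} (hs : 1 - η / 2 ≤ s.re) (hs3 : s.re ≤ 5 / 2) :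
    ‖deriv (regPart a κ) s‖ ≤ 160 / η * (1 + 1 / η) * (B * (|s.im| + 2)) ^ (2 * η) := by
  have hB := h.one_le
  have key : ‖deriv (regPart a κ) s‖ ≤
      80 * (1 + 1 / η) * (B * (|s.im| + 2)) ^ (2 * η) / (η / 2) := by
    refine norm_deriv_le_of_forall_mem_sphere_norm_le (by linarith) ?_ fun z hz ↦ ?_
    · refine DifferentiableOn.diffContOnCl fun z hz ↦ ?_
      refine (h.differentiableAt_regPart ?_).differentiableWithinAt
      rw [closure_ball _ (by linarith), mem_closedBall_iff_norm] at hz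
      have := (abs_le.mp ((Complex.abs_re_le_norm (z - s)).trans hz)).1
      simp only [sub_re] at this; linarith
    · rw [mem_sphere_iff_norm] at hz
      have h1 := abs_le.mp ((Complex.abs_re_le_norm (z - s)).trans hz.le)
      have h2 : |z.im| ≤ |s.im| + 1 := by
        have := (Complex.abs_im_le_norm (z - s)).trans hz.le
        simp only [sub_im] at this
        have := abs_sub_abs_le_abs_sub z.im s.im
        linarith
      simp only [sub_re] at h1
      refine (h.norm_regPart_le hη hη2 (by linarith) (by linarith)).trans ?_
      have : (B * (|z.im| + 2)) ^ (2 * η) ≤ 2 * (B * (|s.im| + 2)) ^ (2 * η) := by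
        calc (B * (|z.im| + 2)) ^ (2 * η) ≤ (2 * (B * (|s.im| + 2))) ^ (2 * η) := by
              refine Real.rpow_le_rpow (by positivity) ?_ (by linarith)
              nlinarith [abs_nonneg s.im]
          _ = 2 ^ (2 * η) * (B * (|s.im| + 2)) ^ (2 * η) :=
              Real.mul_rpow (by norm_num) (by positivity)
          _ ≤ 2 ^ (1 : ℝ) * (B * (|s.im| + 2)) ^ (2 * η) := by gcongr; norm_num; linarith
          _ = _ := by rw [Real.rpow_one]
      calc _ ≤ 40 * (1 + 1 / η) * (2 * (B * (|s.im| + 2)) ^ (2 * η)) := by gcongr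
        _ = _ := by ring
  refine key.trans (le_of_eq ?_)
  field_simp
  ring

end Bounds

lemma sum_Icc_one_eq_sum_range {M : Type*} [AddCommMonoid M] (f : ℕ → M) (n : ℕ) :
    ∑ k ∈ Finset.Icc 1 n, f k = ∑ k ∈ Finset.range n, f (k + 1) := by
  induction n with
  | zero => simp
  | succ n ih => rw [Finset.sum_Icc_succ_top (by omega), ih, Finset.sum_range_succ]

lemma sum_range_zmod {M : Type*} [AddCommMonoid M] {q : ℕ} [NeZero q] (b : ZMod q → M) (m : ℕ) :
    ∑ k ∈ Finset.range q, b ((m + k : ℕ) : ZMod q) = ∑ x, b x := by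
  refine Finset.sum_nbij (fun k ↦ ((m + k : ℕ) : ZMod q)) (by simp) ?_ ?_ (by simp)
  · intro k hk l hl hkl
    simp only [Finset.coe_range, Set.mem_Iio] at hk hl
    have := (ZMod.natCast_eq_natCast_iff _ _ _).mp hkl
    exact (Nat.ModEq.add_left_cancel' m this).eq_of_lt_of_lt hk hl
  · intro x _
    refine ⟨(x - m).val, by simpa using ZMod.val_lt _, by simp⟩

lemma hasMean_zmod {q : ℕ} [NeZero q] {b : ZMod q → ℂ} (hb : ∀ x, ‖b x‖ ≤ 1) {κ : ℝ}
    (h0 : 0 ≤ κ) (h1 : κ ≤ 1) (hs : ∑ x, b x = κ * q) :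
    HasMean (fun n ↦ b n) κ (2 * q) where
  norm_le n := hb n
  nonneg := h0
  le_one := h1
  one_le := by
    have : (1 : ℝ) ≤ q := by exact_mod_cast NeZero.one_le
    linarith
  sum_sub_le n := by
    set E : ℕ → ℂ := fun n ↦ ∑ k ∈ Finset.Icc 1 n, b k - κ * n with hE
    have hper : Function.Periodic E q := by
      intro n
      simp only [hE, sum_Icc_one_eq_sum_range, Finset.sum_range_add]
      have := sum_range_zmod b (n + 1)
      simp only [add_right_comm n 1] at this
      rw [this, hs]; push_cast; ring
    rw [show ∑ k ∈ Finset.Icc 1 n, b k - κ * n = E n from rfl, ← hper.map_mod_nat]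
    set r := n % q
    have hr : r ≤ q := (Nat.mod_lt _ (NeZero.pos q)).le
    refine (norm_sub_le _ _).trans ?_
    have e1 : ‖∑ k ∈ Finset.Icc 1 r, b k‖ ≤ r := by
      simpa using norm_sum_le_of_le (Finset.Icc 1 r) fun (k : ℕ) _ ↦ hb k
    have e2 : ‖(κ : ℂ) * r‖ ≤ r := by
      rw [norm_mul, Complex.norm_real, Real.norm_eq_abs, abs_of_nonneg h0, Complex.norm_natCast]
      exact mul_le_of_le_one_left (by positivity) h1
    have : (r : ℝ) ≤ q := by exact_mod_cast hr
    linarith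

lemma hasMean_char {q : ℕ} [NeZero q] {χ : DirichletCharacter ℂ q} (hχ : χ ≠ 1) :
    HasMean (fun n ↦ χ n) 0 (2 * q) :=
  hasMean_zmod (fun x ↦ χ.norm_le_one x) le_rfl zero_le_one
    (by simpa using MulChar.sum_eq_zero_of_ne_one hχ)

lemma hasMean_one_char (q : ℕ) [NeZero q] :
    HasMean (fun n ↦ (1 : DirichletCharacter ℂ q) n) ((q.totient : ℝ) / q) (2 * q) := by
  have hq : (0 : ℝ) < q := by exact_mod_cast NeZero.pos q
  refine hasMean_zmod (fun x ↦ DirichletCharacter.norm_le_one _ x) (by positivity) ?_ ?_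
  · rw [div_le_one hq]; exact_mod_cast Nat.totient_le q
  · rw [MulChar.sum_one_eq_card_units, ZMod.card_units_eq_totient]
    have : (q : ℂ) ≠ 0 := by exact_mod_cast hq.ne'
    push_cast; field_simp

lemma exists_hasMean_char {q : ℕ} [NeZero q] (χ : DirichletCharacter ℂ q) :
    ∃ κ : ℝ, HasMean (fun n ↦ χ n) κ (2 * q) := by
  by_cases h : χ = 1
  · subst h; exact ⟨_, hasMean_one_char q⟩
  · exact ⟨0, hasMean_char h⟩

/-- A common upper bound for the Dirichlet series with coefficients bounded by `1`. -/
lemma exists_norm_LSeries_le : ∃ C : ℝ, 1 ≤ C ∧ ∀ a : ℕ → ℂ, (∀ n, ‖a n‖ ≤ 1) →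
    ∀ s : ℂ, 1 < s.re → s.re ≤ 2 → ‖LSeries a s‖ ≤ C / (s.re - 1) := by
  have h1 : HasMean (fun _ ↦ 1) 1 1 := by
    refine ⟨by simp, fun n ↦ by simp, le_rfl, zero_le_one, le_rfl⟩
  refine ⟨2 + 40 * (1 + 1 / (1 / 2)) * (1 * (|0| + 2)) ^ (2 * (1 / 2 : ℝ)), ?_, ?_⟩
  · norm_num
  intro a ha s hs hs2
  have hle : ‖LSeries a s‖ ≤ ‖LSeries (fun _ ↦ 1) (s.re : ℂ)‖ := by
    have hsum := (h1.summable (s := (s.re : ℂ)) (by simpa))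
    have hsum' : Summable (fun n ↦ ‖LSeries.term (fun _ ↦ 1) (s.re : ℂ) n‖) := hsum.norm
    have e : LSeries (fun _ ↦ 1) (s.re : ℂ) =
        ((∑' n, ‖LSeries.term (fun _ ↦ 1) (s.re : ℂ) n‖ : ℝ) : ℂ) := by
      rw [LSeries, Complex.ofReal_tsum]
      congr 1; ext n
      rcases eq_or_ne n 0 with rfl | hn
      · simp
      · rw [LSeries.term_of_ne_zero hn, norm_div, norm_one,
          Complex.norm_natCast_cpow_of_pos (by omega)]
        push_cast
        simp only [ofReal_re]
        rw [Complex.ofReal_cpow (by positivity)]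
        simp
    rw [e, Complex.norm_real, Real.norm_of_nonneg (tsum_nonneg fun _ ↦ norm_nonneg _)]
    refine tsum_of_norm_bounded hsum'.hasSum fun n ↦ ?_
    rcases eq_or_ne n 0 with rfl | hn
    · simp
    · rw [LSeries.term_of_ne_zero hn, LSeries.term_of_ne_zero hn, norm_div, norm_div, norm_one,
        Complex.norm_natCast_cpow_of_pos (by omega), Complex.norm_natCast_cpow_of_pos (by omega),
        Complex.ofReal_re]
      gcongr
      exact ha n
  refine hle.trans ?_
  have hpos : 0 < s.re - 1 := by linarith
  rw [h1.LSeries_eq (by simpa)]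
  have hb := h1.norm_regPart_le (η := 1 / 2) (s := (s.re : ℂ)) (by norm_num) le_rfl
    (by simp; linarith) (by simp; linarith)
  rw [Complex.ofReal_im] at hb
  refine (norm_add_le _ _).trans ?_
  rw [add_div]
  refine add_le_add ?_ ?_
  · rw [show ((s.re : ℂ) - 1) = ((s.re - 1 : ℝ) : ℂ) by push_cast; rfl, ← Complex.ofReal_div,
      ← Complex.ofReal_mul, Complex.norm_real, one_mul, Real.norm_of_nonneg (by
        apply div_nonneg <;> linarith)]
    gcongr
  · rw [le_div_iff₀ hpos]
    exact (mul_le_of_le_one_right (norm_nonneg _) (by linarith)).trans hb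

/-- Lower bounds from the inequality `3 + 4 cos θ + cos 2θ ≥ 0`. -/
lemma norm_ge_of_product_ge_one {F : ℂ → ℂ} {t M C D : ℝ} (hM : 1 ≤ M) (hC : 1 ≤ C) (hD : 1 ≤ D)
    (hd : ∀ s : ℂ, 1 < s.re → s.re ≤ 2 → s.im = t → DifferentiableAt ℂ F s)
    (hM' : ∀ s : ℂ, 1 < s.re → s.re ≤ 2 → s.im = t → ‖deriv F s‖ ≤ M)
    (h : ∀ s : ℂ, 1 < s.re → s.re ≤ 2 → s.im = t → 1 ≤ (C / (s.re - 1)) ^ 3 * ‖F s‖ ^ 4 * D)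
    {s : ℂ} (hs : 1 < s.re) (hs2 : s.re ≤ 2) (hst : s.im = t) :
    1 / (16 * M ^ 3 * C ^ 3 * D) ≤ ‖F s‖ := by
  set r := 1 / (16 * M ^ 4 * C ^ 3 * D) with hr
  have hr0 : 0 < r := by positivity
  have hr1 : r ≤ 1 := by
    rw [hr, div_le_one (by positivity)]
    have := one_le_pow₀ hM (n := 4)
    have := one_le_pow₀ hC (n := 3)
    calc (1 : ℝ) ≤ 16 * 1 * 1 * 1 := by norm_num
      _ ≤ _ := by gcongr
  have hMr : 1 / (16 * M ^ 3 * C ^ 3 * D) = M * r := by rw [hr]; field_simp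
  rw [hMr]
  have far : ∀ s : ℂ, 1 < s.re → s.re ≤ 2 → s.im = t → r ≤ s.re - 1 → 2 * (M * r) ≤ ‖F s‖ := by
    intro s hs hs2 hst hsr
    have h1 := h s hs hs2 hst
    have h2 : (C / (s.re - 1)) ^ 3 ≤ (C / r) ^ 3 := by gcongr
    have h3 : 1 ≤ (C / r) ^ 3 * ‖F s‖ ^ 4 * D := h1.trans (by gcongr)
    have h4 : (2 * (M * r)) ^ 4 ≤ ‖F s‖ ^ 4 := by
      have e : (2 * (M * r)) ^ 4 * ((C / r) ^ 3 * D) = 1 := by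
        rw [hr]; field_simp; norm_num
      have hp : 0 < (C / r) ^ 3 * D := by positivity
      have : (2 * (M * r)) ^ 4 * ((C / r) ^ 3 * D) ≤ ‖F s‖ ^ 4 * ((C / r) ^ 3 * D) := by
        rw [e]; linarith
      exact le_of_mul_le_mul_right this hp
    exact le_of_pow_le_pow_left₀ (by norm_num) (norm_nonneg _) h4
  rcases le_or_gt r (s.re - 1) with hsr | hsr
  · have := far s hs hs2 hst hsr
    nlinarith [mul_pos (by linarith : 0 < M) hr0]
  · set s' : ℂ := ⟨1 + r, t⟩ with hs'
    have h1 := far s' (by simp [hs', hr0]) (by simp [hs']; linarith) rfl (by simp [hs'])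
    have hconv : Convex ℝ {z : ℂ | 1 < z.re ∧ z.re ≤ 2 ∧ z.im = t} := by
      have e : {z : ℂ | 1 < z.re ∧ z.re ≤ 2 ∧ z.im = t} =
        {z : ℂ | 1 < z.re} ∩ ({z : ℂ | z.re ≤ 2} ∩ {z : ℂ | z.im = t}) := rfl
      rw [e]
      exact (convex_halfSpace_re_gt 1).inter ((convex_halfSpace_re_le 2).inter
        (convex_hyperplane (f := Complex.im) ⟨by simp, by simp⟩ t))
    have h2 := hconv.norm_image_sub_le_of_norm_deriv_le (f := F) (C := M) (x := s) (y := s')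
      (fun z hz ↦ hd z hz.1 hz.2.1 hz.2.2) (fun z hz ↦ hM' z hz.1 hz.2.1 hz.2.2) ⟨hs, hs2, hst⟩
      ⟨by simp [hs', hr0], by simp [hs']; linarith, rfl⟩
    have h3 : ‖s' - s‖ ≤ r := by
      have e : s' - s = ((1 + r - s.re : ℝ) : ℂ) := by
        apply Complex.ext <;> simp [hs', hst]
      rw [e, Complex.norm_real, Real.norm_eq_abs, abs_le]
      constructor <;> linarith
    have h4 : ‖F s' - F s‖ ≤ M * r := h2.trans (by gcongr)
    have h5 := norm_sub_norm_le (F s') (F s)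
    linarith

section Continuation
variable {a : ℕ → ℂ} {κ B : ℝ}

/-- The continuation of the Dirichlet series of `a` to `re s > 0`, `s ≠ 1`. -/
noncomputable def contSeries (a : ℕ → ℂ) (κ : ℝ) (s : ℂ) : ℂ := κ * (s / (s - 1)) + regPart a κ s

/-- The constant in the bounds for `regPart` and its derivative. -/
noncomputable def boundConst (η : ℝ) : ℝ := 320 / η * (1 + 1 / η)

lemma boundConst_ge {η : ℝ} (hη : 0 < η) (hη2 : η ≤ 1 / 2) : 320 / η ≤ boundConst η := by
  rw [boundConst]
  have : 0 < 320 / η := by positivity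
  have : 0 < 1 / η := by positivity
  nlinarith

lemma le_boundConst {η : ℝ} (hη : 0 < η) (hη2 : η ≤ 1 / 2) : 640 ≤ boundConst η := by
  refine le_trans ?_ (boundConst_ge hη hη2)
  rw [le_div_iff₀ hη]; linarith

lemma HasMean.one_le_height (h : HasMean a κ B) (t : ℝ) : 1 ≤ B * (|t| + 2) := by
  nlinarith [h.one_le, abs_nonneg t]

lemma HasMean.contSeries_eq (h : HasMean a κ B) {s : ℂ} (hs : 1 < s.re) :
    LSeries a s = contSeries a κ s := h.LSeries_eq hs

lemma HasMean.norm_contSeries_le (h : HasMean a κ B) {η : ℝ} (hη : 0 < η) (hη2 : η ≤ 1 / 2) {s : ℂ}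
    (hs : 1 ≤ s.re) (hs3 : s.re ≤ 3) (hκ : κ = 0 ∨ 1 / 2 ≤ |s.im|) :
    ‖contSeries a κ s‖ ≤ boundConst η * (B * (|s.im| + 2)) ^ (2 * η) := by
  have h1 := h.norm_regPart_le hη hη2 (by linarith) hs3
  have hZ := Real.one_le_rpow (h.one_le_height s.im) (by linarith : 0 ≤ 2 * η)
  set Z := (B * (|s.im| + 2)) ^ (2 * η)
  have h2 : ‖(κ : ℂ) * (s / (s - 1))‖ ≤ 3 := by
    rcases hκ with rfl | him
    · simp
    · have hn : 1 / 2 ≤ ‖s - 1‖ := him.trans (by simpa using Complex.abs_im_le_norm (s - 1))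
      rw [norm_mul, Complex.norm_real, Real.norm_of_nonneg h.nonneg, norm_div]
      have : ‖s‖ ≤ ‖s - 1‖ + 1 := by simpa using norm_add_le (s - 1) 1
      calc κ * (‖s‖ / ‖s - 1‖) ≤ 1 * (‖s‖ / ‖s - 1‖) := by gcongr; exact h.le_one
        _ ≤ 3 := by rw [one_mul, div_le_iff₀ (by linarith)]; linarith
  have h3 : boundConst η = 8 / η * (40 * (1 + 1 / η)) := by rw [boundConst]; ring
  have h4 : 16 ≤ 8 / η := by rw [le_div_iff₀ hη]; linarith
  have h5 : 40 ≤ 40 * (1 + 1 / η) := by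
    have : 0 < 1 / η := by positivity
    linarith
  calc _ ≤ 3 + 40 * (1 + 1 / η) * Z := (norm_add_le _ _).trans (add_le_add h2 h1)
    _ ≤ 40 * (1 + 1 / η) * Z + 40 * (1 + 1 / η) * Z := by nlinarith
    _ = 2 * (40 * (1 + 1 / η)) * Z := by ring
    _ ≤ _ := by rw [h3]; gcongr; linarith

lemma HasMean.differentiableAt_contSeries (h : HasMean a κ B) {s : ℂ} (hs : 0 < s.re)
    (hκ : κ = 0 ∨ s ≠ 1) : DifferentiableAt ℂ (contSeries a κ) s := by
  refine DifferentiableAt.add ?_ (h.differentiableAt_regPart hs)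
  rcases hκ with rfl | hs1
  · simp
  · exact (DifferentiableAt.div (c := fun s : ℂ ↦ s) (d := fun s ↦ s - 1) differentiableAt_id
      (by fun_prop) (sub_ne_zero.mpr hs1)).const_mul _

lemma ne_one_of_im {s : ℂ} (h : 1 / 2 ≤ |s.im|) : s ≠ 1 := by
  rintro rfl; norm_num at h

lemma HasMean.norm_deriv_contSeries_le (h : HasMean a κ B) {η : ℝ} (hη : 0 < η) (hη2 : η ≤ 1 / 2)
    {s : ℂ} (hs : 1 - η / 2 ≤ s.re) (hs3 : s.re ≤ 5 / 2) (hκ : κ = 0 ∨ 1 / 2 ≤ |s.im|) :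
    ‖deriv (contSeries a κ) s‖ ≤ boundConst η * (B * (|s.im| + 2)) ^ (2 * η) := by
  have h1 := h.norm_deriv_regPart_le hη hη2 hs hs3
  have hZ := Real.one_le_rpow (h.one_le_height s.im) (by linarith : 0 ≤ 2 * η)
  set Z := (B * (|s.im| + 2)) ^ (2 * η)
  have hd := h.differentiableAt_regPart (s := s) (by linarith)
  have h2 : ‖deriv (contSeries a κ) s‖ ≤ 4 + ‖deriv (regPart a κ) s‖ := by
    rcases hκ with rfl | him
    · have : contSeries a 0 = regPart a 0 := by ext; simp [contSeries]
      rw [this]; linarith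
    · have hn : 1 / 2 ≤ ‖s - 1‖ := him.trans (by simpa using Complex.abs_im_le_norm (s - 1))
      have hs1 : s - 1 ≠ 0 := sub_ne_zero.mpr (ne_one_of_im him)
      have hder : HasDerivAt (contSeries a κ)
          (κ * ((1 * (s - 1) - s * 1) / (s - 1) ^ 2) + deriv (regPart a κ) s) s :=
        (((hasDerivAt_id s).div ((hasDerivAt_id s).sub_const 1) hs1).const_mul _).add hd.hasDerivAt
      rw [hder.deriv]
      refine (norm_add_le _ _).trans (add_le_add_left ?_ _)
      rw [norm_mul, Complex.norm_real, Real.norm_of_nonneg h.nonneg,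
        show 1 * (s - 1) - s * 1 = -1 by ring, norm_div, norm_pow, norm_neg, norm_one]
      have : 1 / ‖s - 1‖ ^ 2 ≤ 4 := by
        rw [div_le_iff₀ (by positivity)]; nlinarith
      calc κ * (1 / ‖s - 1‖ ^ 2) ≤ 1 * 4 := by gcongr; exact h.le_one
        _ = 4 := by ring
  have h3 : boundConst η = 2 * (160 / η * (1 + 1 / η)) := by rw [boundConst]; ring
  have h4 := le_boundConst hη hη2
  rw [h3] at h4 ⊢
  nlinarith

end Continuation

section Height

variable {q : ℕ} [NeZero q]

/-- The size parameter of a character modulo `q` at height `t`. -/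
noncomputable def height (q : ℕ) (t : ℝ) : ℝ := 2 * q * (|t| + 2)

lemma one_le_height (t : ℝ) : 4 ≤ height q t := by
  have : (1 : ℝ) ≤ q := by exact_mod_cast NeZero.one_le
  rw [height]; nlinarith [abs_nonneg t]

lemma exists_char_lower {η : ℝ} (hη : 0 < η) (hη2 : η ≤ 1 / 2) : ∃ c : ℝ, 0 < c ∧ c ≤ 1 ∧
    ∀ (q : ℕ) [NeZero q] (χ : DirichletCharacter ℂ q) (κ t D : ℝ),
      HasMean (fun n ↦ χ n) κ (2 * q) → (κ = 0 ∨ 1 / 2 ≤ |t|) → 1 ≤ D →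
      (∀ s : ℂ, 1 < s.re → s.re ≤ 2 → s.im = 2 * t →
        ‖LSeries (fun n ↦ (χ ^ 2) n) s‖ ≤ D * height q t ^ (2 * η)) →
      ∀ s : ℂ, 1 < s.re → s.re ≤ 2 → s.im = t →
        c / (D * height q t ^ (8 * η)) ≤ ‖LSeries (fun n ↦ χ n) s‖ := by
  obtain ⟨C, hC1, hC⟩ := exists_norm_LSeries_le
  have hK := le_boundConst hη hη2
  set K := boundConst η with hKdef
  have hden : 1 ≤ 16 * K ^ 3 * C ^ 3 := by
    have := one_le_pow₀ (by linarith : 1 ≤ K) (n := 3)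
    have := one_le_pow₀ hC1 (n := 3)
    calc (1 : ℝ) ≤ 16 * 1 * 1 := by norm_num
      _ ≤ _ := by gcongr
  refine ⟨1 / (16 * K ^ 3 * C ^ 3), by positivity, by rw [div_le_one (by positivity)]; exact hden, ?_⟩
  intro q _ χ κ t D hm hκ hD hsq s hs hs2 hst
  have hZ0 : 4 ≤ height q t := one_le_height (q := q) t
  have hZ := Real.one_le_rpow (by linarith : 1 ≤ height q t) (by linarith : 0 ≤ 2 * η)
  have hκ' {s : ℂ} (hst : s.im = t) : κ = 0 ∨ 1 / 2 ≤ |s.im| := hst ▸ hκ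
  have key := norm_ge_of_product_ge_one (F := contSeries (fun n ↦ χ n) κ) (t := t)
    (M := K * height q t ^ (2 * η)) (C := C) (D := D * height q t ^ (2 * η))
    (by nlinarith) hC1 (by nlinarith)
    (fun s hs _ hst ↦ hm.differentiableAt_contSeries (by linarith)
      ((hκ' hst).imp_right ne_one_of_im))
    (fun s hs hs2 hst ↦ by
      have := hm.norm_deriv_contSeries_le hη hη2 (s := s) (by linarith) (by linarith) (hκ' hst)
      rwa [hst] at this)
    (fun s hs hs2 hst ↦ by
      have hx : 0 < s.re - 1 := by linarith
      have h1 := DirichletCharacter.norm_LSeries_product_ge_one χ hx t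
      have e1 : (1 + (s.re - 1 : ℝ) : ℂ) = (s.re : ℂ) := by push_cast; ring
      have e2 : (s.re : ℂ) + I * t = s := by
        rw [← hst]; apply Complex.ext <;> simp
      rw [e1, e2, norm_mul, norm_mul, norm_pow, norm_pow] at h1
      rw [← hm.contSeries_eq hs]
      refine le_trans h1 ?_
      have b1 := hC (fun n ↦ (1 : DirichletCharacter ℂ q) n)
        (fun n ↦ DirichletCharacter.norm_le_one _ _) (s.re : ℂ) (by simpa) (by simpa)
      have b2 := hsq (s.re + 2 * I * t) (by simpa) (by simpa) (by simp)
      simp only [Complex.ofReal_re] at b1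
      gcongr) hs hs2 hst
  rw [hm.contSeries_eq hs]
  refine le_trans (le_of_eq ?_) key
  have e : height q t ^ (8 * η) = (height q t ^ (2 * η)) ^ 4 := by
    rw [← Real.rpow_natCast, ← Real.rpow_mul (by linarith)]; congr 1; push_cast; ring
  rw [e]
  field_simp

lemma height_two_mul_le {η : ℝ} (hη : 0 < η) (hη2 : η ≤ 1 / 2) (t : ℝ) :
    height q (2 * t) ^ (2 * η) ≤ 2 * height q t ^ (2 * η) := by
  have hZ0 : 4 ≤ height q t := one_le_height (q := q) t
  calc height q (2 * t) ^ (2 * η) ≤ (2 * height q t) ^ (2 * η) := by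
        refine Real.rpow_le_rpow (by unfold height; positivity) ?_ (by linarith)
        unfold height
        rw [abs_mul, abs_two]
        have : (1 : ℝ) ≤ q := by exact_mod_cast NeZero.one_le
        nlinarith
    _ = 2 ^ (2 * η) * height q t ^ (2 * η) := Real.mul_rpow (by norm_num) (by linarith)
    _ ≤ 2 ^ (1 : ℝ) * height q t ^ (2 * η) := by gcongr; norm_num; linarith
    _ = _ := by rw [Real.rpow_one]

/-- Lower bound for characters of order greater than two. -/
lemma exists_complex_lower {η : ℝ} (hη : 0 < η) (hη2 : η ≤ 1 / 2) : ∃ c : ℝ, 0 < c ∧ c ≤ 1 ∧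
    ∀ (q : ℕ) [NeZero q] (χ : DirichletCharacter ℂ q), χ ^ 2 ≠ 1 →
      ∀ s : ℂ, 1 < s.re → s.re ≤ 2 →
        c / height q s.im ^ (8 * η) ≤ ‖LSeries (fun n ↦ χ n) s‖ := by
  obtain ⟨c, hc, hc1, h⟩ := exists_char_lower hη hη2
  have hK := le_boundConst hη hη2
  refine ⟨c / (2 * boundConst η), by positivity, ?_, fun q _ χ hχ s hs hs2 ↦ ?_⟩
  · rw [div_le_one (by linarith)]; linarith
  have hχ1 : χ ≠ 1 := by rintro rfl; simp at hχ
  rw [div_div]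
  refine h q χ 0 s.im (2 * boundConst η) (hasMean_char hχ1) (Or.inl rfl) (by linarith) ?_ s hs hs2 rfl
  intro z hz hz2 hzt
  have hm := hasMean_char hχ
  rw [hm.contSeries_eq hz]
  refine (hm.norm_contSeries_le hη hη2 (s := z) hz.le (by linarith) (Or.inl rfl)).trans ?_
  rw [hzt]
  have := mul_le_mul_of_nonneg_left (height_two_mul_le (q := q) hη hη2 s.im)
    (by linarith : 0 ≤ boundConst η)
  refine this.trans (le_of_eq (by ring))

/-- Lower bound away from the real axis, for an arbitrary character. -/
lemma exists_real_lower {η : ℝ} (hη : 0 < η) (hη2 : η ≤ 1 / 2) : ∃ c : ℝ, 0 < c ∧ c ≤ 1 ∧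
    ∀ (q : ℕ) [NeZero q] (χ : DirichletCharacter ℂ q) (κ : ℝ), HasMean (fun n ↦ χ n) κ (2 * q) →
      ∀ s : ℂ, 1 < s.re → s.re ≤ 2 → (κ = 0 ∨ 1 / 2 ≤ |s.im|) → ∀ τ : ℝ, 0 < τ → τ ≤ 1 →
        τ ≤ |s.im| → c * τ / height q s.im ^ (8 * η) ≤ ‖LSeries (fun n ↦ χ n) s‖ := by
  obtain ⟨c, hc, hc1, h⟩ := exists_char_lower hη hη2
  have hK := le_boundConst hη hη2
  refine ⟨c / (3 * boundConst η), by positivity, ?_, fun q _ χ κ hm s hs hs2 hκ τ hτ hτ1 hτs ↦ ?_⟩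
  · rw [div_le_one (by linarith)]; linarith
  have e : c / (3 * boundConst η) * τ / height q s.im ^ (8 * η) =
      c / ((3 * boundConst η / τ) * height q s.im ^ (8 * η)) := by field_simp
  have hD : 3 * boundConst η ≤ 3 * boundConst η / τ := by
    rw [le_div_iff₀ hτ]; nlinarith
  rw [e]
  refine h q χ κ s.im (3 * boundConst η / τ) hm hκ (by linarith) ?_ s hs hs2 rfl
  intro z hz hz2 hzt
  obtain ⟨κ', hm'⟩ := exists_hasMean_char (χ ^ 2)
  rw [hm'.LSeries_eq hz]
  have hZ0 : 4 ≤ height q s.im := one_le_height s.im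
  have hZ := Real.one_le_rpow (by linarith : 1 ≤ height q s.im) (by linarith : 0 ≤ 2 * η)
  have b1 : ‖(κ' : ℂ) * (z / (z - 1))‖ ≤ 2 / τ := by
    have hn : τ ≤ ‖z - 1‖ := by
      have := Complex.abs_im_le_norm (z - 1)
      simp only [sub_im, one_im, sub_zero, hzt, abs_mul, abs_two] at this
      linarith
    have hn0 : 0 < ‖z - 1‖ := by linarith
    rw [norm_mul, Complex.norm_real, Real.norm_of_nonneg hm'.nonneg, norm_div]
    have : ‖z‖ ≤ ‖z - 1‖ + 1 := by simpa using norm_add_le (z - 1) 1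
    calc κ' * (‖z‖ / ‖z - 1‖) ≤ 1 * (‖z‖ / ‖z - 1‖) := by gcongr; exact hm'.le_one
      _ ≤ 1 * ((‖z - 1‖ + 1) / ‖z - 1‖) := by gcongr
      _ = 1 + 1 / ‖z - 1‖ := by field_simp
      _ ≤ 1 / τ + 1 / τ := by gcongr; rw [le_div_iff₀ hτ]; linarith
      _ = _ := by ring
  have b2 := hm'.norm_regPart_le hη hη2 (s := z) (by linarith) (by linarith)
  have b3 : 40 * (1 + 1 / η) * 2 ≤ boundConst η := by
    have h4 : 16 ≤ 8 / η := by rw [le_div_iff₀ hη]; linarith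
    have h3 : boundConst η = 8 / η * (40 * (1 + 1 / η)) := by rw [boundConst]; ring
    have : 0 < 40 * (1 + 1 / η) := by positivity
    rw [h3]; nlinarith
  have b4 : (2 * (q : ℝ) * (|z.im| + 2)) ^ (2 * η) ≤ 2 * height q s.im ^ (2 * η) := by
    rw [hzt]; exact height_two_mul_le hη hη2 s.im
  calc _ ≤ 2 / τ + 40 * (1 + 1 / η) * (2 * height q s.im ^ (2 * η)) :=
        (norm_add_le _ _).trans (add_le_add b1 (b2.trans (by gcongr)))
    _ = 2 / τ + (40 * (1 + 1 / η) * 2) * height q s.im ^ (2 * η) := by ring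
    _ ≤ 2 / τ * height q s.im ^ (2 * η) + boundConst η / τ * height q s.im ^ (2 * η) := by
        gcongr
        · exact le_mul_of_one_le_right (by positivity) hZ
        · refine b3.trans ?_; rw [le_div_iff₀ hτ]; nlinarith
    _ = (2 + boundConst η) / τ * height q s.im ^ (2 * η) := by ring
    _ ≤ _ := by gcongr; linarith

end Height

lemma cube_mul_cosh_le (w : ℝ) (hw : 0 ≤ w) : w ^ 3 * Real.cosh w ≤ Real.sinh w ^ 3 := by
  have h1 : HasSum (fun n : ℕ ↦ w ^ 3 * (w ^ (2 * n) / (2 * n).factorial)) (w ^ 3 * Real.cosh w) :=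
    (Real.hasSum_cosh w).mul_left _
  have h3 : HasSum (fun n : ℕ ↦ ((3 * w) ^ (2 * n + 1) / (2 * n + 1).factorial -
      3 * (w ^ (2 * n + 1) / (2 * n + 1).factorial)) / 4) (Real.sinh w ^ 3) := by
    have := ((Real.hasSum_sinh (3 * w)).sub ((Real.hasSum_sinh w).mul_left 3)).div_const 4
    convert! this using 1
    rw [Real.sinh_three_mul]; ring
  have h4 := (hasSum_nat_add_iff' 1).mpr h3
  simp only [Finset.sum_range_one, mul_zero, zero_add, pow_one, Nat.factorial_one, Nat.cast_one,
    div_one, sub_self, zero_div, sub_zero] at h4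
  refine hasSum_le (fun n ↦ ?_) h1 h4
  have hpow : 4 * ((2 * (n : ℝ) + 3) * ((2 * n + 2) * (2 * n + 1))) + 3 ≤ 3 ^ (2 * n + 3) := by
    induction n with
    | zero => norm_num
    | succ n ih =>
      have e : (3 : ℝ) ^ (2 * (n + 1) + 3) = 9 * 3 ^ (2 * n + 3) := by ring
      rw [e]; push_cast
      have hn : (0 : ℝ) ≤ n := by positivity
      nlinarith [pow_nonneg hn 2, pow_nonneg hn 3]
  have hf : (((2 * (n + 1) + 1).factorial : ℕ) : ℝ) =
      (2 * n + 3) * ((2 * n + 2) * ((2 * n + 1) * (2 * n).factorial)) := by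
    rw [show 2 * (n + 1) + 1 = 2 * n + 1 + 1 + 1 by ring, Nat.factorial_succ, Nat.factorial_succ,
      Nat.factorial_succ]
    push_cast; ring
  rw [hf]
  have hF : (0 : ℝ) < (2 * n).factorial := by positivity
  rw [show 2 * (n + 1) + 1 = 2 * n + 3 by ring, mul_pow]
  have e : (3 ^ (2 * n + 3) * w ^ (2 * n + 3) /
        ((2 * n + 3) * ((2 * n + 2) * ((2 * n + 1) * ((2 * n).factorial : ℝ)))) -
      3 * (w ^ (2 * n + 3) /
        ((2 * n + 3) * ((2 * n + 2) * ((2 * n + 1) * ((2 * n).factorial : ℝ)))))) / 4 =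
      (3 ^ (2 * n + 3) - 3) / (4 * ((2 * (n : ℝ) + 3) * ((2 * n + 2) * (2 * n + 1)))) *
      (w ^ 3 * (w ^ (2 * n) / (2 * n).factorial)) := by
    field_simp
    ring
  rw [e]
  refine le_mul_of_one_le_left (by positivity) ?_
  rw [one_le_div (by positivity)]
  linarith

/-- The difference between `1 / v` and the generating function of the geometric series. -/
noncomputable def lambertKernel (v : ℝ) : ℝ := 1 / v - 1 / (Real.exp v - 1)

lemma exp_sub_one_pos {v : ℝ} (hv : 0 < v) : 0 < Real.exp v - 1 := by
  linarith [Real.add_one_lt_exp hv.ne']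

lemma convexOn_lambertKernel : ConvexOn ℝ (Set.Ioi 0) lambertKernel := by
  have hd1 (v : ℝ) (hv : 0 < v) : HasDerivAt lambertKernel
      (-1 / v ^ 2 + Real.exp v / (Real.exp v - 1) ^ 2) v := by
    have h := exp_sub_one_pos hv
    have := ((hasDerivAt_id v).fun_inv hv.ne').sub
      (((Real.hasDerivAt_exp v).sub_const 1).fun_inv h.ne')
    convert! this using 1
    · ext; simp [lambertKernel]
    · simp only [id]; ring
  have hd2 (v : ℝ) (hv : 0 < v) : HasDerivAt (fun v ↦ -1 / v ^ 2 + Real.exp v / (Real.exp v - 1) ^ 2)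
      (2 / v ^ 3 - Real.exp v * (Real.exp v + 1) / (Real.exp v - 1) ^ 3) v := by
    have h := exp_sub_one_pos hv
    have h1 := (hasDerivAt_const v (-1 : ℝ)).fun_div ((hasDerivAt_id v).fun_pow 2)
      (pow_ne_zero 2 hv.ne')
    have h2 := (Real.hasDerivAt_exp v).fun_div (((Real.hasDerivAt_exp v).sub_const 1).fun_pow 2)
      (pow_ne_zero 2 h.ne')
    convert! h1.add h2 using 1
    have := hv.ne'
    have := h.ne'
    simp only [id]
    field_simp
    ring
  refine convexOn_of_hasDerivWithinAt2_nonneg (convex_Ioi 0)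
    (fun v hv ↦ (hd1 v hv).continuousAt.continuousWithinAt)
    (fun v hv ↦ (hd1 v (interior_subset hv)).hasDerivWithinAt)
    (fun v hv ↦ (hd2 v (interior_subset hv)).hasDerivWithinAt) fun v hv ↦ ?_
  have hv0 : 0 < v := interior_subset hv
  have h := exp_sub_one_pos hv0
  rw [sub_nonneg, div_le_div_iff₀ (by positivity) (by positivity)]
  have key := cube_mul_cosh_le (v / 2) (by linarith)
  set E := Real.exp (v / 2) with hE
  have hE0 : 0 < E := Real.exp_pos _
  have e1 : Real.exp v = E ^ 2 := by rw [hE, ← Real.exp_nat_mul]; congr 1; push_cast; ring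
  have e2 : Real.exp (-(v / 2)) = E⁻¹ := Real.exp_neg _
  rw [Real.cosh_eq, Real.sinh_eq, e2, ← hE] at key
  rw [e1]
  have k1 : (E - E⁻¹) = (E ^ 2 - 1) / E := by field_simp
  have k2 : (E + E⁻¹) = (E ^ 2 + 1) / E := by field_simp
  rw [k1, k2] at key
  have k3 := mul_le_mul_of_nonneg_left key (by positivity : 0 ≤ 16 * E ^ 3)
  have k4 : 16 * E ^ 3 * ((v / 2) ^ 3 * ((E ^ 2 + 1) / E / 2)) = E ^ 2 * (E ^ 2 + 1) * v ^ 3 := by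
    field_simp; norm_num
  have k5 : 16 * E ^ 3 * ((E ^ 2 - 1) / E / 2) ^ 3 = 2 * (E ^ 2 - 1) ^ 3 := by
    field_simp; ring
  linarith

lemma lambertKernel_le {v : ℝ} (hv : 0 < v) : lambertKernel v ≤ 1 / 2 := by
  have h := exp_sub_one_pos hv
  have key : Real.exp v * (2 - v) ≤ 2 + v := by
    have hd (x : ℝ) : HasDerivAt (fun x ↦ 2 + x - Real.exp x * (2 - x))
        (1 - (Real.exp x * (2 - x) + Real.exp x * (-1))) x := by
      exact ((hasDerivAt_id x).const_add 2).sub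
        ((Real.hasDerivAt_exp x).mul ((hasDerivAt_id x).const_sub 2))
    have hm : MonotoneOn (fun x ↦ 2 + x - Real.exp x * (2 - x)) (Set.Ici 0) := by
      refine monotoneOn_of_hasDerivWithinAt_nonneg (convex_Ici 0)
        (fun x _ ↦ (hd x).continuousAt.continuousWithinAt)
        (fun x _ ↦ (hd x).hasDerivWithinAt) fun x hx ↦ ?_
      have h1 := Real.add_one_le_exp (-x)
      have h2 : Real.exp x * Real.exp (-x) = 1 := by rw [← Real.exp_add]; simp
      have := Real.exp_pos x
      nlinarith
    have := hm (Set.mem_Ici.mpr le_rfl) (Set.mem_Ici.mpr hv.le) hv.le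
    simp at this; linarith
  rw [lambertKernel, div_sub_div _ _ hv.ne' h.ne', div_le_div_iff₀ (by positivity) (by norm_num)]
  nlinarith

lemma le_lambertKernel {v : ℝ} (hv : 0 < v) : 1 / 2 - v / 4 ≤ lambertKernel v := by
  have h := exp_sub_one_pos hv
  have h2 := Real.quadratic_le_exp_of_nonneg hv.le
  have : 1 / (Real.exp v - 1) ≤ 1 / (v + v ^ 2 / 2) := by
    apply one_div_le_one_div_of_le (by positivity); linarith
  have e : 1 / v - 1 / (v + v ^ 2 / 2) = 1 / (2 + v) := by field_simp; ring
  have : 1 / 2 - v / 4 ≤ 1 / (2 + v) := by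
    rw [le_div_iff₀ (by linarith)]; nlinarith
  rw [lambertKernel]; linarith

lemma tendsto_lambertKernel {u : ℝ} (hu : 0 < u) :
    Tendsto (fun n : ℕ ↦ lambertKernel (u * n)) atTop (𝓝 0) := by
  have h1 : Tendsto (fun n : ℕ ↦ u * (n : ℝ)) atTop atTop :=
    tendsto_natCast_atTop_atTop.const_mul_atTop hu
  have h2 : Tendsto lambertKernel atTop (𝓝 0) := by
    have e1 : Tendsto (fun v : ℝ ↦ 1 / v) atTop (𝓝 0) := by
      simpa using tendsto_inv_atTop_zero (𝕜 := ℝ)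
    have e2 : Tendsto (fun v : ℝ ↦ 1 / (Real.exp v - 1)) atTop (𝓝 0) := by
      have := (tendsto_atTop_add_const_right _ (-1) Real.tendsto_exp_atTop).inv_tendsto_atTop
      refine this.congr fun v ↦ ?_
      simp [sub_eq_add_neg]
    have e3 := e1.sub e2
    rw [sub_zero] at e3
    exact e3
  exact h2.comp h1

lemma sum_range_mul_eq (f : ℕ → ℂ) (k : ℕ → ℝ) (N : ℕ) :
    ∑ n ∈ Finset.range N, f n * k n = (∑ n ∈ Finset.range N, f n) * k N +
      ∑ n ∈ Finset.range N, (∑ i ∈ Finset.range (n + 1), f i) * ((k n - k (n + 1) : ℝ) : ℂ) := by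
  induction N with
  | zero => simp
  | succ N ih =>
    rw [Finset.sum_range_succ, ih, Finset.sum_range_succ (fun n ↦ _ * _) N, Finset.sum_range_succ f N]
    push_cast; ring

/-- Character sums weighted by a convex sequence depend, up to a small error, only on the first
term of the sequence. -/
lemma exists_sum_char_mul_convex {q : ℕ} [NeZero q] {χ : DirichletCharacter ℂ q} (hχ : χ ≠ 1) :
    ∃ c : ℂ, ‖c‖ ≤ 2 * q ∧ ∀ k : ℕ → ℝ, Tendsto k atTop (𝓝 0) →
      (∀ n, k (n + 1) - k (n + 2) ≤ k n - k (n + 1)) → ∀ N,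
      ‖∑ n ∈ Finset.range N, χ (n + 1 : ℕ) * k n - c * k 0‖ ≤
        8 * q ^ 2 * (k 0 - k 1) + 4 * q * k N := by
  have hq : (1 : ℝ) ≤ q := by exact_mod_cast NeZero.one_le
  have hm := hasMean_char hχ
  set F : ℕ → ℂ := fun n ↦ ∑ i ∈ Finset.range n, χ (i + 1 : ℕ) with hF
  have hFn (n : ℕ) : ‖F n‖ ≤ 2 * q := by
    have := hm.sum_sub_le n
    rw [sum_Icc_one_eq_sum_range] at this
    simpa [hF] using this
  have hper : Function.Periodic F q := by
    intro n
    have h1 := sum_range_zmod (fun x ↦ χ x) (n + 1)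
    simp only [add_right_comm n 1] at h1
    simp only [hF, Finset.sum_range_add]
    rw [h1, MulChar.sum_eq_zero_of_ne_one hχ, add_zero]
  set c : ℂ := (∑ x : ZMod q, F x.val) / q with hc
  have hq0 : (q : ℂ) ≠ 0 := by exact_mod_cast NeZero.ne q
  have hcn : ‖c‖ ≤ 2 * q := by
    rw [hc, norm_div, Complex.norm_natCast, div_le_iff₀ (by linarith)]
    refine (norm_sum_le_of_le _ fun x _ ↦ hFn x.val).trans ?_
    simp [ZMod.card]; linarith
  have hS (N : ℕ) : ‖∑ n ∈ Finset.range N, (F (n + 1) - c)‖ ≤ 8 * q ^ 2 := by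
    have hb : HasMean (fun n ↦ (fun x : ZMod q ↦ (F x.val - c) / (4 * q)) n) 0 (2 * q) := by
      refine hasMean_zmod (b := fun x : ZMod q ↦ (F x.val - c) / (4 * q)) (fun x ↦ ?_) le_rfl
        zero_le_one ?_
      · rw [norm_div, norm_mul, Complex.norm_natCast]
        norm_num
        rw [div_le_one (by positivity)]
        exact (norm_sub_le _ _).trans (by linarith [hFn x.val])
      · rw [← Finset.sum_div, Finset.sum_sub_distrib]
        simp [ZMod.card, hc]
        left; field_simp; simp
    have := hb.sum_sub_le N
    rw [sum_Icc_one_eq_sum_range] at this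
    simp only [ofReal_zero, zero_mul, sub_zero, ZMod.val_natCast, hper.map_mod_nat,
      ← Finset.sum_div, norm_div, norm_mul, Complex.norm_natCast] at this
    rw [show ‖(4 : ℂ)‖ = 4 by norm_num, div_le_iff₀ (by linarith)] at this
    refine this.trans (le_of_eq ?_)
    ring
  refine ⟨c, hcn, fun k hk hconv N ↦ ?_⟩
  set D : ℕ → ℝ := fun n ↦ k n - k (n + 1) with hD
  have hDanti : Antitone D := antitone_nat_of_succ_le hconv
  have hDlim : Tendsto D atTop (𝓝 0) := by
    have := hk.sub (hk.comp (tendsto_add_atTop_nat 1))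
    rwa [sub_zero] at this
  have hDpos (n : ℕ) : 0 ≤ D n := hDanti.le_of_tendsto hDlim n
  have hkanti : Antitone k := antitone_nat_of_succ_le fun n ↦ by linarith [hDpos n]
  have hkpos (n : ℕ) : 0 ≤ k n := hkanti.le_of_tendsto hk n
  have e1 : ∑ n ∈ Finset.range N, χ (n + 1 : ℕ) * k n - c * k 0 = F N * k N - c * k N +
      ∑ n ∈ Finset.range N, (F (n + 1) - c) * D n := by
    rw [sum_range_mul_eq]
    simp only [sub_mul, Finset.sum_sub_distrib, ← Finset.mul_sum]
    have : ∑ n ∈ Finset.range N, (D n : ℂ) = k 0 - k N := by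
      have := Finset.sum_range_sub' k N
      rw [← Complex.ofReal_sum, hD, this]; push_cast; ring
    rw [this]; ring
  have e2 : ‖∑ n ∈ Finset.range N, (F (n + 1) - c) * D n‖ ≤ 8 * q ^ 2 * D 0 := by
    rw [sum_range_mul_eq]
    refine (norm_add_le _ _).trans ?_
    have b1 : ‖(∑ n ∈ Finset.range N, (F (n + 1) - c)) * (D N : ℂ)‖ ≤ 8 * q ^ 2 * D N := by
      rw [norm_mul, Complex.norm_real, Real.norm_of_nonneg (hDpos N)]
      exact mul_le_mul_of_nonneg_right (hS N) (hDpos N)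
    have b2 : ‖∑ n ∈ Finset.range N, (∑ i ∈ Finset.range (n + 1), (F (i + 1) - c)) *
        ((D n - D (n + 1) : ℝ) : ℂ)‖ ≤ 8 * q ^ 2 * (D 0 - D N) := by
      rw [← Finset.sum_range_sub' D N, Finset.mul_sum]
      refine norm_sum_le_of_le _ fun n _ ↦ ?_
      have : 0 ≤ D n - D (n + 1) := sub_nonneg.mpr (hDanti n.le_succ)
      rw [norm_mul, Complex.norm_real, Real.norm_of_nonneg this]
      exact mul_le_mul_of_nonneg_right (hS _) this
    linarith
  rw [e1]
  refine (norm_add_le _ _).trans ?_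
  rw [add_comm]
  refine add_le_add e2 ((norm_sub_le _ _).trans ?_)
  rw [norm_mul, norm_mul, Complex.norm_real, Real.norm_of_nonneg (hkpos N)]
  nlinarith [hFn N, hkpos N]

lemma tendsto_sum_char_div {q : ℕ} [NeZero q] {χ : DirichletCharacter ℂ q} (hχ : χ ≠ 1) :
    Tendsto (fun N : ℕ ↦ ∑ n ∈ Finset.range N, χ (n + 1 : ℕ) * ((1 / (n + 1 : ℕ) : ℝ) : ℂ)) atTop
      (𝓝 (regPart (fun n ↦ χ n) 0 1)) := by
  have hm := hasMean_char hχ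
  rw [tendsto_iff_norm_sub_tendsto_zero]
  refine squeeze_zero' (g := fun N : ℕ ↦ (6 * q : ℝ) / N) (Eventually.of_forall fun _ ↦ norm_nonneg _)
    ?_ (tendsto_const_div_atTop_nhds_zero_nat _)
  filter_upwards [eventually_ge_atTop 1] with N hN
  have hN0 : (0 : ℝ) < N := by exact_mod_cast hN
  have h1 := hm.regPart_eq (s := 1) (by simp) hN
  have e : ∑ n ∈ Finset.range N, χ (n + 1 : ℕ) * ((1 / (n + 1 : ℕ) : ℝ) : ℂ) =
      ∑ n ∈ Finset.Icc 1 N, χ n * (n : ℂ) ^ (-1 : ℂ) := by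
    rw [sum_Icc_one_eq_sum_range]
    refine Finset.sum_congr rfl fun n _ ↦ ?_
    rw [cpow_neg_one]; push_cast; ring
  rw [e, h1]
  set I := ∫ t in Set.Ioi (N : ℝ), (t : ℂ) ^ (-(1 : ℂ) - 1) * errorTerm (fun n ↦ χ n) 0 t
  have hI : ‖I‖ ≤ 4 * q / N := by
    have := hm.norm_tail_le (s := 1) (by simp) hN0
    simp only [one_re, div_one, Real.rpow_neg_one] at this
    refine this.trans (le_of_eq ?_)
    field_simp; ring
  have hA : ‖(∑ n ∈ Finset.Icc 1 N, χ n) * (N : ℂ) ^ (-1 : ℂ)‖ ≤ 2 * q / N := by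
    rw [cpow_neg_one, norm_mul, norm_inv, Complex.norm_natCast, ← div_eq_mul_inv]
    have := hm.sum_sub_le N
    simp only [ofReal_zero, zero_mul, sub_zero] at this
    gcongr
  have e2 : ∑ n ∈ Finset.Icc 1 N, χ n * (n : ℂ) ^ (-1 : ℂ) - (∑ n ∈ Finset.Icc 1 N, χ n *
      (n : ℂ) ^ (-1 : ℂ) - (∑ n ∈ Finset.Icc 1 N, χ n) * (N : ℂ) ^ (-1 : ℂ) -
      (0 : ℝ) * (1 * ∫ t in (1 : ℝ)..N, (t : ℂ) ^ (-1 : ℂ)) + 1 * I) =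
      (∑ n ∈ Finset.Icc 1 N, χ n) * (N : ℂ) ^ (-1 : ℂ) - I := by
    push_cast; ring
  rw [e2]
  refine (norm_sub_le _ _).trans ((add_le_add hA hI).trans (le_of_eq ?_))
  ring

/-- The general term of the double series underlying a twisted Lambert series. -/
noncomputable def lambertTerm {q : ℕ} (χ : DirichletCharacter ℂ q) (x : ℝ) (c : ℕ+ × ℕ+) : ℂ :=
  χ (c.1 : ℕ) * ((x ^ (c.1 * c.2 : ℕ) : ℝ) : ℂ)

lemma summable_lambertTerm {q : ℕ} (χ : DirichletCharacter ℂ q) {x : ℝ} (hx0 : 0 < x) (hx1 : x < 1) :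
    Summable (lambertTerm χ x) := by
  refine Summable.of_norm_bounded (summable_prod_mul_pow 0 (r := x)
    (by rwa [Real.norm_of_nonneg hx0.le])) fun c ↦ ?_
  rw [lambertTerm, norm_mul, Complex.norm_real, Real.norm_of_nonneg (by positivity), pow_zero, one_mul]
  exact mul_le_of_le_one_left (by positivity) (χ.norm_le_one _)

lemma hasSum_pow_mul_pnat {y : ℝ} (hy0 : 0 < y) (hy1 : y < 1) :
    HasSum (fun m : ℕ+ ↦ y ^ (m : ℕ)) (1 / (y⁻¹ - 1)) := by
  have h1 := (hasSum_geometric_of_lt_one hy0.le hy1).mul_left y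
  have e : y * (1 - y)⁻¹ = 1 / (y⁻¹ - 1) := by
    have : (1 - y) ≠ 0 := by linarith
    field_simp
  rw [e, ← Equiv.pnatEquivNat.hasSum_iff] at h1
  have e2 : (fun i : ℕ ↦ y * y ^ i) ∘ Equiv.pnatEquivNat = fun m : ℕ+ ↦ y ^ (m : ℕ) := by
    funext m
    simp only [Function.comp, Equiv.pnatEquivNat_apply]
    rw [← pow_succ', PNat.natPred_add_one m]
  rwa [e2] at h1

lemma hasSum_lambertTerm_left {q : ℕ} (χ : DirichletCharacter ℂ q) {x : ℝ} (hx0 : 0 < x) (hx1 : x < 1) :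
    HasSum (fun n : ℕ ↦ χ (n + 1 : ℕ) * ((1 / ((x ^ (n + 1))⁻¹ - 1) : ℝ) : ℂ))
      (∑' c, lambertTerm χ x c) := by
  have hfib (a : ℕ+) : HasSum (fun m : ℕ+ ↦ lambertTerm χ x (a, m))
      (χ (a : ℕ) * ((1 / ((x ^ (a : ℕ))⁻¹ - 1) : ℝ) : ℂ)) := by
    have h := hasSum_pow_mul_pnat (y := x ^ (a : ℕ)) (by positivity)
      (pow_lt_one₀ hx0.le hx1 a.ne_zero)
    simp only [← pow_mul] at h
    exact (Complex.hasSum_ofReal.mpr h).mul_left (χ (a : ℕ))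
  have h2 := (summable_lambertTerm χ hx0 hx1).hasSum.prod_fiberwise hfib
  rw [← Equiv.pnatEquivNat.symm.hasSum_iff] at h2
  convert h2 using 2 with n
  simp only [Function.comp, Equiv.pnatEquivNat_symm_apply, Nat.succPNat_coe, Nat.succ_eq_add_one]

lemma hasSum_lambertTerm_right {q : ℕ} (χ : DirichletCharacter ℂ q) {x : ℝ} (hx0 : 0 < x) (hx1 : x < 1) :
    HasSum (fun n : ℕ ↦ χ.zetaMul (n + 1) * ((x ^ (n + 1) : ℝ) : ℂ))
      (∑' c, lambertTerm χ x c) := by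
  have h1 := sigmaAntidiagonalEquivProd.hasSum_iff.mpr (summable_lambertTerm χ hx0 hx1).hasSum
  have h2 := h1.sigma (g := fun n : ℕ+ ↦ χ.zetaMul n * ((x ^ (n : ℕ) : ℝ) : ℂ)) fun n ↦ by
    have h3 := hasSum_fintype (fun c : Nat.divisorsAntidiagonal n ↦
      (lambertTerm χ x ∘ sigmaAntidiagonalEquivProd) ⟨n, c⟩)
    have e : ∑ c : Nat.divisorsAntidiagonal n,
        (lambertTerm χ x ∘ sigmaAntidiagonalEquivProd) ⟨n, c⟩ =
        χ.zetaMul n * ((x ^ (n : ℕ) : ℝ) : ℂ) := by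
      rw [DirichletCharacter.zetaMul, ArithmeticFunction.coe_zeta_mul_apply,
        ← Nat.sum_divisorsAntidiagonal (M := ℂ)
          (fun i _ ↦ (toArithmeticFunction (χ ·) : ArithmeticFunction ℂ) i),
        Finset.sum_mul]
      refine Eq.trans (Finset.sum_congr rfl fun c _ ↦ ?_) (Finset.sum_coe_sort
        (Nat.divisorsAntidiagonal n) (fun c ↦ toArithmeticFunction (χ ·) c.1 * ((x ^ (n : ℕ) : ℝ) : ℂ)))
      have hc := Nat.mem_divisorsAntidiagonal.mp c.2
      have hc1 : c.1.1 ≠ 0 := by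
        rintro h; rw [h, zero_mul] at hc; exact hc.2 hc.1.symm
      simp only [Function.comp, lambertTerm, sigmaAntidiagonalEquivProd]
      simp [toArithmeticFunction, hc1, divisorsAntidiagonalFactors, hc.1]
    rwa [e] at h3
  rw [← Equiv.pnatEquivNat.symm.hasSum_iff] at h2
  convert h2 using 2 with n
  simp only [Function.comp, Equiv.pnatEquivNat_symm_apply, Nat.succPNat_coe, Nat.succ_eq_add_one]

open scoped ComplexOrder in
lemma one_le_zetaMul_sq {q : ℕ} {χ : DirichletCharacter ℂ q} (hχ : χ ^ 2 = 1) {m : ℕ} (hm : m ≠ 0) :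
    1 ≤ χ.zetaMul (m ^ 2) := by
  induction m using Nat.recOnPosPrimePosCoprime with
  | zero => exact absurd rfl hm
  | one => simp [χ.isMultiplicative_zetaMul.map_one]
  | coprime a b ha hb hab iha ihb =>
    rw [mul_pow, χ.isMultiplicative_zetaMul.map_mul_of_coprime (hab.pow 2 2)]
    exact one_le_mul_of_one_le_of_one_le (iha (by lia)) (ihb (by lia))
  | prime_pow p n hp hn =>
    rw [← pow_mul, DirichletCharacter.zetaMul, ArithmeticFunction.coe_zeta_mul_apply,
      Nat.sum_divisors_prime_pow hp]
    have e : ∀ i ∈ Finset.range (n * 2 + 1), toArithmeticFunction (fun m : ℕ ↦ χ m) (p ^ i) =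
        χ (p : ℕ) ^ i := by
      intro i _
      simp [toArithmeticFunction, hp.ne_zero]
    rw [Finset.sum_congr rfl e]
    rcases MulChar.isQuadratic_iff_sq_eq_one.mpr hχ (p : ZMod q) with h | h | h
    · rw [h, Finset.sum_range_succ']; simp
    · rw [h]; simp only [one_pow, Finset.sum_const, Finset.card_range, nsmul_eq_mul, mul_one]
      exact_mod_cast Nat.le_add_left 1 _
    · rw [h, Finset.sum_range_succ, neg_one_geom_sum]; simp

open scoped ComplexOrder in
lemma zetaMul_re_nonneg {q : ℕ} {χ : DirichletCharacter ℂ q} (hχ : χ ^ 2 = 1) (n : ℕ) :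
    0 ≤ (χ.zetaMul n).re := by
  have := DirichletCharacter.zetaMul_nonneg hχ n
  exact (Complex.le_def.mp this).1

/-- The sum over `n` of `χ.zetaMul n * exp (-u n)`, as a double series. -/
noncomputable def lambertSum {q : ℕ} (χ : DirichletCharacter ℂ q) (u : ℝ) : ℂ :=
  ∑' c, lambertTerm χ (Real.exp (-u)) c

lemma tendsto_lambertSum {q : ℕ} (χ : DirichletCharacter ℂ q) {u : ℝ} (hu : 0 < u) :
    Tendsto (fun N : ℕ ↦ (1 / u : ℝ) *
        (∑ n ∈ Finset.range N, χ (n + 1 : ℕ) * ((1 / (n + 1 : ℕ) : ℝ) : ℂ)) -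
      ∑ n ∈ Finset.range N, χ (n + 1 : ℕ) * (lambertKernel (u * (n + 1 : ℕ)) : ℂ)) atTop
      (𝓝 (lambertSum χ u)) := by
  have h := (hasSum_lambertTerm_left χ (Real.exp_pos (-u))
    (Real.exp_lt_one_iff.mpr (by linarith))).tendsto_sum_nat
  refine h.congr fun N ↦ ?_
  rw [Finset.mul_sum, ← Finset.sum_sub_distrib]
  refine Finset.sum_congr rfl fun n _ ↦ ?_
  have : (Real.exp (-u) ^ (n + 1))⁻¹ = Real.exp (u * (n + 1 : ℕ)) := by
    rw [← Real.exp_nat_mul, ← Real.exp_neg]; congr 1; ring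
  rw [this, lambertKernel]
  push_cast
  field_simp
  ring

lemma norm_lambertSum_sub_le {q : ℕ} [NeZero q] {χ : DirichletCharacter ℂ q} (hχ : χ ≠ 1) {u : ℝ}
    (hu : 0 < u) : ‖lambertSum χ u - lambertSum χ (2 * u)‖ ≤
      1 / (2 * u) * ‖regPart (fun n ↦ χ n) 0 1‖ + 13 * q ^ 2 * u := by
  have hq : (1 : ℝ) ≤ q := by exact_mod_cast NeZero.one_le
  obtain ⟨c, hc, hsum⟩ := exists_sum_char_mul_convex hχ
  have key {v : ℝ} (hv : 0 < v) (N : ℕ) : ‖∑ n ∈ Finset.range N, χ (n + 1 : ℕ) *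
      (lambertKernel (v * (n + 1 : ℕ)) : ℂ) - c * lambertKernel v‖ ≤ 
      8 * q ^ 2 * (v / 2) + 4 * q * lambertKernel (v * (N + 1 : ℕ)) := by
    have h := hsum (fun n ↦ lambertKernel (v * (n + 1 : ℕ)))
      ((tendsto_lambertKernel hv).comp (tendsto_add_atTop_nat 1)) (fun n ↦ ?_) N
    · simp only [zero_add, Nat.cast_one, mul_one] at h
      refine h.trans ?_
      have h1 := lambertKernel_le hv
      have h2 := le_lambertKernel (v := v * (1 + 1 : ℕ)) (by positivity)
      push_cast at h2 ⊢
      gcongr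
      linarith
    · have hcv := convexOn_lambertKernel.2
        (show v * (n + 1 : ℕ) ∈ Set.Ioi (0 : ℝ) by simp only [Set.mem_Ioi]; positivity)
        (show v * (n + 2 + 1 : ℕ) ∈ Set.Ioi (0 : ℝ) by simp only [Set.mem_Ioi]; positivity)
        (show (0 : ℝ) ≤ 1 / 2 by norm_num) (show (0 : ℝ) ≤ 1 / 2 by norm_num) (by norm_num)
      simp only [smul_eq_mul] at hcv
      rw [show (1 / 2 : ℝ) * (v * (n + 1 : ℕ)) + 1 / 2 * (v * (n + 2 + 1 : ℕ)) = v * (n + 1 + 1 : ℕ) by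
        push_cast; ring] at hcv
      linarith
  have h2u : 0 < 2 * u := by linarith
  have lim := ((tendsto_lambertSum χ hu).sub (tendsto_lambertSum χ h2u)).norm
  have lim2 : Tendsto (fun N : ℕ ↦ 1 / (2 * u) *
      ‖∑ n ∈ Finset.range N, χ (n + 1 : ℕ) * ((1 / (n + 1 : ℕ) : ℝ) : ℂ)‖ + 13 * q ^ 2 * u +
      4 * q * (lambertKernel (u * (N + 1 : ℕ)) + lambertKernel (2 * u * (N + 1 : ℕ)))) atTop
      (𝓝 (1 / (2 * u) * ‖regPart (fun n ↦ χ n) 0 1‖ + 13 * q ^ 2 * u + 4 * q * (0 + 0))) := by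
    refine ((tendsto_sum_char_div hχ).norm.const_mul _).add_const _ |>.add (Tendsto.const_mul _ ?_)
    exact ((tendsto_lambertKernel hu).comp (tendsto_add_atTop_nat 1)).add
      ((tendsto_lambertKernel h2u).comp (tendsto_add_atTop_nat 1))
  rw [add_zero, mul_zero, add_zero] at lim2
  refine le_of_tendsto_of_tendsto' lim lim2 fun N ↦ ?_
  set A := ∑ n ∈ Finset.range N, χ (n + 1 : ℕ) * ((1 / (n + 1 : ℕ) : ℝ) : ℂ)
  have k1 := key hu N
  have k2 := key h2u N
  set E1 := ∑ n ∈ Finset.range N, χ (n + 1 : ℕ) * (lambertKernel (u * (n + 1 : ℕ)) : ℂ)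
  set E2 := ∑ n ∈ Finset.range N, χ (n + 1 : ℕ) * (lambertKernel (2 * u * (n + 1 : ℕ)) : ℂ)
  have e : (1 / u : ℝ) * A - E1 - ((1 / (2 * u) : ℝ) * A - E2) = (1 / (2 * u) : ℝ) * A -
      (E1 - c * lambertKernel u) + (E2 - c * lambertKernel (2 * u)) -
      c * ((lambertKernel u - lambertKernel (2 * u) : ℝ) : ℂ) := by
    have : (u : ℂ) ≠ 0 := by exact_mod_cast hu.ne'
    push_cast
    field_simp
    ring
  have hd : |lambertKernel u - lambertKernel (2 * u)| ≤ u / 2 := by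
    have h1 := lambertKernel_le hu
    have h2 := le_lambertKernel hu
    have h3 := lambertKernel_le h2u
    have h4 := le_lambertKernel h2u
    rw [abs_le]; constructor <;> linarith
  rw [e]
  refine (norm_sub_le _ _).trans ((add_le_add (norm_add_le _ _) le_rfl).trans
    ((add_le_add (add_le_add (norm_sub_le _ _) le_rfl) le_rfl).trans ?_))
  rw [norm_mul, norm_mul, Complex.norm_real, Complex.norm_real,
    Real.norm_of_nonneg (r := 1 / (2 * u)) (by positivity), Real.norm_eq_abs]
  have hcd : ‖c‖ * |lambertKernel u - lambertKernel (2 * u)| ≤ 2 * q * (u / 2) :=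
    mul_le_mul hc hd (abs_nonneg _) (by positivity)
  have : (q : ℝ) * u ≤ q ^ 2 * u := by
    have : (q : ℝ) ≤ q ^ 2 := by nlinarith
    gcongr
  linarith

lemma div_nine_le_exp_sub {v : ℝ} (h0 : 0 ≤ v) (h1 : v ≤ 1) :
    v / 9 ≤ Real.exp (-v) - Real.exp (-(2 * v)) := by
  have e : Real.exp (-(2 * v)) = Real.exp (-v) * Real.exp (-v) := by
    rw [← Real.exp_add]; ring_nf
  have a : 1 / 3 ≤ Real.exp (-v) := by
    have : Real.exp (-1) ≤ Real.exp (-v) := Real.exp_le_exp.mpr (by linarith)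
    have := Real.exp_neg_one_gt_d9
    linarith
  have b : Real.exp (-v) ≤ 1 - v / 3 := by
    have h := Real.add_one_le_exp v
    have h3 : Real.exp (-v) * Real.exp v = 1 := by rw [← Real.exp_add]; simp
    have h4 := Real.exp_pos (-v)
    nlinarith
  rw [e]
  nlinarith

lemma le_re_lambertSum_sub {q : ℕ} [NeZero q] {χ : DirichletCharacter ℂ q} (hχ : χ ^ 2 = 1)
    {M : ℕ} (hM : 1 ≤ M) : (M : ℝ) / 27 ≤
      (lambertSum χ (1 / M ^ 2) - lambertSum χ (2 * (1 / M ^ 2))).re := by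
  have hM0 : (0 : ℝ) < M := by exact_mod_cast hM
  set u : ℝ := 1 / M ^ 2 with hu_def
  have hu : 0 < u := by positivity
  have H (v : ℝ) (hv : 0 < v) : HasSum (fun n : ℕ ↦ (χ.zetaMul (n + 1)).re *
      Real.exp (-(v * (n + 1 : ℕ)))) (lambertSum χ v).re := by
    have h := Complex.hasSum_re (hasSum_lambertTerm_right χ (Real.exp_pos (-v))
      (Real.exp_lt_one_iff.mpr (by linarith)))
    refine h.congr_fun ?_
    intro n
    rw [Complex.re_mul_ofReal, ← Real.exp_nat_mul]
    congr 2; ring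
  have h := (H u hu).sub (H (2 * u) (by linarith))
  rw [← Complex.sub_re] at h
  have hnn (n : ℕ) : 0 ≤ (χ.zetaMul (n + 1)).re * Real.exp (-(u * (n + 1 : ℕ))) -
      (χ.zetaMul (n + 1)).re * Real.exp (-(2 * u * (n + 1 : ℕ))) := by
    rw [← mul_sub]
    refine mul_nonneg (zetaMul_re_nonneg hχ _) (sub_nonneg.mpr (Real.exp_le_exp.mpr ?_))
    have : 0 ≤ u * (n + 1 : ℕ) := by positivity
    linarith
  have hinj : Set.InjOn (fun m : ℕ ↦ (m + 1) ^ 2 - 1) (Finset.range M : Set ℕ) := by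
    intro a _ b _ hab
    have : (a + 1) ^ 2 = (b + 1) ^ 2 := by
      have h1 : 1 ≤ (a + 1) ^ 2 := Nat.one_le_pow _ _ (by lia)
      have h2 : 1 ≤ (b + 1) ^ 2 := Nat.one_le_pow _ _ (by lia)
      simp only at hab
      lia
    have := Nat.pow_left_injective (n := 2) (by lia) this
    lia
  refine le_trans ?_ (sum_le_hasSum ((Finset.range M).image fun m : ℕ ↦ (m + 1) ^ 2 - 1)
    (fun n _ ↦ hnn n) h)
  rw [Finset.sum_image hinj]
  have hterm : ∀ m ∈ Finset.range M, ((m + 1 : ℕ) : ℝ) ^ 2 * (u / 9) ≤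
      (χ.zetaMul ((m + 1) ^ 2 - 1 + 1)).re * Real.exp (-(u * ((m + 1) ^ 2 - 1 + 1 : ℕ))) -
      (χ.zetaMul ((m + 1) ^ 2 - 1 + 1)).re * Real.exp (-(2 * u * ((m + 1) ^ 2 - 1 + 1 : ℕ))) := by
    intro m hm
    have hm' : (m + 1) ^ 2 - 1 + 1 = (m + 1) ^ 2 := Nat.sub_add_cancel (Nat.one_le_pow _ _ (by lia))
    rw [hm', ← mul_sub]
    have h1 : 1 ≤ (χ.zetaMul ((m + 1) ^ 2)).re :=
      (Complex.le_def.mp (one_le_zetaMul_sq hχ (Nat.succ_ne_zero m))).1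
    have hmM : ((m + 1 : ℕ) : ℝ) ≤ M := by exact_mod_cast Finset.mem_range.mp hm
    have h2 := div_nine_le_exp_sub (v := u * ((m + 1) ^ 2 : ℕ)) (by positivity) (by
      rw [hu_def, one_div, inv_mul_le_iff₀ (by positivity), mul_one, Nat.cast_pow]
      gcongr)
    rw [← mul_assoc] at h2
    have h3 : 0 ≤ u * ((m + 1) ^ 2 : ℕ) / 9 := by positivity
    push_cast at h2 h3 ⊢
    nlinarith
  refine le_trans ?_ (Finset.sum_le_sum hterm)
  rw [← Finset.sum_mul]
  have hsq : ∀ M : ℕ, (M : ℝ) ^ 3 / 3 ≤ ∑ m ∈ Finset.range M, ((m + 1 : ℕ) : ℝ) ^ 2 := by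
    intro M
    induction M with
    | zero => simp
    | succ M ih =>
      rw [Finset.sum_range_succ]
      push_cast at ih ⊢
      have : (0 : ℝ) ≤ M := M.cast_nonneg
      nlinarith
  calc (M : ℝ) / 27 = M ^ 3 / 3 * (u / 9) := by rw [hu_def]; field_simp; norm_num
    _ ≤ _ := by gcongr; exact hsq M

/-- An effective lower bound for `L(1, χ)` for real characters `χ`. -/
lemma le_norm_regPart_one {q : ℕ} [NeZero q] {χ : DirichletCharacter ℂ q} (hχ : χ ≠ 1)
    (hχ2 : χ ^ 2 = 1) : 1 / 270 * (q : ℝ) ^ (-(2 / 3) : ℝ) ≤ ‖regPart (fun n ↦ χ n) 0 1‖ := by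
  have hq : (1 : ℝ) ≤ q := by exact_mod_cast NeZero.one_le
  set P : ℝ := (q : ℝ) ^ (2 / 3 : ℝ) with hP
  have hP1 : 1 ≤ P := Real.one_le_rpow hq (by norm_num)
  have hP3 : P ^ 3 = q ^ 2 := by
    rw [hP, ← Real.rpow_natCast, ← Real.rpow_mul (by linarith)]
    norm_num
  set M : ℕ := ⌈9 * P⌉₊ with hMdef
  have hMP : 9 * P ≤ M := Nat.le_ceil _
  have hMP2 : (M : ℝ) ≤ 10 * P := by
    have := Nat.ceil_lt_add_one (a := 9 * P) (by linarith)
    linarith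
  have hM0 : (0 : ℝ) < M := by linarith
  have hM : 1 ≤ M := by exact_mod_cast hM0
  have h1 := le_re_lambertSum_sub hχ2 hM
  have h2 := norm_lambertSum_sub_le hχ (u := 1 / M ^ 2) (by positivity)
  have h3 := (h1.trans (Complex.re_le_norm _)).trans h2
  set L := ‖regPart (fun n ↦ χ n) 0 1‖
  have hM3 : 729 * (q : ℝ) ^ 2 ≤ M ^ 3 := by
    calc 729 * (q : ℝ) ^ 2 = (9 * P) ^ 3 := by rw [mul_pow, hP3]; norm_num
      _ ≤ _ := by gcongr
  have h4 : 13 * (q : ℝ) ^ 2 * (1 / M ^ 2) ≤ M / 54 := by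
    rw [mul_one_div, div_le_iff₀ (by positivity)]
    nlinarith
  have h5 : (M : ℝ) / 54 ≤ M ^ 2 / 2 * L := by
    have : 1 / (2 * (1 / (M : ℝ) ^ 2)) = M ^ 2 / 2 := by field_simp
    rw [this] at h3
    linarith
  have h6 : 1 ≤ 27 * M * L := by
    by_contra! hcon
    nlinarith
  rw [Real.rpow_neg (by linarith), ← hP, ← div_eq_mul_inv, div_le_iff₀ (by linarith)]
  have : 0 ≤ L := norm_nonneg _
  nlinarith

lemma norm_iteratedDeriv_logDeriv_le {G : ℂ → ℂ} {s : ℂ} {M δ r : ℝ} (hδ : 0 < δ) (hM : 0 < M)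
    (hr : δ / (2 * M) < r) (hd : DifferentiableOn ℂ G (Metric.ball s r))
    (hG : ∀ w ∈ Metric.ball s r, ‖deriv G w‖ ≤ M) (hs : δ ≤ ‖G s‖) (j : ℕ) :
    ‖iteratedDeriv j (fun w ↦ deriv G w / G w) s‖ ≤ j.factorial * (2 * M / δ) ^ (j + 1) := by
  set ρ := δ / (2 * M) with hρ
  have hρ0 : 0 < ρ := by positivity
  have hsub : Metric.closedBall s ρ ⊆ Metric.ball s r := Metric.closedBall_subset_ball hr
  have hlow : ∀ w ∈ Metric.closedBall s ρ, δ / 2 ≤ ‖G w‖ := by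
    intro w hw
    have h1 := Convex.norm_image_sub_le_of_norm_deriv_le (f := G) (C := M) (s := Metric.ball s r)
      (fun z hz ↦ hd.differentiableAt (Metric.isOpen_ball.mem_nhds hz)) hG (convex_ball s r)
      (hsub (Metric.mem_closedBall_self hρ0.le)) (hsub hw)
    have h2 : M * ‖w - s‖ ≤ δ / 2 := by
      calc M * ‖w - s‖ ≤ M * ρ := by gcongr; rwa [← dist_eq_norm]
        _ = δ / 2 := by rw [hρ]; field_simp
    have h3 := norm_sub_norm_le (G s) (G w)
    rw [norm_sub_rev] at h3
    linarith
  have hdiff : DifferentiableOn ℂ (fun w ↦ deriv G w / G w) (Metric.closedBall s ρ) := by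
    refine DifferentiableOn.div ((hd.deriv Metric.isOpen_ball).mono hsub) (hd.mono hsub) fun w hw h ↦ ?_
    have := hlow w hw
    rw [h, norm_zero] at this
    linarith
  have h := norm_iteratedDeriv_le_of_forall_mem_sphere_norm_le (c := s) (R := ρ) (C := 2 * M / δ) j hρ0
    (hdiff.mono Metric.closure_ball_subset_closedBall).diffContOnCl (fun w hw ↦ ?_)
  · refine h.trans (le_of_eq ?_)
    rw [hρ, div_pow, div_pow]
    field_simp
    ring
  · have hw' := Metric.sphere_subset_closedBall hw
    rw [norm_div]
    calc ‖deriv G w‖ / ‖G w‖ ≤ M / (δ / 2) := by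
          gcongr
          · exact hG w (hsub hw')
          · exact hlow w hw'
      _ = 2 * M / δ := by field_simp

/-- The sequence `χ(n) Λ(n) (log n)^j`. -/
noncomputable def logTwist {q : ℕ} (χ : DirichletCharacter ℂ q) (j n : ℕ) : ℂ :=
  χ n * ((ArithmeticFunction.vonMangoldt n * Real.log n ^ j : ℝ) : ℂ)

lemma logTwist_eq {q : ℕ} (χ : DirichletCharacter ℂ q) (j : ℕ) : logTwist χ j =
    LSeries.logMul^[j] ((fun n : ℕ ↦ χ n) * fun n : ℕ ↦ (ArithmeticFunction.vonMangoldt n : ℂ)) := by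
  induction j with
  | zero => funext n; simp [logTwist]
  | succ j ih =>
    rw [Function.iterate_succ_apply', ← ih]
    funext n
    simp only [logTwist, LSeries.logMul, ← Complex.natCast_log]
    push_cast
    ring

lemma abscissa_twist_le {q : ℕ} (χ : DirichletCharacter ℂ q) : LSeries.abscissaOfAbsConv
    ((fun n : ℕ ↦ χ n) * fun n : ℕ ↦ (ArithmeticFunction.vonMangoldt n : ℂ)) ≤ 1 := by
  refine LSeries.abscissaOfAbsConv_le_of_forall_lt_LSeriesSummable fun y hy ↦ ?_
  exact χ.LSeriesSummable_twist_vonMangoldt (by simpa using hy)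

lemma logTwist_summable {q : ℕ} (χ : DirichletCharacter ℂ q) (j : ℕ) {s : ℂ} (hs : 1 < s.re) :
    LSeriesSummable (logTwist χ j) s := by
  refine LSeriesSummable_of_abscissaOfAbsConv_lt_re ?_
  rw [logTwist_eq, LSeries.absicssaOfAbsConv_logPowMul]
  exact (abscissa_twist_le χ).trans_lt (by exact_mod_cast hs)

lemma norm_LSeries_logTwist {q : ℕ} [NeZero q] (χ : DirichletCharacter ℂ q) {κ : ℝ}
    (hm : HasMean (fun n ↦ χ n) κ (2 * q)) (j : ℕ) {s : ℂ} (hs : 1 < s.re) :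
    ‖LSeries (logTwist χ j) s‖ = ‖iteratedDeriv j
      (fun w ↦ deriv (contSeries (fun n ↦ χ n) κ) w / contSeries (fun n ↦ χ n) κ w) s‖ := by
  set f := (fun n : ℕ ↦ χ n) * fun n : ℕ ↦ (ArithmeticFunction.vonMangoldt n : ℂ)
  set G := contSeries (fun n ↦ χ n) κ
  have hopen : IsOpen {z : ℂ | 1 < z.re} := isOpen_lt continuous_const continuous_re
  have h1 := LSeries_iteratedDeriv (f := f) j (s := s)
    ((abscissa_twist_le χ).trans_lt (by exact_mod_cast hs))
  rw [← logTwist_eq] at h1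
  have hGL : Set.EqOn (LSeries fun n ↦ χ n) G {z : ℂ | 1 < z.re} := fun z hz ↦ hm.contSeries_eq hz
  have heq : Set.EqOn (LSeries f) (fun w ↦ -(deriv G w / G w)) {z : ℂ | 1 < z.re} := by
    intro z hz
    rw [DirichletCharacter.LSeries_twist_vonMangoldt_eq χ hz]
    have : deriv (LSeries fun n ↦ χ n) z = deriv G z :=
      (hGL.eventuallyEq_of_mem (hopen.mem_nhds hz)).deriv_eq
    simp only [this, hGL hz, neg_div]
  have h2 := (heq.eventuallyEq_of_mem (hopen.mem_nhds hs)).iteratedDeriv_eq j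
  have h3 : ‖LSeries (logTwist χ j) s‖ = ‖iteratedDeriv j (LSeries f) s‖ := by
    rw [h1, norm_mul]; simp
  rw [h3, h2, iteratedDeriv_fun_neg, norm_neg]

lemma norm_LSeries_logTwist_le {q : ℕ} [NeZero q] (χ : DirichletCharacter ℂ q) {κ : ℝ}
    (hm : HasMean (fun n ↦ χ n) κ (2 * q)) {η : ℝ} (hη : 0 < η) (hη2 : η ≤ 1 / 2) (j : ℕ) {s : ℂ}
    (hs : 1 < s.re) (hs2 : s.re ≤ 2) (hκ : κ = 0 ∨ 1 ≤ |s.im|) {δ : ℝ} (hδ : 0 < δ) (hδ1 : δ ≤ 1)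
    (hL : δ ≤ ‖LSeries (fun n ↦ χ n) s‖) : ‖LSeries (logTwist χ j) s‖ ≤
      j.factorial * (4 * boundConst η * height q s.im ^ (2 * η) / δ) ^ (j + 1) := by
  have hZ4 : 4 ≤ height q s.im := one_le_height (q := q) s.im
  have hZ1 : 1 ≤ height q s.im ^ (2 * η) := Real.one_le_rpow (by linarith) (by linarith)
  have hK := boundConst_ge hη hη2
  have hK0 := le_boundConst hη hη2
  have hq : (1 : ℝ) ≤ q := by exact_mod_cast NeZero.one_le
  set M := 2 * boundConst η * height q s.im ^ (2 * η) with hM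
  have hM0 : 0 < M := by positivity
  rw [norm_LSeries_logTwist χ hm j hs]
  have hball : ∀ w ∈ Metric.ball s (η / 4), 1 - η / 2 ≤ w.re ∧ w.re ≤ 5 / 2 ∧
      (κ = 0 ∨ 1 / 2 ≤ |w.im|) ∧ |w.im| ≤ |s.im| + 1 := by
    intro w hw
    have h := mem_ball_iff_norm.mp hw
    have h1 := abs_le.mp ((Complex.abs_re_le_norm (w - s)).trans h.le)
    have h2 := (Complex.abs_im_le_norm (w - s)).trans h.le
    rw [Complex.sub_re] at h1
    rw [Complex.sub_im] at h2
    refine ⟨by linarith, by linarith, hκ.imp_right fun h3 ↦ ?_, ?_⟩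
    · have := abs_sub_abs_le_abs_sub s.im w.im
      rw [abs_sub_comm] at this
      linarith
    · have := abs_sub_abs_le_abs_sub w.im s.im
      linarith
  have hMr : δ / (2 * M) < η / 4 := by
    have : 320 / η ≤ M := by rw [hM]; nlinarith
    rw [div_le_iff₀ hη] at this
    rw [div_lt_iff₀ (by positivity)]
    linarith
  have h := norm_iteratedDeriv_logDeriv_le (G := contSeries (fun n ↦ χ n) κ) (s := s) hδ hM0 hMr
    (fun w hw ↦ ?_) (fun w hw ↦ ?_) (by rwa [← hm.contSeries_eq hs]) j
  · refine h.trans (le_of_eq ?_)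
    rw [hM]; ring_nf
  · obtain ⟨h1, _, h3, _⟩ := hball w hw
    exact (hm.differentiableAt_contSeries (by linarith)
      (h3.imp_right ne_one_of_im)).differentiableWithinAt
  · obtain ⟨h1, h2, h3, h4⟩ := hball w hw
    refine (hm.norm_deriv_contSeries_le hη hη2 h1 h2 h3).trans ?_
    have : (2 * q * (|w.im| + 2) : ℝ) ≤ 2 * height q s.im := by
      rw [height]; nlinarith [abs_nonneg s.im]
    calc boundConst η * (2 * q * (|w.im| + 2) : ℝ) ^ (2 * η) ≤
        boundConst η * (2 * height q s.im) ^ (2 * η) := by gcongr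
      _ = boundConst η * (2 ^ (2 * η) * height q s.im ^ (2 * η)) := by
          rw [Real.mul_rpow (by norm_num) (by linarith)]
      _ ≤ boundConst η * (2 * height q s.im ^ (2 * η)) := by
          have : (2 : ℝ) ^ (2 * η) ≤ 2 ^ (1 : ℝ) :=
            Real.rpow_le_rpow_of_exponent_le (by norm_num) (by linarith)
          rw [Real.rpow_one] at this
          gcongr
      _ = M := by rw [hM]; ring

lemma inv_le_norm_LSeries {q : ℕ} (χ : DirichletCharacter ℂ q) {C : ℝ}
    (hC : ∀ a : ℕ → ℂ, (∀ n, ‖a n‖ ≤ 1) → ∀ s : ℂ, 1 < s.re → s.re ≤ 2 →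
      ‖LSeries a s‖ ≤ C / (s.re - 1)) (hC0 : 0 < C) {s : ℂ} (hs : 1 < s.re) (hs2 : s.re ≤ 2) :
    (s.re - 1) / C ≤ ‖LSeries (fun n ↦ χ n) s‖ := by
  have h1 := DirichletCharacter.LSeries.mul_mu_eq_one χ hs
  have h2 := hC ((fun n : ℕ ↦ χ n) * fun n : ℕ ↦ ((ArithmeticFunction.moebius n : ℤ) : ℂ)) (fun n ↦ ?_)
    s hs hs2
  · have h3 := congrArg norm h1
    rw [norm_mul, norm_one] at h3
    rw [le_div_iff₀ (by linarith)] at h2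
    rw [div_le_iff₀ hC0]
    calc s.re - 1 = ‖LSeries (fun n ↦ χ n) s‖ *
        (‖LSeries ((fun n : ℕ ↦ χ n) * fun n : ℕ ↦ ((ArithmeticFunction.moebius n : ℤ) : ℂ)) s‖ *
          (s.re - 1)) := by rw [← mul_assoc, h3, one_mul]
      _ ≤ _ := by gcongr
  · simp only [Pi.mul_apply, norm_mul]
    refine mul_le_one₀ (χ.norm_le_one _) (norm_nonneg _) ?_
    rw [Complex.norm_intCast]
    exact_mod_cast ArithmeticFunction.abs_moebius_le_one

set_option maxHeartbeats 800000 in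
lemma exists_quadratic_lower {η : ℝ} (hη : 0 < η) (hη2 : η ≤ 1 / 2) : ∃ c : ℝ, 0 < c ∧ c ≤ 1 ∧
    ∀ (q : ℕ) [NeZero q] (χ : DirichletCharacter ℂ q), χ ≠ 1 → χ ^ 2 = 1 →
      ∀ s : ℂ, 1 < s.re → s.re ≤ 2 →
        c * (q : ℝ) ^ (-(2 / 3) : ℝ) / height q s.im ^ (10 * η) ≤ ‖LSeries (fun n ↦ χ n) s‖ := by
  obtain ⟨C, hC1, hC⟩ := exists_norm_LSeries_le
  obtain ⟨c1, hc1, hc11, hlow⟩ := exists_real_lower hη hη2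
  have hKη := boundConst_ge hη hη2
  have hK := le_boundConst hη hη2
  set K := boundConst η
  have hKpos : 0 < K := by linarith
  set c := c1 / (270 * 8 * K * C) with hc
  have hden : 1 ≤ 270 * 8 * K * C := by nlinarith
  refine ⟨c, by positivity, ?_, fun q _ χ hχ hχ2 s hs hs2 ↦ ?_⟩
  · rw [hc, div_le_one (by linarith)]; linarith
  have hq : (1 : ℝ) ≤ q := by exact_mod_cast NeZero.one_le
  have hm := hasMean_char hχ
  have hZ4 : 4 ≤ height q s.im := one_le_height (q := q) s.im
  have hZ1 : 1 ≤ height q s.im ^ (2 * η) := Real.one_le_rpow (by linarith) (by linarith)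
  have hZ8 : 1 ≤ height q s.im ^ (8 * η) := Real.one_le_rpow (by linarith) (by linarith)
  have hZ10 : height q s.im ^ (10 * η) = height q s.im ^ (2 * η) * height q s.im ^ (8 * η) := by
    rw [← Real.rpow_add (by linarith)]; ring_nf
  have hQ0 : 0 < (q : ℝ) ^ (-(2 / 3) : ℝ) := by positivity
  have hQ1 : (q : ℝ) ^ (-(2 / 3) : ℝ) ≤ 1 := Real.rpow_le_one_of_one_le_of_nonpos hq (by norm_num)
  have hL1 := le_norm_regPart_one hχ hχ2
  set Q := (q : ℝ) ^ (-(2 / 3) : ℝ)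
  rw [hZ10]
  set Z2 := height q s.im ^ (2 * η) with hZ2
  set Z8 := height q s.im ^ (8 * η)
  set τ := 1 / 270 * Q / (8 * K * Z2) with hτ
  have hKZ : K ≤ K * Z2 := le_mul_of_one_le_right hKpos.le hZ1
  have hτ0 : 0 < τ := by positivity
  have hτη : τ ≤ η / 8 := by
    rw [hτ, div_le_iff₀ (by positivity)]
    rw [div_le_iff₀ hη] at hKη
    nlinarith
  have target : c * Q / (Z2 * Z8) = c1 * τ / Z8 / C := by
    rw [hc, hτ]; field_simp
  rw [target]
  rcases le_or_gt τ |s.im| with h1 | h1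
  · refine le_trans ?_ (hlow q χ 0 hm s hs hs2 (Or.inl rfl) τ hτ0 (by linarith) h1)
    exact div_le_self (by positivity) hC1
  rcases le_or_gt τ (s.re - 1) with h2 | h2
  · refine le_trans ?_ (inv_le_norm_LSeries χ hC (by linarith) hs hs2)
    have : c1 * τ / Z8 ≤ τ := by
      rw [div_le_iff₀ (by linarith)]
      nlinarith
    gcongr
    linarith
  have hs1 : ‖s - 1‖ ≤ 2 * τ := by
    refine (Complex.norm_le_abs_re_add_abs_im _).trans ?_
    simp only [sub_re, one_re, sub_im, one_im, sub_zero]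
    rw [abs_of_pos (by linarith : 0 < s.re - 1)]
    linarith
  have hball : ∀ w ∈ Metric.closedBall (1 : ℂ) (2 * τ), 1 - η / 2 ≤ w.re ∧ w.re ≤ 5 / 2 ∧ |w.im| ≤ 1 := by
    intro w hw
    have h := mem_closedBall_iff_norm.mp hw
    have h1 := abs_le.mp ((Complex.abs_re_le_norm (w - 1)).trans h)
    have h2 := (Complex.abs_im_le_norm (w - 1)).trans h
    simp only [sub_re, one_re, sub_im, one_im, sub_zero] at h1 h2
    exact ⟨by linarith, by linarith, by linarith⟩
  have hmv := Convex.norm_image_sub_le_of_norm_deriv_le (f := contSeries (fun n ↦ χ n) 0)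
    (C := 2 * K * Z2) (s := Metric.closedBall (1 : ℂ) (2 * τ)) (x := 1) (y := s)
    (fun w hw ↦ hm.differentiableAt_contSeries (by linarith [(hball w hw).1]) (Or.inl rfl))
    (fun w hw ↦ ?_) (convex_closedBall _ _) (Metric.mem_closedBall_self (by linarith))
    (by rwa [mem_closedBall_iff_norm])
  · rw [hm.contSeries_eq hs]
    have e1 : contSeries (fun n ↦ χ n) 0 1 = regPart (fun n ↦ χ n) 0 1 := by simp [contSeries]
    rw [e1] at hmv
    have h3 := norm_sub_norm_le (regPart (fun n ↦ χ n) 0 1) (contSeries (fun n ↦ χ n) 0 s)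
    rw [norm_sub_rev] at h3
    have h4 : 2 * K * Z2 * ‖s - 1‖ ≤ 1 / 270 * Q / 2 := by
      calc 2 * K * Z2 * ‖s - 1‖ ≤ 2 * K * Z2 * (2 * τ) := by gcongr
        _ = _ := by rw [hτ]; field_simp; norm_num
    have h5 : c1 * τ / Z8 / C ≤ τ := by
      rw [div_div, div_le_iff₀ (by positivity)]
      have : 1 ≤ Z8 * C := by nlinarith
      nlinarith
    have h6 : τ ≤ 1 / 270 * Q / 2 := by
      rw [hτ]
      gcongr
      nlinarith
    linarith
  · obtain ⟨g1, g2, g3⟩ := hball w hw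
    refine (hm.norm_deriv_contSeries_le hη hη2 g1 g2 (Or.inl rfl)).trans ?_
    have : (2 * q * (|w.im| + 2) : ℝ) ≤ 2 * height q s.im := by
      rw [height]; nlinarith [abs_nonneg s.im]
    calc K * (2 * q * (|w.im| + 2) : ℝ) ^ (2 * η) ≤ K * (2 * height q s.im) ^ (2 * η) := by gcongr
      _ = K * (2 ^ (2 * η) * Z2) := by
          rw [Real.mul_rpow (by norm_num) (by linarith)]
      _ ≤ K * (2 * Z2) := by
          have : (2 : ℝ) ^ (2 * η) ≤ 2 ^ (1 : ℝ) :=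
            Real.rpow_le_rpow_of_exponent_le (by norm_num) (by linarith)
          rw [Real.rpow_one] at this
          gcongr
      _ = 2 * K * Z2 := by ring

lemma height_rpow_half_le (q : ℕ) [NeZero q] (t : ℝ) {e : ℝ} (he : e ≤ 1 / 2) :
    height q t ^ e ≤ 2 * q * √(|t| + 2) := by
  have hq : (1 : ℝ) ≤ q := by exact_mod_cast NeZero.one_le
  have hZ4 : 4 ≤ height q t := one_le_height (q := q) t
  calc height q t ^ e ≤ height q t ^ (1 / 2 : ℝ) :=
        Real.rpow_le_rpow_of_exponent_le (by linarith) he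
    _ = √(2 * q) * √(|t| + 2) := by
        rw [← Real.sqrt_eq_rpow, height, Real.sqrt_mul (by positivity)]
    _ ≤ 2 * q * √(|t| + 2) := by
        gcongr
        rw [Real.sqrt_le_left (by positivity)]
        nlinarith

lemma exists_LSeries_logTwist_complex (j : ℕ) : ∃ C : ℝ, 0 < C ∧
    ∀ (q : ℕ) [NeZero q] (χ : DirichletCharacter ℂ q), χ ^ 2 ≠ 1 →
      ∀ s : ℂ, 1 < s.re → s.re ≤ 2 → ‖LSeries (logTwist χ j) s‖ ≤ C * q * √(|s.im| + 2) := by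
  set η : ℝ := 1 / (24 * (j + 1)) with hη_def
  have hη : 0 < η := by positivity
  have hη2 : η ≤ 1 / 2 := by
    rw [hη_def]; gcongr; have : (0 : ℝ) ≤ j := j.cast_nonneg; linarith
  obtain ⟨c, hc, hc1, hlow⟩ := exists_complex_lower hη hη2
  have hK := le_boundConst hη hη2
  refine ⟨j.factorial * (4 * boundConst η / c) ^ (j + 1) * 2, by positivity, fun q _ χ hχ s hs hs2 ↦ ?_⟩
  have hχ1 : χ ≠ 1 := by rintro rfl; simp at hχ
  have hZ4 : 4 ≤ height q s.im := one_le_height (q := q) s.im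
  have hZ8 : 1 ≤ height q s.im ^ (8 * η) := Real.one_le_rpow (by linarith) (by linarith)
  have h := norm_LSeries_logTwist_le χ (hasMean_char hχ1) hη hη2 j hs hs2 (Or.inl rfl)
    (δ := c / height q s.im ^ (8 * η)) (by positivity)
    (by rw [div_le_one (by linarith)]; linarith) (hlow q χ hχ s hs hs2)
  refine h.trans ?_
  have e : 4 * boundConst η * height q s.im ^ (2 * η) / (c / height q s.im ^ (8 * η)) =
      4 * boundConst η / c * height q s.im ^ (10 * η) := by
    rw [show 10 * η = 2 * η + 8 * η by ring, Real.rpow_add (by linarith)]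
    field_simp
  rw [e, mul_pow, ← Real.rpow_natCast (_ ^ _), ← Real.rpow_mul (by linarith)]
  have := height_rpow_half_le q s.im (e := 10 * η * (j + 1 : ℕ)) (by
    rw [hη_def]; push_cast; field_simp; norm_num)
  calc _ ≤ j.factorial * ((4 * boundConst η / c) ^ (j + 1) * (2 * q * √(|s.im| + 2))) := by gcongr
    _ = _ := by ring

lemma exists_LSeries_logTwist_ne_one (j : ℕ) : ∃ C : ℝ, 0 < C ∧
    ∀ (q : ℕ) [NeZero q] (χ : DirichletCharacter ℂ q), χ ≠ 1 →
      ∀ s : ℂ, 1 < s.re → s.re ≤ 2 → ‖LSeries (logTwist χ j) s‖ ≤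
        C * ((q : ℝ) ^ (2 / 3 * (j + 1) : ℝ) * q) * √(|s.im| + 2) := by
  set η : ℝ := 1 / (24 * (j + 1)) with hη_def
  have hη : 0 < η := by positivity
  have hη2 : η ≤ 1 / 2 := by
    rw [hη_def]; gcongr; have : (0 : ℝ) ≤ j := j.cast_nonneg; linarith
  obtain ⟨C₁, hC₁, h₁⟩ := exists_LSeries_logTwist_complex j
  obtain ⟨c, hc, hc1, hlow⟩ := exists_quadratic_lower hη hη2
  have hK := le_boundConst hη hη2
  set C₂ := j.factorial * (4 * boundConst η / c) ^ (j + 1) * 2 with hC₂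
  refine ⟨C₁ + C₂, by positivity, fun q _ χ hχ s hs hs2 ↦ ?_⟩
  have hq : (1 : ℝ) ≤ q := by exact_mod_cast NeZero.one_le
  have hQ1 : 1 ≤ (q : ℝ) ^ (2 / 3 * (j + 1) : ℝ) := Real.one_le_rpow hq (by positivity)
  rw [add_mul, add_mul]
  by_cases hχ2 : χ ^ 2 = 1
  swap
  · refine (h₁ q χ hχ2 s hs hs2).trans ((?_ : _ ≤ _).trans (le_add_of_nonneg_right (by positivity)))
    gcongr
    nlinarith
  refine le_trans ?_ (le_add_of_nonneg_left (by positivity))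
  have hZ4 : 4 ≤ height q s.im := one_le_height (q := q) s.im
  have hZ8 : 1 ≤ height q s.im ^ (10 * η) := Real.one_le_rpow (by linarith) (by linarith)
  have hQ0 : 0 < (q : ℝ) ^ (-(2 / 3) : ℝ) := by positivity
  have hQ2 : (q : ℝ) ^ (-(2 / 3) : ℝ) ≤ 1 := Real.rpow_le_one_of_one_le_of_nonpos hq (by norm_num)
  have h := norm_LSeries_logTwist_le χ (hasMean_char hχ) hη hη2 j hs hs2 (Or.inl rfl)
    (δ := c * (q : ℝ) ^ (-(2 / 3) : ℝ) / height q s.im ^ (10 * η)) (by positivity)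
    (by rw [div_le_one (by linarith)]; nlinarith) (hlow q χ hχ hχ2 s hs hs2)
  refine h.trans ?_
  have e : 4 * boundConst η * height q s.im ^ (2 * η) /
      (c * (q : ℝ) ^ (-(2 / 3) : ℝ) / height q s.im ^ (10 * η)) =
      4 * boundConst η / c * (q : ℝ) ^ (2 / 3 : ℝ) * height q s.im ^ (12 * η) := by
    rw [show 12 * η = 2 * η + 10 * η by ring, Real.rpow_add (by linarith), Real.rpow_neg (by linarith)]
    field_simp
  rw [e, mul_pow, mul_pow, ← Real.rpow_natCast (_ ^ (12 * η)), ← Real.rpow_mul (by linarith),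
    ← Real.rpow_natCast (_ ^ (2 / 3 : ℝ)), ← Real.rpow_mul (by linarith)]
  have := height_rpow_half_le q s.im (e := 12 * η * (j + 1 : ℕ)) (by
    rw [hη_def]; push_cast; field_simp; norm_num)
  push_cast at this ⊢
  calc _ ≤ j.factorial * ((4 * boundConst η / c) ^ (j + 1) * (q : ℝ) ^ (2 / 3 * (j + 1) : ℝ) *
        (2 * q * √(|s.im| + 2))) := by gcongr
    _ = _ := by rw [hC₂]; ring

lemma one_char_one (n : ℕ) : (1 : DirichletCharacter ℂ 1) n = 1 := by
  rw [Subsingleton.elim (n : ZMod 1) 1, map_one]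

lemma hasMean_one : HasMean (fun n ↦ (1 : DirichletCharacter ℂ 1) n) 1 (2 * (1 : ℕ)) := by
  have := hasMean_one_char 1
  simpa using this

/-- The sequence `(Λ(n) - 1) (log n)^j`. -/
noncomputable def logDefect (j n : ℕ) : ℂ :=
  (((ArithmeticFunction.vonMangoldt n - 1) * Real.log n ^ j : ℝ) : ℂ)

/-- The entire part of the zeta function, `R(s) = ζ(s) - s / (s - 1)`. -/
noncomputable def zetaReg (s : ℂ) : ℂ := regPart (fun n ↦ (1 : DirichletCharacter ℂ 1) n) 1 s

/-- The function `(s - 1) ζ(s)`, continued to `re s > 0`. -/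
noncomputable def zetaPole (s : ℂ) : ℂ := s + (s - 1) * zetaReg s

lemma differentiableAt_zetaReg {s : ℂ} (hs : 0 < s.re) : DifferentiableAt ℂ zetaReg s :=
  hasMean_one.differentiableAt_regPart hs

lemma LSeries_one_eq_contSeries {s : ℂ} (hs : 1 < s.re) : LSeries 1 s = s / (s - 1) + zetaReg s := by
  have h := hasMean_one.LSeries_eq hs
  rw [ofReal_one, one_mul] at h
  rw [zetaReg, ← h]
  exact congrArg (LSeries · s) (funext fun n ↦ (one_char_one n).symm)

lemma differentiableAt_zetaPole {s : ℂ} (hs : 0 < s.re) : DifferentiableAt ℂ zetaPole s :=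
  differentiableAt_id.add ((differentiableAt_id.sub_const 1).mul (differentiableAt_zetaReg hs))

lemma zetaPole_ne_zero {s : ℂ} (hs : 1 ≤ s.re) : zetaPole s ≠ 0 := by
  rcases eq_or_ne s 1 with rfl | h1
  · simp [zetaPole]
  have hs1 : s - 1 ≠ 0 := sub_ne_zero.mpr h1
  suffices h : zetaPole s = (s - 1) * riemannZeta s by
    rw [h]; exact mul_ne_zero hs1 (riemannZeta_ne_zero_of_one_le_re hs)
  have hne : (𝓝[{z : ℂ | 1 < z.re}] s).NeBot := by
    refine mem_closure_iff_nhdsWithin_neBot.mp ?_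
    rw [Complex.closure_setOfPred_lt_re]
    exact hs
  have c1 : Tendsto zetaPole (𝓝[{z : ℂ | 1 < z.re}] s) (𝓝 (zetaPole s)) :=
    (differentiableAt_zetaPole (by linarith)).continuousAt.tendsto.mono_left nhdsWithin_le_nhds
  have c2 : Tendsto (fun z ↦ (z - 1) * riemannZeta z) (𝓝[{z : ℂ | 1 < z.re}] s)
      (𝓝 ((s - 1) * riemannZeta s)) :=
    (((differentiableAt_id.sub_const 1).mul
      (differentiableAt_riemannZeta h1)).continuousAt.tendsto).mono_left nhdsWithin_le_nhds
  refine tendsto_nhds_unique c1 (c2.congr' ?_)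
  filter_upwards [self_mem_nhdsWithin] with z hz
  have hz1 : z - 1 ≠ 0 := by
    intro h; rw [sub_eq_zero] at h; rw [h] at hz; simp at hz
  rw [← LSeries_one_eq_riemannZeta hz, LSeries_one_eq_contSeries hz, zetaPole]
  field_simp

lemma LSeries_vonMangoldt_sub_one {s : ℂ} (hs : 1 < s.re) :
    LSeries ((fun n : ℕ ↦ (ArithmeticFunction.vonMangoldt n : ℂ)) - 1) s =
      -(deriv zetaPole s / zetaPole s) - 1 - zetaReg s := by
  have hs1 : s - 1 ≠ 0 := by
    intro h; rw [sub_eq_zero] at h; rw [h] at hs; simp at hs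
  have hR := differentiableAt_zetaReg (s := s) (by linarith)
  have hopen : IsOpen {z : ℂ | 1 < z.re} := isOpen_lt continuous_const continuous_re
  have hd : deriv (LSeries 1) s = -1 / (s - 1) ^ 2 + deriv zetaReg s := by
    have : Set.EqOn (LSeries 1) (fun z ↦ z / (z - 1) + zetaReg z) {z : ℂ | 1 < z.re} :=
      fun z hz ↦ LSeries_one_eq_contSeries hz
    rw [(this.eventuallyEq_of_mem (hopen.mem_nhds hs)).deriv_eq]
    have h1 : HasDerivAt (fun z : ℂ ↦ z / (z - 1)) ((1 * (s - 1) - s * 1) / (s - 1) ^ 2) s :=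
      (hasDerivAt_id s).div ((hasDerivAt_id s).sub_const 1) hs1
    rw [(h1.fun_add hR.hasDerivAt).deriv]
    ring
  have hP : deriv zetaPole s = 1 + (zetaReg s + (s - 1) * deriv zetaReg s) := by
    have := (hasDerivAt_id s).add (((hasDerivAt_id s).sub_const 1).mul hR.hasDerivAt)
    rw [show zetaPole = id + (fun z ↦ id z - 1) * zetaReg from rfl, this.deriv]
    simp
  have hP0 := zetaPole_ne_zero hs.le
  rw [LSeries_sub (ArithmeticFunction.LSeriesSummable_vonMangoldt hs)
      (LSeriesSummable_one_iff.mpr hs),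
    ArithmeticFunction.LSeries_vonMangoldt_eq hs, hd, LSeries_one_eq_contSeries hs, hP]
  have e : s / (s - 1) + zetaReg s = zetaPole s / (s - 1) := by rw [zetaPole]; field_simp
  rw [e]
  have h2 : zetaReg s = (zetaPole s - s) / (s - 1) := by rw [zetaPole]; field_simp; ring
  rw [h2]
  field_simp
  ring

lemma logDefect_eq (j : ℕ) : logDefect j =
    LSeries.logMul^[j] ((fun n : ℕ ↦ (ArithmeticFunction.vonMangoldt n : ℂ)) - 1) := by
  induction j with
  | zero => funext n; simp [logDefect]
  | succ j ih =>
    rw [Function.iterate_succ_apply', ← ih]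
    funext n
    simp only [logDefect, LSeries.logMul, ← Complex.natCast_log]
    push_cast
    ring

lemma abscissa_vonMangoldt_sub_one_le : LSeries.abscissaOfAbsConv
    ((fun n : ℕ ↦ (ArithmeticFunction.vonMangoldt n : ℂ)) - 1) ≤ 1 := by
  refine LSeries.abscissaOfAbsConv_le_of_forall_lt_LSeriesSummable fun y hy ↦ ?_
  have hy' : 1 < (y : ℂ).re := by simpa using hy
  exact (ArithmeticFunction.LSeriesSummable_vonMangoldt hy').sub (LSeriesSummable_one_iff.mpr hy')

lemma logDefect_summable (j : ℕ) {s : ℂ} (hs : 1 < s.re) : LSeriesSummable (logDefect j) s := by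
  refine LSeriesSummable_of_abscissaOfAbsConv_lt_re ?_
  rw [logDefect_eq, LSeries.absicssaOfAbsConv_logPowMul]
  exact abscissa_vonMangoldt_sub_one_le.trans_lt (by exact_mod_cast hs)

lemma exists_LSeries_logDefect_near (j : ℕ) : ∃ C : ℝ, 0 < C ∧ ∀ s : ℂ, 1 < s.re → s.re ≤ 2 →
    |s.im| ≤ 1 → ‖LSeries (logDefect j) s‖ ≤ C := by
  set H : ℂ → ℂ := fun s ↦ -(deriv zetaPole s / zetaPole s) - 1 - zetaReg s with hH
  set U : Set ℂ := {z : ℂ | 0 < z.re} with hU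
  have hUo : IsOpen U := isOpen_lt continuous_const continuous_re
  have hPd : DifferentiableOn ℂ zetaPole U :=
    fun z hz ↦ (differentiableAt_zetaPole hz).differentiableWithinAt
  set V : Set ℂ := U ∩ zetaPole ⁻¹' {0}ᶜ with hV
  have hVo : IsOpen V := hPd.continuousOn.isOpen_inter_preimage hUo isOpen_compl_singleton
  have hHd : DifferentiableOn ℂ H V := by
    refine ((DifferentiableOn.div ((hPd.deriv hUo).mono inter_subset_left)
      (hPd.mono inter_subset_left) fun z hz ↦ hz.2).neg.sub_const 1).sub fun z hz ↦ ?_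
    exact (differentiableAt_zetaReg hz.1).differentiableWithinAt
  have hcont : ContinuousOn (iteratedDeriv j H) V := by
    have := (hHd.contDiffOn (n := j) hVo).continuousOn_iteratedDerivWithin le_rfl hVo.uniqueDiffOn
    exact this.congr fun z hz ↦ (iteratedDerivWithin_of_isOpen hVo hz).symm
  have hKc : IsCompact (Set.Icc (1 : ℝ) 2 ×ℂ Set.Icc (-1 : ℝ) 1) :=
    isCompact_Icc.reProdIm isCompact_Icc
  obtain ⟨C, hC⟩ := hKc.exists_bound_of_continuousOn (hcont.mono fun z hz ↦ by
    rw [Complex.mem_reProdIm] at hz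
    exact ⟨lt_of_lt_of_le one_pos hz.1.1, zetaPole_ne_zero hz.1.1⟩)
  refine ⟨|C| + 1, by positivity, fun s hs hs2 him ↦ ?_⟩
  have hopen : IsOpen {z : ℂ | 1 < z.re} := isOpen_lt continuous_const continuous_re
  have h1 := LSeries_iteratedDeriv
    (f := (fun n : ℕ ↦ (ArithmeticFunction.vonMangoldt n : ℂ)) - 1) j (s := s)
    (abscissa_vonMangoldt_sub_one_le.trans_lt (by exact_mod_cast hs))
  rw [← logDefect_eq] at h1
  have heq : Set.EqOn (LSeries ((fun n : ℕ ↦ (ArithmeticFunction.vonMangoldt n : ℂ)) - 1)) H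
      {z : ℂ | 1 < z.re} := fun z hz ↦ LSeries_vonMangoldt_sub_one hz
  rw [(heq.eventuallyEq_of_mem (hopen.mem_nhds hs)).iteratedDeriv_eq j] at h1
  have h2 : ‖LSeries (logDefect j) s‖ = ‖iteratedDeriv j H s‖ := by
    rw [h1, norm_mul]; simp
  rw [h2]
  refine (hC s ?_).trans (by linarith [le_abs_self C])
  rw [Complex.mem_reProdIm]
  exact ⟨⟨hs.le, hs2⟩, abs_le.mp him⟩

lemma exists_LSeries_log_pow (j : ℕ) : ∃ C : ℝ, 0 < C ∧ ∀ s : ℂ, 1 < s.re → s.re ≤ 2 →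
    1 ≤ |s.im| → ‖LSeries (LSeries.logMul^[j] 1) s‖ ≤ C * √(|s.im| + 2) := by
  refine ⟨j.factorial * (640 * 4) / (1 / 8) ^ j, by positivity, fun s hs hs2 him ↦ ?_⟩
  set H : ℂ → ℂ := fun z ↦ z / (z - 1) + zetaReg z with hH
  have hopen : IsOpen {z : ℂ | 1 < z.re} := isOpen_lt continuous_const continuous_re
  have h1 := LSeries_iteratedDeriv (f := 1) j (s := s)
    (by rw [LSeries.abscissaOfAbsConv_one]; exact_mod_cast hs)
  have heq : Set.EqOn (LSeries 1) H {z : ℂ | 1 < z.re} := fun z hz ↦ LSeries_one_eq_contSeries hz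
  rw [(heq.eventuallyEq_of_mem (hopen.mem_nhds hs)).iteratedDeriv_eq j] at h1
  have h2 : ‖LSeries (LSeries.logMul^[j] 1) s‖ = ‖iteratedDeriv j H s‖ := by
    rw [h1, norm_mul]; simp
  have hball : ∀ w ∈ Metric.closedBall s (1 / 8), 1 - 1 / 4 ≤ w.re ∧ w.re ≤ 3 ∧ 1 / 2 ≤ |w.im| ∧
      |w.im| ≤ |s.im| + 1 := by
    intro w hw
    have h := mem_closedBall_iff_norm.mp hw
    have h1 := abs_le.mp ((Complex.abs_re_le_norm (w - s)).trans h)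
    have h2 := (Complex.abs_im_le_norm (w - s)).trans h
    rw [Complex.sub_re] at h1
    rw [Complex.sub_im] at h2
    have h3 := abs_sub_abs_le_abs_sub w.im s.im
    have h4 := abs_sub_abs_le_abs_sub s.im w.im
    rw [abs_sub_comm] at h4
    exact ⟨by linarith, by linarith, by linarith, by linarith⟩
  have hne {w : ℂ} (hw : w ∈ Metric.closedBall s (1 / 8)) : w - 1 ≠ 0 :=
    sub_ne_zero.mpr (ne_one_of_im (hball w hw).2.2.1)
  have hd : DifferentiableOn ℂ H (Metric.closedBall s (1 / 8)) := fun w hw ↦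
    ((DifferentiableAt.div (c := fun z : ℂ ↦ z) (d := fun z : ℂ ↦ z - 1) (by fun_prop)
      (by fun_prop) (hne hw)).add
      (differentiableAt_zetaReg (s := w) (by linarith [(hball w hw).1]))).differentiableWithinAt
  rw [h2]
  have hT : 1 ≤ √(|s.im| + 2) := Real.one_le_sqrt.mpr (by linarith)
  refine (norm_iteratedDeriv_le_of_forall_mem_sphere_norm_le (C := 640 * 4 * √(|s.im| + 2)) j
    (by norm_num : (0 : ℝ) < 1 / 8)
    (hd.mono Metric.closure_ball_subset_closedBall).diffContOnCl fun w hw ↦ ?_).trans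
    (le_of_eq (by ring))
  have hw' := Metric.sphere_subset_closedBall hw
  obtain ⟨g1, g2, g3, g4⟩ := hball w hw'
  have h3 : ‖zetaReg w‖ ≤ 40 * (1 + 1 / (1 / 4)) * ((2 * (1 : ℕ) : ℝ) * (|w.im| + 2)) ^ (2 * (1 / 4) : ℝ) :=
    hasMean_one.norm_regPart_le (by norm_num) (by norm_num) g1 g2
  rw [show (2 * (1 / 4) : ℝ) = 1 / 2 by norm_num, ← Real.sqrt_eq_rpow] at h3
  have h4 : √((2 * (1 : ℕ) : ℝ) * (|w.im| + 2)) ≤ 4 * √(|s.im| + 2) := by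
    rw [show (4 : ℝ) = √16 by rw [show (16 : ℝ) = 4 ^ 2 by norm_num]; simp, ← Real.sqrt_mul (by norm_num)]
    refine Real.sqrt_le_sqrt ?_
    push_cast; linarith [abs_nonneg s.im]
  have h5 : ‖w / (w - 1)‖ ≤ 3 := by
    have e : w / (w - 1) = 1 + 1 / (w - 1) := by have := hne hw'; field_simp; ring
    rw [e]
    refine (norm_add_le _ _).trans ?_
    have : 1 / 2 ≤ ‖w - 1‖ := by
      have := Complex.abs_im_le_norm (w - 1)
      simp only [sub_im, one_im, sub_zero] at this
      linarith
    rw [norm_one, norm_div, norm_one]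
    have : 1 / ‖w - 1‖ ≤ 1 / (1 / 2) := by gcongr
    linarith
  refine (norm_add_le _ _).trans ?_
  have h6 := h3.trans (mul_le_mul_of_nonneg_left h4 (by norm_num))
  norm_num at h6
  linarith

lemma logTwist_one_eq (j : ℕ) : logTwist (1 : DirichletCharacter ℂ 1) j =
    logDefect j + LSeries.logMul^[j] 1 := by
  have h (n : ℕ) : LSeries.logMul^[j] 1 n = ((Real.log n ^ j : ℝ) : ℂ) := by
    induction j generalizing n with
    | zero => simp
    | succ j ih =>
      rw [Function.iterate_succ_apply', LSeries.logMul, ih, ← Complex.natCast_log]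
      push_cast; ring
  funext n
  rw [Pi.add_apply, h, logTwist, one_char_one, logDefect]
  push_cast; ring

lemma exists_LSeries_logDefect (j : ℕ) : ∃ C : ℝ, 0 < C ∧ ∀ s : ℂ, 1 < s.re → s.re ≤ 2 →
    ‖LSeries (logDefect j) s‖ ≤ C * √(|s.im| + 2) := by
  obtain ⟨C₁, hC₁, h₁⟩ := exists_LSeries_logDefect_near j
  obtain ⟨C₂, hC₂, h₂⟩ := exists_LSeries_log_pow j
  set η : ℝ := 1 / (24 * (j + 1)) with hη_def
  have hη : 0 < η := by positivity
  have hη2 : η ≤ 1 / 2 := by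
    rw [hη_def]; gcongr; have : (0 : ℝ) ≤ j := j.cast_nonneg; linarith
  obtain ⟨c, hc, hc1, hlow⟩ := exists_real_lower hη hη2
  have hK := le_boundConst hη hη2
  set C₃ := j.factorial * (4 * boundConst η / c) ^ (j + 1) * 2 with hC₃
  refine ⟨C₁ + C₂ + C₃, by positivity, fun s hs hs2 ↦ ?_⟩
  have hT : 1 ≤ √(|s.im| + 2) := Real.one_le_sqrt.mpr (by linarith [abs_nonneg s.im])
  rcases le_total |s.im| 1 with him | him
  · refine (h₁ s hs hs2 him).trans ?_
    have : 0 ≤ C₂ + C₃ := by positivity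
    nlinarith
  have e0 : logDefect j = logTwist (1 : DirichletCharacter ℂ 1) j - LSeries.logMul^[j] 1 := by
    rw [logTwist_one_eq]; simp
  have hs1 : LSeriesSummable (LSeries.logMul^[j] 1) s := by
    have := (logTwist_summable (1 : DirichletCharacter ℂ 1) j hs).sub (logDefect_summable j hs)
    rwa [logTwist_one_eq, add_sub_cancel_left] at this
  rw [e0, LSeries_sub (logTwist_summable _ j hs) hs1]
  have hZ4 : 4 ≤ height 1 s.im := one_le_height (q := 1) s.im
  have hZ8 : 1 ≤ height 1 s.im ^ (8 * η) := Real.one_le_rpow (by linarith) (by linarith)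
  have h := norm_LSeries_logTwist_le 1 hasMean_one hη hη2 j hs hs2 (Or.inr him)
    (δ := c / height 1 s.im ^ (8 * η)) (by positivity)
    (by rw [div_le_one (by linarith)]; linarith)
    (by simpa using hlow 1 1 1 hasMean_one s hs hs2 (Or.inr (by linarith)) 1 one_pos le_rfl him)
  have e : 4 * boundConst η * height 1 s.im ^ (2 * η) / (c / height 1 s.im ^ (8 * η)) =
      4 * boundConst η / c * height 1 s.im ^ (10 * η) := by
    rw [show 10 * η = 2 * η + 8 * η by ring, Real.rpow_add (by linarith)]
    field_simp
  rw [e, mul_pow, ← Real.rpow_natCast (_ ^ _), ← Real.rpow_mul (by linarith)] at h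
  have h3 := height_rpow_half_le 1 s.im (e := 10 * η * (j + 1 : ℕ)) (by
    rw [hη_def]; push_cast; field_simp; norm_num)
  have h4 : ‖LSeries (logTwist (1 : DirichletCharacter ℂ 1) j) s‖ ≤ C₃ * √(|s.im| + 2) := by
    refine h.trans ?_
    calc _ ≤ j.factorial * ((4 * boundConst η / c) ^ (j + 1) * (2 * (1 : ℕ) * √(|s.im| + 2))) := by
          gcongr
      _ = _ := by rw [hC₃]; push_cast; ring
  refine (norm_sub_le _ _).trans ((add_le_add h4 (h₂ s hs hs2 him)).trans ?_)
  nlinarith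

/-- The function `u ↦ max (1 - u) 0`, complex valued. -/
noncomputable def hat (u : ℝ) : ℂ := ((max (1 - u) 0 : ℝ) : ℂ)

/-- The Mellin transform of `hat`. -/
noncomputable def hatKernel (s : ℂ) : ℂ := 1 / s - 1 / (s + 1)

lemma hasMellin_hat {s : ℂ} (hs : 0 < s.re) : HasMellin hat s (hatKernel s) := by
  have h1 := hasMellin_one_Ioc hs
  have h2 := hasMellin_cpow_Ioc 1 (s := s) (by rw [one_re]; linarith)
  have h := hasMellin_sub h1.1 h2.1
  rw [h1.2, h2.2] at h
  have e : Set.EqOn hat (fun t ↦ (Set.Ioc (0 : ℝ) 1).indicator (fun _ ↦ (1 : ℂ)) t -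
      (Set.Ioc (0 : ℝ) 1).indicator (fun t ↦ (t : ℂ) ^ (1 : ℂ)) t) (Set.Ioi 0) := by
    intro t ht
    rw [Set.mem_Ioi] at ht
    by_cases h : t ≤ 1
    · have : t ∈ Set.Ioc (0 : ℝ) 1 := ⟨ht, h⟩
      simp [hat, this, h]
    · have : t ∉ Set.Ioc (0 : ℝ) 1 := fun h' ↦ h h'.2
      simp [hat, this, (not_le.mp h).le]
  refine ⟨?_, ?_⟩
  · refine h.1.congr_fun (fun t ht ↦ ?_) measurableSet_Ioi
    simp only [e ht]
  · rw [← hatKernel] at h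
    rw [← h.2, mellin, mellin]
    exact setIntegral_congr_fun measurableSet_Ioi fun t ht ↦ by simp only [e ht]

lemma norm_hatKernel_le {σ : ℝ} (hσ : 1 ≤ σ) (t : ℝ) :
    ‖hatKernel (σ + t * I)‖ ≤ 1 / (1 + t ^ 2) := by
  have key (u : ℝ) (hu : 1 ≤ u) : √(1 + t ^ 2) ≤ ‖(u : ℂ) + t * I‖ := by
    rw [Complex.norm_add_mul_I]
    exact Real.sqrt_le_sqrt (by nlinarith)
  have h0 : 0 < √(1 + t ^ 2) := Real.sqrt_pos.mpr (by positivity)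
  have h1 := key σ hσ
  have h2 := key (σ + 1) (by linarith)
  have e2 : (σ : ℂ) + t * I + 1 = ((σ + 1 : ℝ) : ℂ) + t * I := by push_cast; ring
  have n1 : (σ : ℂ) + t * I ≠ 0 := norm_pos_iff.mp (h0.trans_le h1)
  have n2 : ((σ + 1 : ℝ) : ℂ) + t * I ≠ 0 := norm_pos_iff.mp (h0.trans_le h2)
  have e : hatKernel (σ + t * I) = 1 / ((σ + t * I) * (((σ + 1 : ℝ) : ℂ) + t * I)) := by
    rw [hatKernel, e2]
    field_simp
    push_cast; ring
  rw [e, norm_div, norm_one, norm_mul]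
  have : 1 + t ^ 2 = √(1 + t ^ 2) * √(1 + t ^ 2) := (Real.mul_self_sqrt (by positivity)).symm
  rw [this]
  gcongr

lemma integrable_sqrt_div : Integrable fun t : ℝ ↦ √(|t| + 2) * (1 / (1 + t ^ 2)) := by
  have h := (integrable_rpow_neg_one_add_norm_sq (E := ℝ) (μ := volume) (r := 3 / 2)
    (by norm_num)).const_mul 2
  refine h.mono' ?_ (Eventually.of_forall fun t ↦ ?_)
  · have : Continuous fun t : ℝ ↦ √(|t| + 2) * (1 / (1 + t ^ 2)) := by
      refine Continuous.mul (by fun_prop) (Continuous.div (by fun_prop) (by fun_prop) fun t ↦ ?_)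
      positivity
    exact this.aestronglyMeasurable
  · have hp : 0 < 1 + t ^ 2 := by positivity
    rw [Real.norm_of_nonneg (by positivity), Real.norm_eq_abs, sq_abs,
      show (-(3 / 2) / 2 : ℝ) = 1 / 4 - 1 by norm_num, Real.rpow_sub hp, Real.rpow_one,
      mul_one_div, ← mul_div_assoc]
    gcongr
    have : (1 + t ^ 2) ^ (1 / 4 : ℝ) = √(√(1 + t ^ 2)) := by
      rw [Real.sqrt_eq_rpow, Real.sqrt_eq_rpow, ← Real.rpow_mul hp.le]; norm_num
    rw [this, show (2 : ℝ) = √4 by rw [show (4 : ℝ) = 2 ^ 2 by norm_num]; simp,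
      ← Real.sqrt_mul (by norm_num)]
    refine Real.sqrt_le_sqrt ?_
    rw [show √4 = (2 : ℝ) by rw [show (4 : ℝ) = 2 ^ 2 by norm_num]; simp,
      show (4 : ℝ) = √(4 ^ 2) by simp, ← Real.sqrt_mul (by norm_num)]
    refine Real.le_sqrt_of_sq_le ?_
    nlinarith [sq_abs t, sq_nonneg (|t| - 1), abs_nonneg t]

lemma verticalIntegrable_hatKernel {σ : ℝ} (hσ : 1 ≤ σ) :
    Integrable fun t : ℝ ↦ hatKernel (σ + t * I) := by
  have hc : Continuous fun t : ℝ ↦ hatKernel (σ + t * I) := by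
    have h (u : ℝ) (hu : 0 < u) (t : ℝ) : (u : ℂ) + t * I ≠ 0 := fun h ↦ by
      have := congrArg re h; simp at this; linarith
    refine Continuous.sub (Continuous.div continuous_const (by fun_prop) (h σ (by linarith)))
      (Continuous.div continuous_const (by fun_prop) fun t ↦ ?_)
    have := h (σ + 1) (by linarith) t
    push_cast at this
    intro h'; apply this; rw [← h']; ring
  refine integrable_inv_one_add_sq.mono' hc.aestronglyMeasurable (Eventually.of_forall fun t ↦ ?_)
  rw [← one_div]
  exact norm_hatKernel_le hσ t

lemma hat_eq_integral {σ : ℝ} (hσ : 1 ≤ σ) {u : ℝ} (hu : 0 < u) :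
    hat u = (1 / (2 * Real.pi)) • ∫ t : ℝ, (u : ℂ) ^ (-(σ + t * I)) * hatKernel (σ + t * I) := by
  have hm (t : ℝ) : HasMellin hat (σ + t * I) (hatKernel (σ + t * I)) :=
    hasMellin_hat (by simp; linarith)
  have hV : VerticalIntegrable (mellin hat) σ := by
    refine (verticalIntegrable_hatKernel hσ).congr (Eventually.of_forall fun t ↦ ?_)
    exact (hm t).2.symm
  have hcont : Continuous hat := by unfold hat; fun_prop
  have hm0 := (hm 0).1
  simp only [ofReal_zero, zero_mul, add_zero] at hm0
  rw [← mellinInv_mellin_eq σ hat hu hm0 hV hcont.continuousAt, mellinInv]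
  congr 1
  refine integral_congr_ae (Eventually.of_forall fun t ↦ ?_)
  simp only [(hm t).2, smul_eq_mul]

lemma exists_norm_sum_mul_sub_le : ∃ C : ℝ, 0 < C ∧ ∀ (a : ℕ → ℂ) (Q : ℝ),
    (∀ s : ℂ, 1 < s.re → LSeriesSummable a s) →
    (∀ s : ℂ, 1 < s.re → s.re ≤ 2 → ‖LSeries a s‖ ≤ Q * √(|s.im| + 2)) →
    ∀ y : ℝ, 3 ≤ y →
      ‖∑ n ∈ Finset.Icc 1 ⌊y⌋₊, a n * ((y - n : ℝ) : ℂ)‖ ≤ C * Q * y ^ 2 := by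
  set J : ℝ := ∫ t : ℝ, √(|t| + 2) * (1 / (1 + t ^ 2)) with hJ
  have hJ0 : 0 ≤ J := integral_nonneg fun t ↦ by positivity
  refine ⟨3 * (J + 1), by positivity, fun a Q hsum hbd y hy ↦ ?_⟩
  have hy0 : 0 < y := by linarith
  have hlog : 1 ≤ Real.log y := by
    rw [Real.le_log_iff_exp_le hy0]; linarith [Real.exp_one_lt_d9]
  have hlog0 : 0 < Real.log y := by linarith
  set σ : ℝ := 1 + 1 / Real.log y with hσ
  have hσ1 : 1 < σ := by rw [hσ]; linarith [one_div_pos.mpr hlog0]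
  have hσ2 : σ ≤ 2 := by
    have : 1 / Real.log y ≤ 1 := by rw [div_le_one hlog0]; exact hlog
    linarith
  have hyσ : y ^ σ ≤ 3 * y := by
    rw [hσ, Real.rpow_add hy0, Real.rpow_one, mul_comm]
    gcongr
    rw [Real.rpow_def_of_pos hy0, mul_one_div_cancel hlog0.ne']
    linarith [Real.exp_one_lt_d9]
  have hre (t : ℝ) : ((σ : ℂ) + t * I).re = σ := by simp
  have him (t : ℝ) : ((σ : ℂ) + t * I).im = t := by simp
  set F : ℕ → ℝ → ℂ := fun n t ↦
    LSeries.term a (σ + t * I) n * ((y : ℂ) ^ ((σ : ℂ) + t * I) * hatKernel (σ + t * I)) with hF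
  have hGc : Integrable fun t : ℝ ↦ (y : ℂ) ^ ((σ : ℂ) + t * I) * hatKernel (σ + t * I) := by
    refine (verticalIntegrable_hatKernel hσ1.le).bdd_mul (c := y ^ σ) ?_ (Eventually.of_forall fun t ↦ ?_)
    · refine Continuous.aestronglyMeasurable ?_
      exact Continuous.const_cpow (by fun_prop) (Or.inl (by exact_mod_cast hy0.ne'))
    · rw [Complex.norm_cpow_eq_rpow_re_of_pos hy0, hre]
  have hterm (n : ℕ) (t : ℝ) : ‖LSeries.term a (σ + t * I) n‖ = ‖LSeries.term a (σ : ℂ) n‖ := by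
    simp only [LSeries.norm_term_eq, hre, ofReal_re]
  have hFi (n : ℕ) : Integrable (F n) := by
    refine hGc.bdd_mul (c := ‖LSeries.term a (σ : ℂ) n‖) ?_ (Eventually.of_forall fun t ↦ (hterm n t).le)
    refine Continuous.aestronglyMeasurable ?_
    rcases eq_or_ne n 0 with rfl | hn
    · simp only [LSeries.term_zero]; exact continuous_const
    · simp only [LSeries.term_of_ne_zero hn]
      refine Continuous.div continuous_const
        (Continuous.const_cpow (by fun_prop) (Or.inl (by exact_mod_cast hn))) fun t ↦ ?_
      rw [Ne, Complex.cpow_eq_zero_iff]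
      exact fun h ↦ hn (by exact_mod_cast h.1)
  have hFs : Summable fun n ↦ ∫ t, ‖F n t‖ := by
    have h0 := (hsum (σ : ℂ) (by simpa using hσ1)).norm.mul_right
      (∫ t : ℝ, ‖(y : ℂ) ^ ((σ : ℂ) + t * I) * hatKernel (σ + t * I)‖)
    refine h0.congr fun n ↦ ?_
    rw [← integral_const_mul]
    refine integral_congr_ae (Eventually.of_forall fun t ↦ ?_)
    simp only [hF, norm_mul, hterm]
  have hS := hasSum_integral_of_summable_integral_norm hFi hFs
  have hFint (n : ℕ) (hn : n ≠ 0) : ∫ t, F n t = 2 * Real.pi * (a n * hat (n / y)) := by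
    have hn0 : (0 : ℝ) < n := by exact_mod_cast Nat.pos_of_ne_zero hn
    rw [hat_eq_integral hσ1.le (div_pos hn0 hy0), Complex.real_smul]
    push_cast
    have e : ∫ t, F n t = ∫ t : ℝ, a n * (((n / y : ℝ) : ℂ) ^ (-((σ : ℂ) + t * I)) * hatKernel (σ + t * I)) := by
      refine integral_congr_ae (Eventually.of_forall fun t ↦ ?_)
      have h1 : ((n / y : ℝ) : ℂ) ^ (-((σ : ℂ) + t * I)) =
          (y : ℂ) ^ ((σ : ℂ) + t * I) / (n : ℂ) ^ ((σ : ℂ) + t * I) := by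
        rw [Complex.cpow_neg, ofReal_div, div_cpow_ofReal_nonneg hn0.le hy0.le, inv_div, ofReal_natCast]
      simp only [hF, LSeries.term_of_ne_zero hn, h1]
      ring
    rw [e, integral_const_mul]
    have : (Real.pi : ℂ) ≠ 0 := by exact_mod_cast Real.pi_ne_zero
    push_cast
    generalize (∫ t : ℝ, ((n : ℂ) / y) ^ (-((σ : ℂ) + t * I)) * hatKernel (σ + t * I)) = z
    field_simp
  have hF0 : ∫ t, F 0 t = 0 := by simp [hF]
  have hfin : ∑' n, ∫ t, F n t = ∑ n ∈ Finset.Icc 1 ⌊y⌋₊, ∫ t, F n t := by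
    refine tsum_eq_sum fun n hn ↦ ?_
    rcases eq_or_ne n 0 with rfl | h0
    · exact hF0
    rw [hFint n h0]
    have : y < n := by
      by_contra! h
      exact hn (Finset.mem_Icc.mpr ⟨Nat.one_le_iff_ne_zero.mpr h0, Nat.le_floor h⟩)
    have : 1 - n / y ≤ 0 := by rw [sub_nonpos, one_le_div hy0]; exact this.le
    simp [hat, this]
  have hval : ∑ n ∈ Finset.Icc 1 ⌊y⌋₊, a n * ((y - n : ℝ) : ℂ) =
      y / (2 * Real.pi) * ∫ t, ∑' n, F n t := by
    rw [← hS.tsum_eq, hfin, Finset.mul_sum]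
    refine Finset.sum_congr rfl fun n hn ↦ ?_
    rw [Finset.mem_Icc] at hn
    rw [hFint n (by omega)]
    have hny : (n : ℝ) ≤ y := (Nat.le_floor_iff hy0.le).mp hn.2
    have : 0 ≤ 1 - n / y := by rw [sub_nonneg, div_le_one hy0]; exact hny
    rw [hat, max_eq_left this]
    have : (Real.pi : ℂ) ≠ 0 := by exact_mod_cast Real.pi_ne_zero
    have : (y : ℂ) ≠ 0 := by exact_mod_cast hy0.ne'
    push_cast
    field_simp
  have hQ : 0 ≤ Q := by
    have := (norm_nonneg _).trans (hbd 2 (by simp) (by simp))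
    exact nonneg_of_mul_nonneg_left this (by positivity)
  have hI : ‖∫ t, ∑' n, F n t‖ ≤ Q * y ^ σ * J := by
    rw [hJ, ← integral_const_mul]
    refine norm_integral_le_of_norm_le (integrable_sqrt_div.const_mul _) (Eventually.of_forall fun t ↦ ?_)
    have : ∑' n, F n t = LSeries a (σ + t * I) * ((y : ℂ) ^ ((σ : ℂ) + t * I) * hatKernel (σ + t * I)) := by
      simp only [hF]; rw [tsum_mul_right]; rfl
    rw [this, norm_mul, norm_mul, Complex.norm_cpow_eq_rpow_re_of_pos hy0, hre]
    have h1 := hbd (σ + t * I) (by rw [hre]; exact hσ1) (by rw [hre]; exact hσ2)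
    rw [him] at h1
    calc _ ≤ Q * √(|t| + 2) * (y ^ σ * (1 / (1 + t ^ 2))) := by
          gcongr; exact norm_hatKernel_le hσ1.le t
      _ = _ := by ring
  rw [hval, norm_mul, norm_div, norm_mul, Complex.norm_of_nonneg hy0.le,
    Complex.norm_of_nonneg Real.pi_nonneg]
  have h2 : y / (‖(2 : ℂ)‖ * Real.pi) ≤ y := by
    refine div_le_self hy0.le ?_
    rw [Complex.norm_two]
    linarith [Real.pi_gt_three]
  calc _ ≤ y * (Q * (3 * y) * (J + 1)) := by
        refine mul_le_mul h2 (hI.trans ?_) (norm_nonneg _) hy0.le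
        gcongr; linarith
    _ = _ := by ring

/-- The trapezoidal weight equal to `y' - y` on `[0, y]`, decreasing linearly to `0` on `[y, y']`. -/
noncomputable def trap (y y' : ℝ) (n : ℕ) : ℝ := max (y' - n) 0 - max (y - n) 0

lemma trap_nonneg {y y' : ℝ} (h : y ≤ y') (n : ℕ) : 0 ≤ trap y y' n :=
  sub_nonneg.mpr (max_le_max (by linarith) le_rfl)

lemma trap_le {y y' : ℝ} (h : y ≤ y') (n : ℕ) : trap y y' n ≤ y' - y := by
  rw [trap]
  have : max (y' - n) 0 ≤ max (y - n) 0 + (y' - y) := by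
    refine max_le ?_ ?_
    · linarith [le_max_left (y - n) 0]
    · linarith [le_max_right (y - n) 0]
  linarith

lemma trap_of_le {y y' : ℝ} (h : y ≤ y') {n : ℕ} (hn : (n : ℝ) ≤ y) : trap y y' n = y' - y := by
  rw [trap, max_eq_left (by linarith), max_eq_left (by linarith)]; ring

/-- The weight `Λ(n) (log n)^j`. -/
noncomputable def lam (j n : ℕ) : ℝ := ArithmeticFunction.vonMangoldt n * Real.log n ^ j

lemma lam_nonneg (j n : ℕ) : 0 ≤ lam j n :=
  mul_nonneg ArithmeticFunction.vonMangoldt_nonneg (pow_nonneg (Real.log_natCast_nonneg n) j)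

lemma lam_one (j : ℕ) : lam j 1 = 0 := by simp [lam]

lemma exists_norm_sum_trap_le : ∃ C : ℝ, 0 < C ∧ ∀ (a : ℕ → ℂ) (Q : ℝ),
    (∀ s : ℂ, 1 < s.re → LSeriesSummable a s) →
    (∀ s : ℂ, 1 < s.re → s.re ≤ 2 → ‖LSeries a s‖ ≤ Q * √(|s.im| + 2)) →
    ∀ y y' : ℝ, 3 ≤ y → y ≤ y' →
      ‖∑ n ∈ Finset.Icc 1 ⌊y'⌋₊, a n * (trap y y' n : ℂ)‖ ≤ C * Q * y' ^ 2 := by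
  obtain ⟨C, hC, h⟩ := exists_norm_sum_mul_sub_le
  refine ⟨2 * C, by positivity, fun a Q hs hb y y' hy hyy ↦ ?_⟩
  have hQ : 0 ≤ Q := by
    have := (norm_nonneg _).trans (hb 2 (by simp) (by simp))
    exact nonneg_of_mul_nonneg_left this (by positivity)
  have e : ∑ n ∈ Finset.Icc 1 ⌊y'⌋₊, a n * (trap y y' n : ℂ) =
      ∑ n ∈ Finset.Icc 1 ⌊y'⌋₊, a n * ((y' - n : ℝ) : ℂ) -
        ∑ n ∈ Finset.Icc 1 ⌊y⌋₊, a n * ((y - n : ℝ) : ℂ) := by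
    have e1 : ∑ n ∈ Finset.Icc 1 ⌊y⌋₊, a n * ((y - n : ℝ) : ℂ) =
        ∑ n ∈ Finset.Icc 1 ⌊y'⌋₊, a n * ((max (y - n) 0 : ℝ) : ℂ) := by
      rw [← Finset.sum_subset (Finset.Icc_subset_Icc le_rfl (Nat.floor_mono hyy))]
      · refine Finset.sum_congr rfl fun n hn ↦ ?_
        rw [max_eq_left]
        rw [Finset.mem_Icc] at hn
        rw [sub_nonneg]
        exact (Nat.le_floor_iff (by linarith)).mp hn.2
      · intro n hn hn'
        have : y < n := by
          by_contra! h
          exact hn' (Finset.mem_Icc.mpr ⟨(Finset.mem_Icc.mp hn).1, Nat.le_floor h⟩)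
        rw [max_eq_right (by linarith)]; simp
    rw [e1, ← Finset.sum_sub_distrib]
    refine Finset.sum_congr rfl fun n hn ↦ ?_
    have : 0 ≤ y' - n := by
      rw [sub_nonneg]
      exact (Nat.le_floor_iff (by linarith)).mp (Finset.mem_Icc.mp hn).2
    rw [trap, max_eq_left this]
    push_cast; ring
  rw [e]
  refine (norm_sub_le _ _).trans ?_
  have h1 := h a Q hs hb y' (hy.trans hyy)
  have h2 := h a Q hs hb y hy
  have h3 : C * Q * y ^ 2 ≤ C * Q * y' ^ 2 := by gcongr
  linarith

/-- The smoothed sum of `χ(n) Λ(n) (log n)^j` with the trapezoidal weight. -/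
noncomputable def twistSum {q : ℕ} (χ : DirichletCharacter ℂ q) (j : ℕ) (y y' : ℝ) : ℂ :=
  ∑ n ∈ Finset.Icc 1 ⌊y'⌋₊, χ n * ((lam j n * trap y y' n : ℝ) : ℂ)

lemma twistSum_eq {q : ℕ} (χ : DirichletCharacter ℂ q) (j : ℕ) (y y' : ℝ) :
    twistSum χ j y y' = ∑ n ∈ Finset.Icc 1 ⌊y'⌋₊, logTwist χ j n * (trap y y' n : ℂ) := by
  refine Finset.sum_congr rfl fun n _ ↦ ?_
  rw [logTwist, lam]; push_cast; ring

lemma exists_twistSum_complex (j : ℕ) : ∃ C : ℝ, 0 < C ∧ ∀ (q : ℕ) [NeZero q]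
    (χ : DirichletCharacter ℂ q), χ ^ 2 ≠ 1 → ∀ y y' : ℝ, 3 ≤ y → y ≤ y' →
      ‖twistSum χ j y y'‖ ≤ C * q * y' ^ 2 := by
  obtain ⟨C₁, hC₁, h₁⟩ := exists_norm_sum_trap_le
  obtain ⟨C₂, hC₂, h₂⟩ := exists_LSeries_logTwist_complex j
  refine ⟨C₁ * C₂, by positivity, fun q _ χ hχ y y' hy hyy ↦ ?_⟩
  rw [twistSum_eq, mul_assoc C₁]
  exact h₁ _ _ (fun s hs ↦ logTwist_summable χ j hs) (fun s hs hs2 ↦ h₂ q χ hχ s hs hs2) y y' hy hyy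

lemma exists_twistSum_ne_one (j : ℕ) : ∃ C : ℝ, 0 < C ∧ ∀ (q : ℕ) [NeZero q]
    (χ : DirichletCharacter ℂ q), χ ≠ 1 → ∀ y y' : ℝ, 3 ≤ y → y ≤ y' →
      ‖twistSum χ j y y'‖ ≤ C * ((q : ℝ) ^ (2 / 3 * (j + 1) : ℝ) * q) * y' ^ 2 := by
  obtain ⟨C₁, hC₁, h₁⟩ := exists_norm_sum_trap_le
  obtain ⟨C₂, hC₂, h₂⟩ := exists_LSeries_logTwist_ne_one j
  refine ⟨C₁ * C₂, by positivity, fun q _ χ hχ y y' hy hyy ↦ ?_⟩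
  rw [twistSum_eq, mul_assoc C₁]
  exact h₁ _ _ (fun s hs ↦ logTwist_summable χ j hs) (fun s hs hs2 ↦ h₂ q χ hχ s hs hs2) y y' hy hyy

lemma exists_defectSum (j : ℕ) : ∃ C : ℝ, 0 < C ∧ ∀ y y' : ℝ, 3 ≤ y → y ≤ y' →
    |∑ n ∈ Finset.Icc 1 ⌊y'⌋₊, lam j n * trap y y' n -
      ∑ n ∈ Finset.Icc 1 ⌊y'⌋₊, Real.log n ^ j * trap y y' n| ≤ C * y' ^ 2 := by
  obtain ⟨C₁, hC₁, h₁⟩ := exists_norm_sum_trap_le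
  obtain ⟨C₂, hC₂, h₂⟩ := exists_LSeries_logDefect j
  refine ⟨C₁ * C₂, by positivity, fun y y' hy hyy ↦ ?_⟩
  have h := h₁ _ _ (fun s hs ↦ logDefect_summable j hs) (fun s hs hs2 ↦ h₂ s hs hs2) y y' hy hyy
  rw [← Real.norm_eq_abs, ← Complex.norm_real, ← Finset.sum_sub_distrib]
  convert h using 2
  push_cast
  refine Finset.sum_congr rfl fun n _ ↦ ?_
  rw [lam, logDefect]; push_cast; ring

/-- The sum of `Λ(n) (log n)^j` over `n ≡ 1 mod d` with the trapezoidal weight. -/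
noncomputable def progSum (d j : ℕ) (y y' : ℝ) : ℝ :=
  ∑ n ∈ Finset.Icc 1 ⌊y'⌋₊ with n ≡ 1 [MOD d], lam j n * trap y y' n

lemma totient_mul_progSum (d : ℕ) [NeZero d] (j : ℕ) (y y' : ℝ) :
    ((Nat.totient d * progSum d j y y' : ℝ) : ℂ) =
      ∑ χ : DirichletCharacter ℂ d, twistSum χ j y y' := by
  simp only [twistSum]
  rw [Finset.sum_comm, progSum, Finset.sum_filter]
  push_cast
  rw [Finset.mul_sum]
  refine Finset.sum_congr rfl fun n _ ↦ ?_
  rw [← Finset.sum_mul, DirichletCharacter.sum_characters_eq]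
  have : ((n : ZMod d) = 1) ↔ n ≡ 1 [MOD d] := by
    rw [← ZMod.natCast_eq_natCast_iff]; simp
  simp only [this]
  split_ifs <;> simp

lemma lam_mul_trap_le {y y' : ℝ} (h0 : 0 ≤ y') (h : y ≤ y') (j : ℕ) {n : ℕ}
    (hn : n ∈ Finset.Icc 1 ⌊y'⌋₊) :
    lam j n * trap y y' n ≤ (y' - y) * Real.log y' ^ j * ArithmeticFunction.vonMangoldt n := by
  rw [Finset.mem_Icc] at hn
  have hn1 : (0 : ℝ) < n := by exact_mod_cast hn.1
  have hl : Real.log n ≤ Real.log y' :=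
    Real.log_le_log hn1 ((Nat.le_floor_iff h0).mp hn.2)
  have hl0 := Real.log_natCast_nonneg n
  have hv := ArithmeticFunction.vonMangoldt_nonneg (n := n)
  calc lam j n * trap y y' n
      ≤ (ArithmeticFunction.vonMangoldt n * Real.log y' ^ j) * (y' - y) := by
        rw [lam]
        have := trap_nonneg h n
        have hl1 := pow_nonneg (hl0.trans hl) j
        exact mul_le_mul (by gcongr) (trap_le h n) this (by positivity)
    _ = _ := by ring

lemma sum_vonMangoldt_le {y : ℝ} (hy : 0 ≤ y) :
    ∑ n ∈ Finset.Icc 1 ⌊y⌋₊, ArithmeticFunction.vonMangoldt n ≤ 6 * y := by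
  have h := Chebyshev.psi_le_const_mul_self hy
  have h4 : Real.log 4 ≤ 2 := by
    rw [show (4 : ℝ) = 2 ^ 2 by norm_num, Real.log_pow]
    push_cast; linarith [Real.log_two_lt_d9]
  rw [Chebyshev.psi, ← Finset.Icc_add_one_left_eq_Ioc] at h
  refine h.trans ?_
  gcongr; linarith

lemma sum_lam_mul_trap_le {y y' : ℝ} (h0 : 1 ≤ y') (h : y ≤ y') (j : ℕ) :
    ∑ n ∈ Finset.Icc 1 ⌊y'⌋₊, lam j n * trap y y' n ≤ 6 * ((y' - y) * y' * Real.log y' ^ j) := by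
  refine (Finset.sum_le_sum fun n hn ↦ lam_mul_trap_le (by linarith) h j hn).trans ?_
  rw [← Finset.mul_sum]
  have := sum_vonMangoldt_le (y := y') (by linarith)
  have hl : 0 ≤ Real.log y' := Real.log_nonneg h0
  have : 0 ≤ y' - y := by linarith
  calc _ ≤ (y' - y) * Real.log y' ^ j * (6 * y') := by gcongr
    _ = _ := by ring

lemma norm_twistSum_le {q : ℕ} (χ : DirichletCharacter ℂ q) {y y' : ℝ} (h0 : 1 ≤ y') (h : y ≤ y')
    (j : ℕ) : ‖twistSum χ j y y'‖ ≤ 6 * ((y' - y) * y' * Real.log y' ^ j) := by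
  refine le_trans ?_ (sum_lam_mul_trap_le h0 h j)
  refine (norm_sum_le _ _).trans (Finset.sum_le_sum fun n _ ↦ ?_)
  have : 0 ≤ lam j n * trap y y' n := mul_nonneg (lam_nonneg j n) (trap_nonneg h n)
  rw [norm_mul, Complex.norm_of_nonneg this]
  exact mul_le_of_le_one_left this (DirichletCharacter.norm_le_one χ _)

lemma sum_vonMangoldt_prime_dvd_le {p : ℕ} (hp : p.Prime) (N : ℕ) :
    ∑ n ∈ Finset.Icc 1 N with p ∣ n, ArithmeticFunction.vonMangoldt n ≤ Real.log N := by
  rcases Nat.eq_zero_or_pos N with rfl | hN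
  · simp
  have hsub : ∑ n ∈ Finset.Icc 1 N with p ∣ n, ArithmeticFunction.vonMangoldt n ≤
      ∑ n ∈ (Finset.Icc 1 (Nat.log p N)).image (p ^ ·), ArithmeticFunction.vonMangoldt n := by
    rw [← Finset.sum_filter_ne_zero]
    refine Finset.sum_le_sum_of_subset_of_nonneg (fun n hn' ↦ ?_)
      fun _ _ _ ↦ ArithmeticFunction.vonMangoldt_nonneg
    obtain ⟨hn, h0⟩ := Finset.mem_filter.mp hn'
    rw [Finset.mem_filter, Finset.mem_Icc] at hn
    rw [ArithmeticFunction.vonMangoldt_ne_zero_iff] at h0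
    obtain ⟨q, i, hq, hi, rfl⟩ := (isPrimePow_nat_iff _).mp h0
    have : p = q := (Nat.prime_dvd_prime_iff_eq hp hq).mp (hp.dvd_of_dvd_pow hn.2)
    subst this
    exact Finset.mem_image.mpr ⟨i, Finset.mem_Icc.mpr
      ⟨hi, Nat.le_log_of_pow_le hp.one_lt hn.1.2⟩, rfl⟩
  refine hsub.trans ?_
  rw [Finset.sum_image fun a _ b _ h ↦ Nat.pow_right_injective hp.two_le h]
  have : ∀ i ∈ Finset.Icc 1 (Nat.log p N), ArithmeticFunction.vonMangoldt (p ^ i) = Real.log p := by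
    intro i hi
    rw [Finset.mem_Icc] at hi
    rw [ArithmeticFunction.vonMangoldt_apply_pow (by omega),
      ArithmeticFunction.vonMangoldt_apply_prime hp]
  rw [Finset.sum_congr rfl this, Finset.sum_const, Nat.card_Icc, nsmul_eq_mul,
    Nat.add_sub_cancel, ← Real.log_pow]
  have hp0 : (0 : ℝ) < p := by exact_mod_cast hp.pos
  refine Real.log_le_log (by positivity) ?_
  exact_mod_cast Nat.pow_log_le_self p hN.ne'

lemma sum_vonMangoldt_not_coprime_le (d : ℕ) (hd : d ≠ 0) (N : ℕ) :
    ∑ n ∈ Finset.Icc 1 N with ¬ n.Coprime d, ArithmeticFunction.vonMangoldt n ≤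
      d * Real.log N := by
  have hsub : ∑ n ∈ Finset.Icc 1 N with ¬ n.Coprime d, ArithmeticFunction.vonMangoldt n ≤
      ∑ p ∈ d.primeFactors, ∑ n ∈ Finset.Icc 1 N with p ∣ n, ArithmeticFunction.vonMangoldt n := by
    simp only [Finset.sum_filter]
    rw [Finset.sum_comm]
    refine Finset.sum_le_sum fun n _ ↦ ?_
    have hnn (p : ℕ) : 0 ≤ if p ∣ n then ArithmeticFunction.vonMangoldt n else 0 := by
      split_ifs
      exacts [ArithmeticFunction.vonMangoldt_nonneg, le_rfl]
    split_ifs with hc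
    · exact Finset.sum_nonneg fun p _ ↦ hnn p
    · obtain ⟨p, hp, h1, h2⟩ := Nat.Prime.not_coprime_iff_dvd.mp hc
      have := Finset.single_le_sum (fun p _ ↦ hnn p) (Nat.mem_primeFactors.mpr ⟨hp, h2, hd⟩)
      simpa [h1] using this
  refine hsub.trans ?_
  refine (Finset.sum_le_sum fun p hp ↦
    sum_vonMangoldt_prime_dvd_le (Nat.prime_of_mem_primeFactors hp) N).trans ?_
  rw [Finset.sum_const, nsmul_eq_mul]
  have : (d.primeFactors.card : ℝ) ≤ d := by
    have h1 : d.primeFactors ⊆ Finset.Icc 1 d := fun p hp ↦ Finset.mem_Icc.mpr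
      ⟨(Nat.prime_of_mem_primeFactors hp).one_le, Nat.le_of_mem_primeFactors hp⟩
    have := Finset.card_le_card h1
    rw [Nat.card_Icc] at this
    exact_mod_cast this
  have := Real.log_natCast_nonneg N
  gcongr

lemma norm_twistSum_one_sub_le (d : ℕ) [NeZero d] {y y' : ℝ} (h0 : 1 ≤ y') (h : y ≤ y') (j : ℕ) :
    ‖twistSum (1 : DirichletCharacter ℂ d) j y y' - progSum 1 j y y'‖ ≤
      (y' - y) * Real.log y' ^ (j + 1) * d := by
  have hL : 0 ≤ Real.log y' := Real.log_nonneg h0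
  have hy : 0 ≤ y' - y := by linarith
  have e : twistSum (1 : DirichletCharacter ℂ d) j y y' - progSum 1 j y y' =
      -((∑ n ∈ Finset.Icc 1 ⌊y'⌋₊ with ¬ n.Coprime d, lam j n * trap y y' n : ℝ) : ℂ) := by
    rw [twistSum, progSum, Finset.filter_true_of_mem fun n _ ↦ Nat.modEq_one, Finset.sum_filter]
    push_cast
    rw [← Finset.sum_sub_distrib, ← Finset.sum_neg_distrib]
    refine Finset.sum_congr rfl fun n _ ↦ ?_
    by_cases hc : n.Coprime d
    · rw [MulChar.one_apply ((ZMod.isUnit_iff_coprime n d).mpr hc)]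
      simp [hc]
    · rw [MulChar.map_nonunit _ fun h ↦ hc ((ZMod.isUnit_iff_coprime n d).mp h)]
      simp [hc]
  rw [e, norm_neg, Complex.norm_real, Real.norm_of_nonneg (Finset.sum_nonneg fun n _ ↦
    mul_nonneg (lam_nonneg j n) (trap_nonneg h n))]
  calc _ ≤ ∑ n ∈ Finset.Icc 1 ⌊y'⌋₊ with ¬ n.Coprime d,
        (y' - y) * Real.log y' ^ j * ArithmeticFunction.vonMangoldt n :=
        Finset.sum_le_sum fun n hn ↦
          lam_mul_trap_le (by linarith) h j (Finset.mem_of_mem_filter n hn)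
    _ ≤ (y' - y) * Real.log y' ^ j * (d * Real.log y') := by
        rw [← Finset.mul_sum]
        refine mul_le_mul_of_nonneg_left ?_ (by positivity)
        refine (sum_vonMangoldt_not_coprime_le d (NeZero.ne d) _).trans ?_
        gcongr
        · exact_mod_cast Nat.floor_pos.mpr h0
        · exact Nat.floor_le (by linarith)
    _ = _ := by ring

lemma card_sq_eq_one_le {d : ℕ} [NeZero d] (hd : Squarefree d) :
    (Finset.univ.filter fun χ : DirichletCharacter ℂ d ↦ χ ^ 2 = 1).card ≤ d.divisors.card := by
  obtain ⟨e⟩ := DirichletCharacter.mulEquiv_units ℂ d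
  refine Finset.card_le_card_of_injOn
    (fun χ ↦ Int.gcd ((((e χ : (ZMod d)ˣ) : ZMod d).val : ℤ) - 1) d) ?_ ?_
  · intro χ _
    rw [Finset.mem_coe, Nat.mem_divisors]
    exact ⟨Int.natCast_dvd_natCast.mp (Int.gcd_dvd_right _ _), NeZero.ne d⟩
  · intro χ hχ ψ hψ h
    simp only [Finset.coe_filter, Finset.mem_univ, true_and, Set.mem_ofPred_eq] at hχ hψ h
    have key (χ : DirichletCharacter ℂ d) (hχ : χ ^ 2 = 1) :
        (d : ℤ) ∣ ((((e χ : (ZMod d)ˣ) : ZMod d).val : ℤ) - 1) *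
          ((((e χ : (ZMod d)ˣ) : ZMod d).val : ℤ) + 1) := by
      rw [← ZMod.intCast_zmod_eq_zero_iff_dvd]
      push_cast
      rw [ZMod.natCast_zmod_val]
      have h1 : (e χ) ^ 2 = 1 := by rw [← map_pow, hχ, map_one]
      have h2 : ((e χ : (ZMod d)ˣ) : ZMod d) ^ 2 = 1 := by
        simpa using congrArg Units.val h1
      linear_combination h2
    have k1 := key χ hχ
    have k2 := key ψ hψ
    refine e.injective (Units.ext ?_)
    set a : ZMod d := ((e χ : (ZMod d)ˣ) : ZMod d) with ha
    set b : ZMod d := ((e ψ : (ZMod d)ˣ) : ZMod d) with hb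
    have hdvd : (d : ℤ) ∣ (a.val : ℤ) - b.val := by
      rw [Int.natCast_dvd]
      refine (Nat.prod_primeFactors_of_squarefree hd).symm.dvd.trans ?_
      refine Finset.prod_primes_dvd _ (fun p hp ↦ (Nat.prime_of_mem_primeFactors hp).prime)
        fun p hp ↦ ?_
      have hp' := Nat.prime_iff_prime_int.mp (Nat.prime_of_mem_primeFactors hp)
      have hpd : (p : ℤ) ∣ d := by exact_mod_cast Nat.dvd_of_mem_primeFactors hp
      rw [← Int.natCast_dvd]
      have hiff : (p : ℤ) ∣ (a.val : ℤ) - 1 ↔ (p : ℤ) ∣ (b.val : ℤ) - 1 := by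
        have h1 : (p : ℤ) ∣ (a.val : ℤ) - 1 ↔ (p : ℤ) ∣ (Int.gcd ((a.val : ℤ) - 1) d : ℤ) :=
          ⟨fun h' ↦ Int.dvd_coe_gcd h' hpd, fun h' ↦ h'.trans (Int.gcd_dvd_left _ _)⟩
        have h2 : (p : ℤ) ∣ (b.val : ℤ) - 1 ↔ (p : ℤ) ∣ (Int.gcd ((b.val : ℤ) - 1) d : ℤ) :=
          ⟨fun h' ↦ Int.dvd_coe_gcd h' hpd, fun h' ↦ h'.trans (Int.gcd_dvd_left _ _)⟩
        rw [h1, h2, h]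
      rcases hp'.dvd_or_dvd (hpd.trans k1) with h1 | h1
      · have := dvd_sub h1 (hiff.mp h1)
        rwa [sub_sub_sub_cancel_right] at this
      · rcases hp'.dvd_or_dvd (hpd.trans k2) with h2 | h2
        · have := dvd_sub (hiff.mpr h2) h2
          rwa [sub_sub_sub_cancel_right] at this
        · have := dvd_sub h1 h2
          rwa [add_sub_add_right_eq_sub] at this
    have := (ZMod.intCast_zmod_eq_zero_iff_dvd _ d).mpr hdvd
    push_cast at this
    rwa [ZMod.natCast_zmod_val, ZMod.natCast_zmod_val, sub_eq_zero] at this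

/-- The value at a prime `p` of the Möbius inverse of `n ↦ (φ(n) / n)^k`. -/
noncomputable def gPrime (k p : ℕ) : ℝ := (1 - (p : ℝ)⁻¹) ^ k - 1

/-- The Möbius inverse of `n ↦ (φ(n) / n)^k`. -/
noncomputable def gCoef (k d : ℕ) : ℝ :=
  if Squarefree d then ∏ p ∈ d.primeFactors, gPrime k p else 0

lemma totient_div_self {n : ℕ} (hn : n ≠ 0) :
    (Nat.totient n : ℝ) / n = ∏ p ∈ n.primeFactors, (1 - (p : ℝ)⁻¹) := by
  have h : ((Nat.totient n : ℚ) : ℝ) = ((n * ∏ p ∈ n.primeFactors, (1 - (p : ℚ)⁻¹) : ℚ) : ℝ) := by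
    rw [Nat.totient_eq_mul_prod_factors]
  push_cast at h
  have hn' : (n : ℝ) ≠ 0 := by exact_mod_cast hn
  rw [h]
  field_simp

lemma sum_gCoef_divisors (k : ℕ) {n : ℕ} (hn : n ≠ 0) :
    ∑ d ∈ n.divisors, gCoef k d = ((Nat.totient n : ℝ) / n) ^ k := by
  have h1 : ∑ d ∈ n.divisors, gCoef k d = ∑ d ∈ n.divisors with Squarefree d, gCoef k d := by
    rw [Finset.sum_filter]
    refine Finset.sum_congr rfl fun d _ ↦ ?_
    rw [gCoef]; split_ifs <;> rfl
  have h2 : (UniqueFactorizationMonoid.normalizedFactors n).toFinset = n.primeFactors := by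
    rw [Nat.factors_eq]; rfl
  have h3 : ((Nat.totient n : ℝ) / n) ^ k = ∏ p ∈ n.primeFactors, (1 + gPrime k p) := by
    rw [totient_div_self hn, ← Finset.prod_pow]
    exact Finset.prod_congr rfl fun p _ ↦ by rw [gPrime]; ring
  rw [h1, Nat.sum_divisors_filter_squarefree hn, h2, h3, Finset.prod_one_add]
  refine Finset.sum_congr rfl fun s hs ↦ ?_
  have hsp : ∀ p ∈ s, p.Prime := fun p hp ↦
    Nat.prime_of_mem_primeFactors (Finset.mem_powerset.mp hs hp)
  have hval : s.val.prod = ∏ p ∈ s, p := Finset.prod_val s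
  have hsq : Squarefree (∏ p ∈ s, p) := by
    refine Finset.squarefree_prod_of_pairwise_isCoprime (fun p hp q hq hpq ↦ ?_)
      fun p hp ↦ (hsp p hp).prime.squarefree
    exact Nat.coprime_iff_isRelPrime.mp ((Nat.coprime_primes (hsp p hp) (hsp q hq)).mpr hpq)
  rw [hval, gCoef, if_pos hsq, Nat.primeFactors_prod hsp]

lemma abs_gPrime_le {k p : ℕ} (hp : p.Prime) : |gPrime k p| ≤ k / p := by
  have hp1 : (1 : ℝ) ≤ p := by exact_mod_cast hp.one_le
  have hi : (p : ℝ)⁻¹ ≤ 1 := inv_le_one_of_one_le₀ hp1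
  have hi0 : 0 ≤ (p : ℝ)⁻¹ := by positivity
  have h := one_add_mul_le_pow (a := -(p : ℝ)⁻¹) (by linarith) k
  have h2 : (1 - (p : ℝ)⁻¹) ^ k ≤ 1 := pow_le_one₀ (by linarith) (by linarith)
  rw [gPrime, abs_of_nonpos (by linarith), div_eq_mul_inv]
  rw [← sub_eq_add_neg] at h
  linarith

lemma abs_gPrime_le_one {k p : ℕ} (hp : p.Prime) : |gPrime k p| ≤ 1 := by
  have hp1 : (1 : ℝ) ≤ p := by exact_mod_cast hp.one_le
  have hi : (p : ℝ)⁻¹ ≤ 1 := inv_le_one_of_one_le₀ hp1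
  have hi0 : 0 ≤ (p : ℝ)⁻¹ := by positivity
  have h1 : 0 ≤ (1 - (p : ℝ)⁻¹) ^ k := pow_nonneg (by linarith) k
  have h2 : (1 - (p : ℝ)⁻¹) ^ k ≤ 1 := pow_le_one₀ (by linarith) (by linarith)
  rw [gPrime, abs_of_nonpos (by linarith)]
  linarith

lemma abs_gCoef_le_one (k d : ℕ) : |gCoef k d| ≤ 1 := by
  rw [gCoef]
  split_ifs
  · rw [Finset.abs_prod]
    exact Finset.prod_le_one (fun _ _ ↦ abs_nonneg _) fun p hp ↦
      abs_gPrime_le_one (Nat.prime_of_mem_primeFactors hp)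
  · simp

lemma exists_pow_card_primeFactors_le {A ε : ℝ} (hA : 1 ≤ A) (hε : 0 < ε) :
    ∃ C : ℝ, 0 < C ∧ ∀ d : ℕ, d ≠ 0 → A ^ d.primeFactors.card ≤ C * (d : ℝ) ^ ε := by
  set P := ⌈A ^ (1 / ε)⌉₊ with hP
  refine ⟨A ^ P, by positivity, fun d hd ↦ ?_⟩
  have key (p : ℕ) (hp : p.Prime) : A ≤ (if p < P then A else 1) * (p : ℝ) ^ ε := by
    have hp1 : (1 : ℝ) ≤ p := by exact_mod_cast hp.one_le
    split_ifs with h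
    · exact le_mul_of_one_le_right (by linarith) (Real.one_le_rpow hp1 hε.le)
    · rw [one_mul]
      have h1 : A ^ (1 / ε) ≤ p := (Nat.le_ceil _).trans (by exact_mod_cast not_lt.mp h)
      calc A = (A ^ (1 / ε)) ^ ε := by
            rw [← Real.rpow_mul (by linarith), one_div_mul_cancel hε.ne', Real.rpow_one]
        _ ≤ _ := Real.rpow_le_rpow (by positivity) h1 hε.le
  have h1 : A ^ d.primeFactors.card ≤
      ∏ p ∈ d.primeFactors, (if p < P then A else 1) * (p : ℝ) ^ ε := by
    rw [← Finset.prod_const]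
    exact Finset.prod_le_prod (fun _ _ ↦ by linarith) fun p hp ↦
      key p (Nat.prime_of_mem_primeFactors hp)
  refine h1.trans ?_
  rw [Finset.prod_mul_distrib]
  refine mul_le_mul ?_ ?_ (Finset.prod_nonneg fun p _ ↦ by positivity) (by positivity)
  · rw [Finset.prod_ite, Finset.prod_const_one, mul_one, Finset.prod_const]
    refine pow_le_pow_right₀ hA ?_
    have : d.primeFactors.filter (· < P) ⊆ Finset.range P := fun p hp ↦
      Finset.mem_range.mpr (Finset.mem_filter.mp hp).2
    simpa using Finset.card_le_card this
  · rw [Real.finsetProd_rpow _ _ fun p _ ↦ by positivity]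
    refine Real.rpow_le_rpow (by positivity) ?_ hε.le
    rw [← Nat.cast_prod]
    exact_mod_cast Nat.le_of_dvd (Nat.pos_of_ne_zero hd) (Nat.prod_primeFactors_dvd d)

lemma abs_gCoef_mul_divisors_div_le {k d : ℕ} (hk : 1 ≤ k) (hd : d ≠ 0) :
    |gCoef k d| * d.divisors.card / Nat.totient d ≤
      (4 * k : ℝ) ^ d.primeFactors.card / (d : ℝ) ^ 2 := by
  have hd0 : (0 : ℝ) < d := by exact_mod_cast Nat.pos_of_ne_zero hd
  rw [gCoef]
  split_ifs with hs
  swap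
  · simp; positivity
  have hprod : ∏ p ∈ d.primeFactors, (p : ℝ) = d := by
    rw [← Nat.cast_prod, Nat.prod_primeFactors_of_squarefree hs]
  have h1 : |∏ p ∈ d.primeFactors, gPrime k p| ≤ (k : ℝ) ^ d.primeFactors.card / d := by
    rw [Finset.abs_prod]
    refine (Finset.prod_le_prod (fun _ _ ↦ abs_nonneg _) fun p hp ↦
      abs_gPrime_le (Nat.prime_of_mem_primeFactors hp)).trans (le_of_eq ?_)
    rw [Finset.prod_div_distrib, Finset.prod_const, hprod]
  have h2 : (d.divisors.card : ℝ) ≤ 2 ^ d.primeFactors.card := by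
    rw [Nat.card_divisors hd, ← Finset.prod_const]
    push_cast
    refine Finset.prod_le_prod (fun _ _ ↦ by positivity) fun p _ ↦ ?_
    have : d.factorization p ≤ 1 := hs.natFactorization_le_one p
    have : (d.factorization p : ℝ) ≤ 1 := by exact_mod_cast this
    linarith
  have h3 : (d : ℝ) / 2 ^ d.primeFactors.card ≤ Nat.totient d := by
    have : ((1 : ℝ) / 2) ^ d.primeFactors.card ≤ (Nat.totient d : ℝ) / d := by
      rw [totient_div_self hd, ← Finset.prod_const]
      refine Finset.prod_le_prod (fun _ _ ↦ by norm_num) fun p hp ↦ ?_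
      have hp2 : (2 : ℝ) ≤ p := by exact_mod_cast (Nat.prime_of_mem_primeFactors hp).two_le
      have : (p : ℝ)⁻¹ ≤ 2⁻¹ := inv_anti₀ (by norm_num) hp2
      linarith
    rw [le_div_iff₀ hd0] at this
    refine le_trans (le_of_eq ?_) this
    rw [div_pow, one_pow]; ring
  have h4 : 0 < (d : ℝ) / 2 ^ d.primeFactors.card := by positivity
  calc _ ≤ (k : ℝ) ^ d.primeFactors.card / d * 2 ^ d.primeFactors.card /
        (d / 2 ^ d.primeFactors.card) := by gcongr
    _ = _ := by
      rw [mul_pow, show (4 : ℝ) = 2 * 2 by norm_num, mul_pow]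
      field_simp

lemma exists_abs_gCoef_le {k : ℕ} (hk : 1 ≤ k) : ∃ C : ℝ, 0 < C ∧ ∀ d : ℕ, d ≠ 0 →
    |gCoef k d| * d.divisors.card / Nat.totient d ≤ C * (d : ℝ) ^ (-(19 / 10) : ℝ) := by
  have hk' : (1 : ℝ) ≤ k := by exact_mod_cast hk
  obtain ⟨C, hC, h⟩ := exists_pow_card_primeFactors_le (A := 4 * k) (ε := 1 / 10)
    (by linarith) (by norm_num)
  refine ⟨C, hC, fun d hd ↦ (abs_gCoef_mul_divisors_div_le hk hd).trans ?_⟩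
  have hd0 : (0 : ℝ) < d := by exact_mod_cast Nat.pos_of_ne_zero hd
  calc _ ≤ C * (d : ℝ) ^ (1 / 10 : ℝ) / (d : ℝ) ^ 2 := by gcongr; exact h d hd
    _ = _ := by
      rw [← Real.rpow_natCast, mul_div_assoc, ← Real.rpow_sub hd0]; norm_num

lemma gCoef_one (k : ℕ) : gCoef k 1 = 1 := by simp [gCoef]

lemma gCoef_zero (k : ℕ) : gCoef k 0 = 0 := by simp [gCoef]

lemma gCoef_mul (k : ℕ) {m n : ℕ} (h : m.Coprime n) :
    gCoef k (m * n) = gCoef k m * gCoef k n := by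
  simp only [gCoef, Nat.squarefree_mul h]
  by_cases hm : Squarefree m <;> by_cases hn : Squarefree n <;> simp only [hm, hn, and_self,
    and_true, if_true, if_false, mul_zero, zero_mul, and_false]
  rw [h.primeFactors_mul, Finset.prod_union h.disjoint_primeFactors]

lemma summable_gCoef_div {k : ℕ} (hk : 1 ≤ k) :
    Summable fun d : ℕ ↦ ‖gCoef k d / Nat.totient d‖ := by
  obtain ⟨C, hC, h⟩ := exists_abs_gCoef_le hk
  have hs : Summable fun d : ℕ ↦ C * (d : ℝ) ^ (-(19 / 10) : ℝ) :=
    (Real.summable_nat_rpow.mpr (by norm_num)).mul_left C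
  refine Summable.of_nonneg_of_le (fun _ ↦ norm_nonneg _) (fun d ↦ ?_) hs
  rcases eq_or_ne d 0 with rfl | hd
  · simp [gCoef_zero]
  refine le_trans ?_ (h d hd)
  rw [Real.norm_eq_abs, abs_div, Nat.abs_cast]
  have : (1 : ℝ) ≤ d.divisors.card := by
    exact_mod_cast Finset.card_pos.mpr (Nat.nonempty_divisors.mpr hd)
  gcongr
  exact le_mul_of_one_le_right (abs_nonneg _) this

lemma aK_eq_tsum {k : ℕ} (hk : 1 ≤ k) : aK k = ∑' d : ℕ, gCoef k d / Nat.totient d := by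
  rw [← EulerProduct.eulerProduct_tprod (f := fun d : ℕ ↦ gCoef k d / Nat.totient d)
    (by simp [gCoef_one]) _ (summable_gCoef_div hk) (by simp [gCoef_zero]), aK]
  · refine tprod_congr fun p ↦ ?_
    have hp := p.2
    have hp2 : (2 : ℝ) ≤ (p : ℕ) := by exact_mod_cast hp.two_le
    have hz : ∀ e ∉ Finset.range 2, gCoef k ((p : ℕ) ^ e) / Nat.totient ((p : ℕ) ^ e) = 0 := by
      intro e he
      rw [Finset.mem_range] at he
      have : ¬ Squarefree ((p : ℕ) ^ e) := by
        rw [Nat.squarefree_pow_iff hp.ne_one (by omega)]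
        omega
      rw [gCoef, if_neg this, zero_div]
    rw [tsum_eq_sum hz, Finset.sum_range_succ, Finset.sum_range_one, pow_zero, pow_one, gCoef_one,
      gCoef, if_pos hp.prime.squarefree, hp.primeFactors, Finset.prod_singleton, Nat.totient_prime hp,
      gPrime, Nat.cast_pred hp.pos, Nat.totient_one, Nat.cast_one, div_one]
    have h1 : ((p : ℕ) : ℝ) - 1 ≠ 0 := by linarith
    have h0 : ((p : ℕ) : ℝ) ≠ 0 := by linarith
    have e : 1 - (((p : ℕ) : ℝ))⁻¹ = (((p : ℕ) : ℝ) - 1) / ((p : ℕ) : ℝ) := by field_simp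
    rw [e, div_pow]
    field_simp
    ring
  · intro m n h
    rw [gCoef_mul k h, Nat.totient_mul h]
    push_cast
    rw [mul_div_mul_comm]

lemma progSum_nonneg (d j : ℕ) {y y' : ℝ} (h : y ≤ y') : 0 ≤ progSum d j y y' :=
  Finset.sum_nonneg fun n _ ↦ mul_nonneg (lam_nonneg j n) (trap_nonneg h n)

lemma progSum_one (j : ℕ) (y y' : ℝ) :
    progSum 1 j y y' = ∑ n ∈ Finset.Icc 1 ⌊y'⌋₊, lam j n * trap y y' n := by
  rw [progSum, Finset.filter_true_of_mem fun n _ ↦ Nat.modEq_one]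

lemma card_char (d : ℕ) [NeZero d] :
    (Finset.univ : Finset (DirichletCharacter ℂ d)).card = Nat.totient d := by
  rw [Finset.card_univ, ← Nat.card_eq_fintype_card]
  exact DirichletCharacter.card_eq_totient_of_hasEnoughRootsOfUnity ℂ d

/-- The deviation of a progression sum from its expected value, via the nonprincipal characters. -/
lemma abs_progSum_sub_le (d : ℕ) [NeZero d] (j : ℕ) {y y' : ℝ} (h0 : 1 ≤ y') (h : y ≤ y') :
    |progSum d j y y' - progSum 1 j y y' / Nat.totient d| ≤
      (y' - y) * Real.log y' ^ (j + 1) * d +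
        (∑ χ ∈ (Finset.univ : Finset (DirichletCharacter ℂ d)).erase 1, ‖twistSum χ j y y'‖) /
          Nat.totient d := by
  have hφ : (1 : ℝ) ≤ Nat.totient d := by
    exact_mod_cast Nat.totient_pos.mpr (NeZero.pos d)
  have e : ((progSum d j y y' - progSum 1 j y y' / Nat.totient d : ℝ) : ℂ) =
      ((twistSum (1 : DirichletCharacter ℂ d) j y y' - progSum 1 j y y') +
        ∑ χ ∈ (Finset.univ : Finset (DirichletCharacter ℂ d)).erase 1, twistSum χ j y y') /
          Nat.totient d := by
    have h1 := totient_mul_progSum d j y y'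
    rw [← Finset.add_sum_erase _ _ (Finset.mem_univ 1)] at h1
    rw [eq_div_iff (by exact_mod_cast (by linarith : (Nat.totient d : ℝ) ≠ 0)), sub_add_eq_add_sub,
      ← h1]
    push_cast
    have : (Nat.totient d : ℂ) ≠ 0 := by exact_mod_cast (by linarith : (Nat.totient d : ℝ) ≠ 0)
    field_simp
  rw [← Real.norm_eq_abs, ← Complex.norm_real, e, norm_div, Complex.norm_natCast]
  have hL : 0 ≤ Real.log y' := Real.log_nonneg h0
  have hy : 0 ≤ y' - y := by linarith
  calc _ ≤ ((y' - y) * Real.log y' ^ (j + 1) * d +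
        ∑ χ ∈ (Finset.univ : Finset (DirichletCharacter ℂ d)).erase 1, ‖twistSum χ j y y'‖) /
          Nat.totient d := by
        gcongr
        exact (norm_add_le _ _).trans (add_le_add (norm_twistSum_one_sub_le d h0 h j)
          (norm_sum_le _ _))
    _ ≤ _ := by
        rw [add_div]
        gcongr
        exact div_le_self (by positivity) hφ

lemma exists_abs_progSum_sub_le_small (j : ℕ) : ∃ C : ℝ, 0 < C ∧ ∀ (d : ℕ) [NeZero d]
    (y y' : ℝ), 3 ≤ y → y ≤ y' →
      |progSum d j y y' - progSum 1 j y y' / Nat.totient d| ≤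
        (y' - y) * Real.log y' ^ (j + 1) * d +
          C * ((d : ℝ) ^ (2 / 3 * (j + 1) : ℝ) * d) * y' ^ 2 := by
  obtain ⟨C, hC, h⟩ := exists_twistSum_ne_one j
  refine ⟨C, hC, fun d _ y y' hy hyy ↦ ?_⟩
  refine (abs_progSum_sub_le d j (by linarith) hyy).trans ?_
  gcongr
  have hφ : (0 : ℝ) < Nat.totient d := by
    exact_mod_cast Nat.totient_pos.mpr (NeZero.pos d)
  rw [div_le_iff₀ hφ]
  refine (Finset.sum_le_card_nsmul _ _ _ fun χ hχ ↦
    h d χ (Finset.ne_of_mem_erase hχ) y y' hy hyy).trans ?_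
  rw [nsmul_eq_mul, mul_comm]
  gcongr
  exact_mod_cast (Finset.card_erase_le).trans (card_char d).le

lemma exists_abs_progSum_sub_le_medium (j : ℕ) : ∃ C : ℝ, 0 < C ∧ ∀ (d : ℕ) [NeZero d],
    Squarefree d → ∀ y y' : ℝ, 3 ≤ y → y ≤ y' →
      |progSum d j y y' - progSum 1 j y y' / Nat.totient d| ≤
        (y' - y) * Real.log y' ^ (j + 1) * d + (C * d * y' ^ 2 +
          6 * ((y' - y) * y' * Real.log y' ^ j) * (d.divisors.card / Nat.totient d)) := by
  obtain ⟨C, hC, h⟩ := exists_twistSum_complex j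
  refine ⟨C, hC, fun d _ hd y y' hy hyy ↦ ?_⟩
  refine (abs_progSum_sub_le d j (by linarith) hyy).trans ?_
  gcongr
  have hφ : (0 : ℝ) < Nat.totient d := by
    exact_mod_cast Nat.totient_pos.mpr (NeZero.pos d)
  have hL : 0 ≤ Real.log y' := Real.log_nonneg (by linarith)
  have hh : 0 ≤ y' - y := by linarith
  have hy0 : 0 ≤ y' := by linarith
  rw [div_le_iff₀ hφ, add_mul, mul_assoc _ (_ / _), div_mul_cancel₀ _ hφ.ne']
  refine (Finset.sum_le_sum_of_subset_of_nonneg (Finset.subset_univ _)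
    fun _ _ _ ↦ norm_nonneg _).trans ?_
  rw [← Finset.sum_filter_not_add_sum_filter _ (fun χ ↦ χ ^ 2 = 1)]
  gcongr
  · refine (Finset.sum_le_card_nsmul _ _ _ fun χ hχ ↦
      h d χ (Finset.mem_filter.mp hχ).2 y y' hy hyy).trans ?_
    rw [nsmul_eq_mul, mul_comm]
    gcongr
    exact_mod_cast (Finset.card_filter_le _ _).trans (card_char d).le
  · refine (Finset.sum_le_card_nsmul _ _ _ fun χ _ ↦
      norm_twistSum_le χ (by linarith) hyy j).trans ?_
    rw [nsmul_eq_mul, mul_comm]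
    gcongr
    exact card_sq_eq_one_le hd

lemma progSum_le (d : ℕ) (hd : d ≠ 0) (j : ℕ) {y y' : ℝ} (h0 : 1 ≤ y') (h : y ≤ y') :
    progSum d j y y' ≤ (y' - y) * Real.log y' ^ (j + 1) * (y' / d) := by
  have hL : 0 ≤ Real.log y' := Real.log_nonneg h0
  have hh : 0 ≤ y' - y := by linarith
  set B := (y' - y) * Real.log y' ^ (j + 1) with hB
  have hB0 : 0 ≤ B := by positivity
  have hterm : ∀ n ∈ Finset.Icc 1 ⌊y'⌋₊, lam j n * trap y y' n ≤ B := by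
    intro n hn
    refine (lam_mul_trap_le (by linarith) h j hn).trans ?_
    rw [hB, pow_succ, ← mul_assoc]
    gcongr
    rw [Finset.mem_Icc] at hn
    refine ArithmeticFunction.vonMangoldt_le_log.trans (Real.log_le_log ?_ ?_)
    · exact_mod_cast hn.1
    · exact (Nat.le_floor_iff (by linarith)).mp hn.2
  have hsub : progSum d j y y' ≤
      ∑ n ∈ (Finset.Icc 1 (⌊y'⌋₊ / d)).image (fun i ↦ d * i + 1), B := by
    rw [progSum, ← Finset.sum_filter_ne_zero]
    refine (Finset.sum_le_sum fun n hn ↦ hterm n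
      (Finset.mem_of_mem_filter n (Finset.mem_of_mem_filter n hn))).trans ?_
    refine Finset.sum_le_sum_of_subset_of_nonneg (fun n hn ↦ ?_) fun _ _ _ ↦ hB0
    rw [Finset.mem_filter, Finset.mem_filter, Finset.mem_Icc] at hn
    obtain ⟨⟨⟨hn1, hnN⟩, hmod⟩, hne⟩ := hn
    have hn2 : n ≠ 1 := by rintro rfl; simp [lam_one] at hne
    obtain ⟨i, hi⟩ := (Nat.modEq_iff_dvd' hn1).mp hmod.symm
    have hni : n = d * i + 1 := by omega
    refine Finset.mem_image.mpr ⟨i, Finset.mem_Icc.mpr ⟨?_, ?_⟩, hni.symm⟩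
    · rcases Nat.eq_zero_or_pos i with rfl | hi0
      · simp at hni; omega
      · exact hi0
    · rw [Nat.le_div_iff_mul_le (Nat.pos_of_ne_zero hd), mul_comm]; omega
  refine hsub.trans ?_
  rw [Finset.sum_const, nsmul_eq_mul, mul_comm]
  gcongr
  have h1 : (((Finset.Icc 1 (⌊y'⌋₊ / d)).image (fun i ↦ d * i + 1)).card : ℝ) ≤
      ((⌊y'⌋₊ / d : ℕ) : ℝ) := by
    have := Finset.card_image_le (s := Finset.Icc 1 (⌊y'⌋₊ / d)) (f := fun i ↦ d * i + 1)
    rw [Nat.card_Icc, Nat.add_sub_cancel] at this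
    exact_mod_cast this
  refine h1.trans (Nat.cast_div_le.trans ?_)
  gcongr
  exact Nat.floor_le (by linarith)

set_option maxHeartbeats 1600000 in
/-- Comparison of a progression sum, weighted by `gCoef`, with its expected value. -/
lemma exists_abs_gCoef_mul_le {k : ℕ} (hk : 1 ≤ k) : ∃ C : ℝ, 0 < C ∧ ∀ (d : ℕ) (y y' : ℝ),
    d ≠ 0 → 3 ≤ y → y ≤ y' → Real.log y' ^ 9 ≤ y' → y' ≤ 2 * ((y' - y) * Real.log y') →
      |gCoef k d| * |progSum d 35 y y' - progSum 1 35 y y' / Nat.totient d| ≤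
        C * ((y' - y) * y' * Real.log y' ^ 34) * (d : ℝ) ^ (-(11 / 10) : ℝ) := by
  obtain ⟨C₁, hC₁, h₁⟩ := exists_abs_progSum_sub_le_small 35
  obtain ⟨C₂, hC₂, h₂⟩ := exists_abs_progSum_sub_le_medium 35
  obtain ⟨C₃, hC₃, h₃⟩ := exists_abs_gCoef_le hk
  refine ⟨1 + 2 * C₁ + 2 * C₂ + 7 * C₃, by positivity, fun d y y' hd hy hyy hL9 hyL ↦ ?_⟩
  have : NeZero d := ⟨hd⟩
  set L := Real.log y' with hL
  set h := y' - y with hh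
  have hL1 : 1 ≤ L := by
    rw [hL, Real.le_log_iff_exp_le (by linarith)]; linarith [Real.exp_one_lt_d9]
  have hL0 : 0 < L := by linarith
  have hh0 : 0 ≤ h := by linarith
  have hy0 : 0 < y' := by linarith
  have hd1 : (1 : ℝ) ≤ d := by exact_mod_cast Nat.pos_of_ne_zero hd
  have hd0 : (0 : ℝ) < d := by linarith
  have hφ : (1 : ℝ) ≤ Nat.totient d := by
    exact_mod_cast Nat.totient_pos.mpr (NeZero.pos d)
  have hτ : (1 : ℝ) ≤ d.divisors.card := by
    exact_mod_cast Finset.card_pos.mpr (Nat.nonempty_divisors.mpr hd)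
  set M := h * y' * L ^ 34 with hM
  have hM0 : 0 ≤ M := by positivity
  set D := (d : ℝ) ^ (-(11 / 10) : ℝ) with hD
  have hD0 : 0 < D := by positivity
  have hg1 := abs_gCoef_le_one k d
  have hg0 := abs_nonneg (gCoef k d)
  by_cases hsq : Squarefree d
  swap
  · rw [gCoef, if_neg hsq, abs_zero, zero_mul]; positivity
  have hdD (e : ℝ) : (d : ℝ) ^ e = (d : ℝ) ^ (e + 11 / 10) * D := by
    rw [hD, ← Real.rpow_add hd0]; norm_num
  -- powers of `d` in terms of powers of `L`
  have hpow {a e : ℝ} (n : ℕ) (hdL : (d : ℝ) ≤ L ^ a) (he : 0 ≤ e) (hb : a * e ≤ n) :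
      (d : ℝ) ^ e ≤ L ^ n := by
    calc (d : ℝ) ^ e ≤ (L ^ a) ^ e := Real.rpow_le_rpow hd0.le hdL he
      _ = L ^ (a * e) := by rw [← Real.rpow_mul hL0.le]
      _ ≤ L ^ (n : ℝ) := Real.rpow_le_rpow_of_exponent_le hL1 hb
      _ = L ^ n := Real.rpow_natCast L n
  have hyy2 : y' ^ 2 * L ^ 33 ≤ 2 * M := by
    calc y' ^ 2 * L ^ 33 = y' * (y' * L ^ 33) := by ring
      _ ≤ 2 * (h * L) * (y' * L ^ 33) := by gcongr
      _ = _ := by rw [hM]; ring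
  have hterm1 (hdL : (d : ℝ) ≤ L ^ (3 : ℝ)) : h * L ^ 36 * d ≤ M * D := by
    have h1 := hpow (e := 21 / 10) 7 hdL (by norm_num) (by norm_num)
    have h2 := hdD 1
    rw [Real.rpow_one, show (1 + 11 / 10 : ℝ) = 21 / 10 by norm_num] at h2
    calc h * L ^ 36 * d = h * L ^ 36 * ((d : ℝ) ^ (21 / 10 : ℝ) * D) := by rw [← h2]
      _ = h * L ^ 36 * (d : ℝ) ^ (21 / 10 : ℝ) * D := by ring
      _ ≤ h * L ^ 36 * L ^ 7 * D := by gcongr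
      _ = h * L ^ 34 * L ^ 9 * D := by ring
      _ ≤ h * L ^ 34 * y' * D := by gcongr
      _ = _ := by rw [hM]; ring
  have hgD : |gCoef k d| * (d.divisors.card / Nat.totient d) ≤
      C₃ * ((d : ℝ) ^ (-(8 / 10) : ℝ) * D) := by
    have := h₃ d hd
    rw [hdD, show (-(19 / 10) + 11 / 10 : ℝ) = -(8 / 10) by norm_num] at this
    rwa [← mul_div_assoc]
  have hinv {a : ℝ} (n : ℕ) (hdL : L ^ a ≤ d) (hb : n ≤ a * (8 / 10)) :
      (d : ℝ) ^ (-(8 / 10) : ℝ) ≤ (L ^ n)⁻¹ := by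
    rw [Real.rpow_neg hd0.le]
    refine inv_anti₀ (by positivity) ?_
    calc L ^ n = L ^ (n : ℝ) := (Real.rpow_natCast L n).symm
      _ ≤ L ^ (a * (8 / 10)) := Real.rpow_le_rpow_of_exponent_le hL1 hb
      _ = (L ^ a) ^ (8 / 10 : ℝ) := by rw [← Real.rpow_mul hL0.le]
      _ ≤ _ := Real.rpow_le_rpow (by positivity) hdL (by norm_num)
  have hMD : 0 ≤ M * D := by positivity
  rcases le_or_gt (d : ℝ) (L ^ (5 / 4 : ℝ)) with c1 | c1
  · have c1' : (d : ℝ) ≤ L ^ (3 : ℝ) :=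
      c1.trans (Real.rpow_le_rpow_of_exponent_le hL1 (by norm_num))
    have h1 := hpow (e := 26 + 1 / 10) 33 c1 (by norm_num) (by norm_num)
    have h2 := hdD 25
    rw [show (25 + 11 / 10 : ℝ) = 26 + 1 / 10 by norm_num] at h2
    have h3 : (d : ℝ) ^ (2 / 3 * ((35 : ℕ) + 1) : ℝ) * d = (d : ℝ) ^ (25 : ℝ) := by
      rw [← Real.rpow_add_one hd0.ne']; norm_num
    have h4 : C₁ * ((d : ℝ) ^ (2 / 3 * ((35 : ℕ) + 1) : ℝ) * d) * y' ^ 2 ≤ 2 * C₁ * (M * D) := by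
      rw [h3, h2]
      calc _ ≤ C₁ * (L ^ 33 * D) * y' ^ 2 := by gcongr
        _ = C₁ * D * (y' ^ 2 * L ^ 33) := by ring
        _ ≤ C₁ * D * (2 * M) := by gcongr
        _ = _ := by ring
    have h5 := h₁ d y y' hy hyy
    have h6 := hterm1 c1'
    have h7 : |gCoef k d| * |progSum d 35 y y' - progSum 1 35 y y' / Nat.totient d| ≤
        |progSum d 35 y y' - progSum 1 35 y y' / Nat.totient d| :=
      mul_le_of_le_one_left (abs_nonneg _) hg1
    have h8 : 0 ≤ (2 * C₂ + 7 * C₃) * (M * D) := by positivity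
    refine h7.trans (h5.trans ?_)
    calc h * L ^ 36 * d + C₁ * ((d : ℝ) ^ (2 / 3 * ((35 : ℕ) + 1) : ℝ) * d) * y' ^ 2
        ≤ M * D + 2 * C₁ * (M * D) := add_le_add h6 h4
      _ ≤ _ := by linarith
  rcases le_or_gt (d : ℝ) (L ^ (3 : ℝ)) with c2 | c2
  · have h1 := hpow (e := 21 / 10) 33 c2 (by norm_num) (by norm_num)
    have h2 := hdD 1
    rw [Real.rpow_one, show (1 + 11 / 10 : ℝ) = 21 / 10 by norm_num] at h2
    have h4 : C₂ * d * y' ^ 2 ≤ 2 * C₂ * (M * D) := by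
      rw [h2]
      calc _ ≤ C₂ * (L ^ 33 * D) * y' ^ 2 := by gcongr
        _ = C₂ * D * (y' ^ 2 * L ^ 33) := by ring
        _ ≤ C₂ * D * (2 * M) := by gcongr
        _ = _ := by ring
    have h5 := h₂ d hsq y y' hy hyy
    have h6 := hterm1 c2
    have h7 := hinv 1 c1.le (by norm_num)
    rw [pow_one] at h7
    have h8 : |gCoef k d| * (6 * (h * y' * L ^ 35) * (d.divisors.card / Nat.totient d)) ≤
        6 * C₃ * (M * D) := by
      calc _ = 6 * (h * y' * L ^ 35) * (|gCoef k d| * (d.divisors.card / Nat.totient d)) := by ring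
        _ ≤ 6 * (h * y' * L ^ 35) * (C₃ * (L⁻¹ * D)) := by 
            refine mul_le_mul_of_nonneg_left (hgD.trans ?_) (by positivity)
            exact mul_le_mul_of_nonneg_left (mul_le_mul_of_nonneg_right h7 hD0.le) hC₃.le
        _ = 6 * C₃ * (h * y' * (L ^ 35 * L⁻¹) * D) := by ring
        _ = _ := by rw [hM, pow_succ L 34, mul_assoc (L ^ 34), mul_inv_cancel₀ hL0.ne', mul_one]
    have h9 : |gCoef k d| * (h * L ^ 36 * d + C₂ * d * y' ^ 2) ≤
        h * L ^ 36 * d + C₂ * d * y' ^ 2 := mul_le_of_le_one_left (by positivity) hg1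
    have h10 : 0 ≤ (2 * C₁ + C₃) * (M * D) := by positivity
    calc _ ≤ |gCoef k d| * (h * L ^ 36 * d + (C₂ * d * y' ^ 2 +
          6 * (h * y' * L ^ 35) * (d.divisors.card / Nat.totient d))) :=
          mul_le_mul_of_nonneg_left h5 hg0
      _ = |gCoef k d| * (h * L ^ 36 * d + C₂ * d * y' ^ 2) +
          |gCoef k d| * (6 * (h * y' * L ^ 35) * (d.divisors.card / Nat.totient d)) := by ring
      _ ≤ h * L ^ 36 * d + C₂ * d * y' ^ 2 + 6 * C₃ * (M * D) := add_le_add h9 h8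
      _ ≤ _ := by linarith
  · have h5 := progSum_le d hd 35 (by linarith) hyy
    have h6 := sum_lam_mul_trap_le (by linarith) hyy 35
    rw [← progSum_one] at h6
    have h7 := hinv 2 c2.le (by norm_num)
    have hdφ : (1 : ℝ) / d ≤ d.divisors.card / Nat.totient d := by
      have : (Nat.totient d : ℝ) ≤ d := by exact_mod_cast Nat.totient_le d
      exact div_le_div₀ (Nat.cast_nonneg _) hτ (by linarith) this
    have h8 : |progSum d 35 y y' - progSum 1 35 y y' / Nat.totient d| ≤
        7 * (h * y' * L ^ 36) * (d.divisors.card / Nat.totient d) := by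
      have n1 := progSum_nonneg d 35 hyy
      have n2 := progSum_nonneg 1 35 hyy
      have a1 : progSum d 35 y y' ≤ h * y' * L ^ 36 * (d.divisors.card / Nat.totient d) := by
        refine h5.trans ?_
        calc _ = h * y' * L ^ 36 * (1 / d) := by ring
          _ ≤ _ := by gcongr
      have a2 : progSum 1 35 y y' / Nat.totient d ≤
          6 * (h * y' * L ^ 36) * (d.divisors.card / Nat.totient d) := by
        rw [← mul_div_assoc]
        gcongr
        refine h6.trans ?_
        calc _ ≤ 6 * (h * y' * L ^ 36) := by
              gcongr; norm_num
          _ ≤ _ := le_mul_of_one_le_right (by positivity) hτ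
      have a3 : 0 ≤ progSum 1 35 y y' / Nat.totient d := by positivity
      set P := progSum 1 35 y y' / Nat.totient d
      set W := h * y' * L ^ 36 * (d.divisors.card / Nat.totient d : ℝ) with hW
      have hW0 : 0 ≤ W := 
        mul_nonneg (by positivity) (div_nonneg (Nat.cast_nonneg _) (Nat.cast_nonneg _))
      have e1 : 6 * (h * y' * L ^ 36) * (d.divisors.card / Nat.totient d : ℝ) = 6 * W := by
        rw [hW]; ring
      have e2 : 7 * (h * y' * L ^ 36) * (d.divisors.card / Nat.totient d : ℝ) = 7 * W := by
        rw [hW]; ring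
      rw [e1] at a2
      rw [e2, abs_le]
      constructor <;> linarith
    have h10 : 0 ≤ (1 + 2 * C₁ + 2 * C₂) * (M * D) := by positivity
    calc _ ≤ |gCoef k d| * (7 * (h * y' * L ^ 36) * (d.divisors.card / Nat.totient d)) :=
          mul_le_mul_of_nonneg_left h8 hg0
      _ = 7 * (h * y' * L ^ 36) * (|gCoef k d| * (d.divisors.card / Nat.totient d)) := by ring
      _ ≤ 7 * (h * y' * L ^ 36) * (C₃ * ((L ^ 2)⁻¹ * D)) := by 
          refine mul_le_mul_of_nonneg_left (hgD.trans ?_) (by positivity)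
          exact mul_le_mul_of_nonneg_left (mul_le_mul_of_nonneg_right h7 hD0.le) hC₃.le
      _ = 7 * C₃ * (h * y' * (L ^ 34 * L ^ 2 * (L ^ 2)⁻¹) * D) := by ring
      _ = 7 * C₃ * (M * D) := by rw [hM, mul_inv_cancel_right₀ (by positivity)]
      _ ≤ _ := by linarith

/-- The sum of `lam j n` over `n ≤ y'`, trapezoidally weighted and twisted by
`(φ (n - 1) / (n - 1)) ^ k`. -/
noncomputable def shiftSum (k j : ℕ) (y y' : ℝ) : ℝ :=
  ∑ n ∈ Finset.Icc 1 ⌊y'⌋₊, lam j n * trap y y' n * ((Nat.totient (n - 1) : ℝ) / (n - 1 : ℕ)) ^ k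

lemma progSum_eq_zero {d : ℕ} (j : ℕ) {y y' : ℝ} (hd : ⌊y'⌋₊ ≤ d) : progSum d j y y' = 0 := by
  refine Finset.sum_eq_zero fun n hn ↦ ?_
  rw [Finset.mem_filter, Finset.mem_Icc] at hn
  obtain ⟨⟨hn1, hnN⟩, hmod⟩ := hn
  obtain ⟨i, hi⟩ := (Nat.modEq_iff_dvd' hn1).mp hmod.symm
  have : n = 1 := by
    rcases Nat.eq_zero_or_pos i with rfl | hi0
    · omega
    · nlinarith [Nat.le_mul_of_pos_right d hi0, Nat.sub_lt hn1 one_pos]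
  rw [this, lam_one, zero_mul]

lemma shiftSum_eq_sum (k j : ℕ) (y y' : ℝ) :
    shiftSum k j y y' = ∑ d ∈ Finset.Icc 1 ⌊y'⌋₊, gCoef k d * progSum d j y y' := by
  simp_rw [progSum, Finset.mul_sum, Finset.sum_filter, shiftSum]
  rw [Finset.sum_comm]
  refine Finset.sum_congr rfl fun n hn ↦ ?_
  rw [Finset.mem_Icc] at hn
  rcases Nat.lt_or_ge 1 n with h1 | h1
  · rw [← sum_gCoef_divisors k (by omega : n - 1 ≠ 0), ← Finset.sum_filter,
      Finset.mul_sum]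
    have : (Finset.Icc 1 ⌊y'⌋₊).filter (fun d ↦ n ≡ 1 [MOD d]) = (n - 1).divisors := by
      ext d
      rw [Finset.mem_filter, Finset.mem_Icc, Nat.mem_divisors, Nat.ModEq.comm,
        Nat.modEq_iff_dvd' hn.1]
      refine ⟨fun h ↦ ⟨h.2, by omega⟩, fun h ↦ ⟨⟨Nat.pos_of_dvd_of_pos h.1 (by omega), ?_⟩, h.1⟩⟩
      have := Nat.le_of_dvd (by omega) h.1
      omega
    rw [this]
    exact Finset.sum_congr rfl fun d _ ↦ by ring
  · obtain rfl : n = 1 := by omega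
    simp [lam_one]

/-- The twisted sum is the untwisted one times the constant `aK k`, up to a smaller error. -/
lemma exists_abs_shiftSum_sub_le {k : ℕ} (hk : 1 ≤ k) : ∃ C : ℝ, 0 < C ∧ ∀ y y' : ℝ,
    3 ≤ y → y ≤ y' → Real.log y' ^ 9 ≤ y' → y' ≤ 2 * ((y' - y) * Real.log y') →
      |shiftSum k 35 y y' - aK k * progSum 1 35 y y'| ≤
        C * ((y' - y) * y' * Real.log y' ^ 34) := by
  obtain ⟨C, hC, h⟩ := exists_abs_gCoef_mul_le hk
  have hsum : Summable fun d : ℕ ↦ (d : ℝ) ^ (-(11 / 10) : ℝ) :=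
    Real.summable_nat_rpow.mpr (by norm_num)
  have hpos : 0 < ∑' d : ℕ, (d : ℝ) ^ (-(11 / 10) : ℝ) :=
    hsum.tsum_pos (fun d ↦ by positivity) 1 (by norm_num)
  refine ⟨C * ∑' d : ℕ, (d : ℝ) ^ (-(11 / 10) : ℝ), by positivity, fun y y' hy hyy hL9 hyL ↦ ?_⟩
  have hS : HasSum (fun d ↦ gCoef k d * progSum d 35 y y') (shiftSum k 35 y y') := by
    rw [shiftSum_eq_sum]
    refine hasSum_sum_of_ne_finset_zero fun d hd ↦ ?_
    rcases Nat.eq_zero_or_pos d with rfl | hd0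
    · rw [gCoef_zero, zero_mul]
    · rw [progSum_eq_zero, mul_zero]
      rw [Finset.mem_Icc] at hd
      omega
  have hA : HasSum (fun d ↦ gCoef k d / Nat.totient d * progSum 1 35 y y')
      (aK k * progSum 1 35 y y') := by
    rw [aK_eq_tsum hk]
    exact (summable_gCoef_div hk).of_norm.hasSum.mul_right _
  rw [← (hS.sub hA).tsum_eq, ← Real.norm_eq_abs,
    show C * (∑' d : ℕ, (d : ℝ) ^ (-(11 / 10) : ℝ)) * ((y' - y) * y' * Real.log y' ^ 34) =
      C * ((y' - y) * y' * Real.log y' ^ 34) * ∑' d : ℕ, (d : ℝ) ^ (-(11 / 10) : ℝ) by ring]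
  refine tsum_of_norm_bounded (hsum.hasSum.mul_left _) fun d ↦ ?_
  rcases Nat.eq_zero_or_pos d with rfl | hd0
  · rw [gCoef_zero, Nat.cast_zero, Real.zero_rpow (by norm_num)]; simp
  · refine le_trans (le_of_eq ?_) (h d y y' hd0.ne' hy hyy hL9 hyL)
    rw [Real.norm_eq_abs, ← abs_mul]
    ring_nf

lemma pow_sub_pow_le {a L : ℝ} (ha : 0 ≤ a) (h : a ≤ L) (n : ℕ) :
    L ^ (n + 1) - a ^ (n + 1) ≤ (n + 1) * L ^ n * (L - a) := by
  have h1 := abs_pow_sub_pow_le L a (n + 1)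
  rw [abs_of_nonneg (sub_nonneg.mpr h), abs_of_nonneg ha, abs_of_nonneg (ha.trans h),
    max_eq_left h, Nat.add_sub_cancel] at h1
  push_cast at h1
  linarith [le_abs_self (L ^ (n + 1) - a ^ (n + 1))]

lemma log_factorial_eq_sum (N : ℕ) :
    Real.log N.factorial = ∑ n ∈ Finset.Icc 1 N, Real.log n := by
  induction N with
  | zero => simp
  | succ N ih =>
    rw [Finset.sum_Icc_succ_top (by omega), ← ih, Nat.factorial_succ, Nat.cast_mul,
      Real.log_mul (by positivity) (by exact_mod_cast N.factorial_ne_zero), add_comm]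

lemma sum_log_sub_log_le {y : ℝ} (hy : 0 < y) (N : ℕ) :
    ∑ n ∈ Finset.Icc 1 N, (Real.log y - Real.log n) ≤ y := by
  have h1 := Real.pow_div_factorial_le_exp y hy.le N
  have hN : (0 : ℝ) < N.factorial := by exact_mod_cast N.factorial_pos
  have h2 := Real.log_le_log (by positivity) h1
  rw [Real.log_exp, Real.log_div (by positivity) hN.ne', Real.log_pow,
    log_factorial_eq_sum] at h2
  rwa [Finset.sum_sub_distrib, Finset.sum_const, Nat.card_Icc, Nat.add_sub_cancel, nsmul_eq_mul]

/-- Asymptotics of the trapezoidally weighted sum of `lam 35 n`. -/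
lemma exists_abs_progSum_one_sub_le : ∃ C : ℝ, 0 < C ∧ ∀ y y' : ℝ, 3 ≤ y → y ≤ y' →
    y' ≤ 2 * ((y' - y) * Real.log y') → (y' - y) * Real.log y' ≤ 2 * y' →
      |progSum 1 35 y y' - (y' - y) * y' * Real.log y' ^ 35| ≤
        C * ((y' - y) * y' * Real.log y' ^ 34) := by
  obtain ⟨C, hC, hdef⟩ := exists_defectSum 35
  refine ⟨2 * C + 38, by positivity, fun y y' hy hyy hyL hyL' ↦ ?_⟩
  have h1 := hdef y y' hy hyy
  rw [← progSum_one] at h1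
  set T := ∑ n ∈ Finset.Icc 1 ⌊y'⌋₊, Real.log n ^ 35 * trap y y' n with hT
  set L := Real.log y' with hL
  set h := y' - y with hh
  have hy0 : 0 < y' := by linarith
  have hL1 : 1 ≤ L := by
    rw [hL, Real.le_log_iff_exp_le (by linarith)]; linarith [Real.exp_one_lt_d9]
  have hL0 : 0 < L := by linarith
  have hh0 : 0 ≤ h := by linarith
  have hLy : L ≤ y' := (Real.log_le_sub_one_of_pos hy0).trans (by linarith)
  have hlog0 (n : ℕ) : 0 ≤ Real.log n := Real.log_natCast_nonneg n
  have hlog (n : ℕ) (hn : n ∈ Finset.Icc 1 ⌊y'⌋₊) : Real.log n ≤ L := by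
    rw [Finset.mem_Icc] at hn
    exact Real.log_le_log (by exact_mod_cast hn.1)
      ((Nat.cast_le.mpr hn.2).trans (Nat.floor_le hy0.le))
  have hdefect : C * y' ^ 2 ≤ 2 * C * (h * y' * L ^ 34) := by
    have e : L ≤ L ^ 34 := le_self_pow₀ hL1 (by norm_num)
    calc C * y' ^ 2 = C * (y' * y') := by ring
      _ ≤ C * (2 * (h * L) * y') := by gcongr
      _ = 2 * C * (h * y' * L) := by ring
      _ ≤ _ := by gcongr
  have hup : T ≤ h * y' * L ^ 35 := by
    have : T ≤ ∑ n ∈ Finset.Icc 1 ⌊y'⌋₊, L ^ 35 * h := by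
      refine Finset.sum_le_sum fun n hn ↦ ?_
      exact mul_le_mul (pow_le_pow_left₀ (hlog0 n) (hlog n hn) _) (trap_le hyy n)
        (trap_nonneg hyy n) (by positivity)
    refine this.trans ?_
    rw [Finset.sum_const, Nat.card_Icc, Nat.add_sub_cancel, nsmul_eq_mul]
    calc (⌊y'⌋₊ : ℝ) * (L ^ 35 * h) ≤ y' * (L ^ 35 * h) := by
          gcongr; exact Nat.floor_le hy0.le
      _ = _ := by ring
  have hsub : Finset.Icc 1 ⌊y⌋₊ ⊆ Finset.Icc 1 ⌊y'⌋₊ :=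
    Finset.Icc_subset_Icc_right (Nat.floor_mono hyy)
  have hlow : h * y' * L ^ 35 - 38 * (h * y' * L ^ 34) ≤ T := by
    have e1 : ∑ n ∈ Finset.Icc 1 ⌊y⌋₊, (L ^ 35 - 35 * L ^ 34 * (L - Real.log n)) * h ≤ T := by
      refine (Finset.sum_le_sum fun n hn ↦ ?_).trans
        (Finset.sum_le_sum_of_subset_of_nonneg hsub fun n _ _ ↦
          mul_nonneg (pow_nonneg (hlog0 n) 35) (trap_nonneg hyy n))
      rw [trap_of_le hyy ((Nat.cast_le.mpr (Finset.mem_Icc.mp hn).2).trans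
        (Nat.floor_le (by linarith)))]
      have := pow_sub_pow_le (hlog0 n) (hlog n (hsub hn)) 34
      refine mul_le_mul_of_nonneg_right ?_ hh0
      push_cast at this
      linarith
    refine le_trans ?_ e1
    rw [← Finset.sum_mul, Finset.sum_sub_distrib, ← Finset.mul_sum, Finset.sum_const,
      Nat.card_Icc, Nat.add_sub_cancel, nsmul_eq_mul]
    have e2 : 35 * L ^ 34 * ∑ n ∈ Finset.Icc 1 ⌊y⌋₊, (L - Real.log n) ≤ 35 * L ^ 34 * y' :=
      mul_le_mul_of_nonneg_left (sum_log_sub_log_le hy0 _) (by positivity)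
    have e3 : (y' - h - 1) * L ^ 35 ≤ (⌊y⌋₊ : ℝ) * L ^ 35 := by
      gcongr
      linarith [Nat.lt_floor_add_one y]
    have e4 : h * L ^ 35 ≤ 2 * y' * L ^ 34 := by
      calc h * L ^ 35 = h * L * L ^ 34 := by ring
        _ ≤ _ := by gcongr
    have e5 : L ^ 35 ≤ y' * L ^ 34 := by
      calc L ^ 35 = L * L ^ 34 := by ring
        _ ≤ _ := by gcongr
    calc h * y' * L ^ 35 - 38 * (h * y' * L ^ 34)
        = (y' * L ^ 35 - 38 * (y' * L ^ 34)) * h := by ring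
      _ ≤ _ := mul_le_mul_of_nonneg_right (by linarith) hh0
  have hM : 0 ≤ h * y' * L ^ 34 := by positivity
  rw [abs_le] at h1 ⊢
  constructor <;> linarith

/-- The sum of `Λ n * log n ^ 35 * (φ (n - 1) / (n - 1)) ^ k` over `n ≤ x`. -/
noncomputable def sharpSum (k : ℕ) (x : ℝ) : ℝ :=
  ∑ n ∈ Finset.Icc 1 ⌊x⌋₊, lam 35 n * ((Nat.totient (n - 1) : ℝ) / (n - 1 : ℕ)) ^ k

lemma totient_div_pow_nonneg (k m : ℕ) : 0 ≤ ((Nat.totient m : ℝ) / m) ^ k := by positivity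

lemma totient_div_pow_le_one (k m : ℕ) : ((Nat.totient m : ℝ) / m) ^ k ≤ 1 :=
  pow_le_one₀ (by positivity)
    (div_le_one_of_le₀ (by exact_mod_cast Nat.totient_le m) (Nat.cast_nonneg m))

lemma shiftSum_le (k : ℕ) {y y' : ℝ} (h : y ≤ y') :
    shiftSum k 35 y y' ≤ (y' - y) * sharpSum k y' := by
  rw [shiftSum, sharpSum, Finset.mul_sum]
  refine Finset.sum_le_sum fun n _ ↦ ?_
  rw [← mul_assoc, mul_comm (y' - y)]
  exact mul_le_mul_of_nonneg_right (mul_le_mul_of_nonneg_left (trap_le h n) (lam_nonneg _ _))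
    (totient_div_pow_nonneg _ _)

lemma le_shiftSum (k : ℕ) {y y' : ℝ} (h0 : 0 ≤ y) (h : y ≤ y') :
    (y' - y) * sharpSum k y ≤ shiftSum k 35 y y' := by
  rw [shiftSum, sharpSum, Finset.mul_sum]
  refine (Finset.sum_le_sum fun n hn ↦ ?_).trans (Finset.sum_le_sum_of_subset_of_nonneg
    (Finset.Icc_subset_Icc_right (Nat.floor_mono h)) fun n _ _ ↦
      mul_nonneg (mul_nonneg (lam_nonneg _ _) (trap_nonneg h n)) (totient_div_pow_nonneg _ _))
  rw [trap_of_le h ((Nat.cast_le.mpr (Finset.mem_Icc.mp hn).2).trans (Nat.floor_le h0))]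
  exact le_of_eq (by ring)

lemma exists_abs_shiftSum_sub_main_le {k : ℕ} (hk : 1 ≤ k) : ∃ C : ℝ, 0 < C ∧ ∀ y y' : ℝ,
    3 ≤ y → y ≤ y' → Real.log y' ^ 9 ≤ y' → y' ≤ 2 * ((y' - y) * Real.log y') →
      (y' - y) * Real.log y' ≤ 2 * y' →
        |shiftSum k 35 y y' - aK k * ((y' - y) * y' * Real.log y' ^ 35)| ≤
          C * ((y' - y) * y' * Real.log y' ^ 34) := by
  obtain ⟨C₁, hC₁, h₁⟩ := exists_abs_shiftSum_sub_le hk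
  obtain ⟨C₂, hC₂, h₂⟩ := exists_abs_progSum_one_sub_le
  refine ⟨C₁ + |aK k| * C₂, by positivity, fun y y' hy hyy hL9 hyL hyL' ↦ ?_⟩
  have e₁ := h₁ y y' hy hyy hL9 hyL
  have e₂ := mul_le_mul_of_nonneg_left (h₂ y y' hy hyy hyL hyL') (abs_nonneg (aK k))
  rw [← abs_mul, mul_sub] at e₂
  refine (abs_sub_le _ (aK k * progSum 1 35 y y') _).trans ((add_le_add e₁ e₂).trans_eq ?_)
  ring

set_option maxHeartbeats 800000 in
/-- Asymptotics of `sharpSum`. -/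
lemma exists_abs_sharpSum_sub_le {k : ℕ} (hk : 1 ≤ k) : ∃ C : ℝ, 0 < C ∧ ∀ᶠ x : ℝ in atTop,
    |sharpSum k x - aK k * (x * Real.log x ^ 35)| ≤ C * (x * Real.log x ^ 34) := by
  obtain ⟨C, hC, hmain⟩ := exists_abs_shiftSum_sub_main_le hk
  have hlog9 : ∀ᶠ x : ℝ in atTop, Real.log x ^ 9 ≤ x := by
    filter_upwards [(Real.isLittleO_pow_log_id_atTop (n := 9)).bound one_pos, eventually_ge_atTop 1]
      with x hx hx1
    rw [one_mul, Real.norm_of_nonneg (pow_nonneg (Real.log_nonneg hx1) _), id,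
      Real.norm_of_nonneg (by linarith)] at hx
    exact hx
  obtain ⟨B, hB⟩ := eventually_atTop.mp hlog9
  refine ⟨|aK k| * (35 * 2 ^ 34 + 2 ^ 35) + 2 * C * 2 ^ 34, by positivity, ?_⟩
  filter_upwards [eventually_ge_atTop B, eventually_ge_atTop 6,
    Real.tendsto_log_atTop.eventually_ge_atTop 2] with x hxB hx6 hℓ2
  set ℓ := Real.log x with hℓ
  have hx0 : 0 < x := by linarith
  have hℓ0 : 0 < ℓ := by linarith
  set h := x / ℓ with hh
  have hhpos : 0 < h := by positivity
  have hhℓ : h * ℓ = x := div_mul_cancel₀ x hℓ0.ne'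
  have hhx : 2 * h ≤ x := by nlinarith
  have hK : 0 ≤ x * ℓ ^ 34 := by positivity
  rw [abs_le]
  constructor
  · have e := hmain (x - h) x (by linarith) (by linarith) (hB x hxB)
      (by rw [sub_sub_cancel, hhℓ]; linarith) (by rw [sub_sub_cancel, hhℓ]; linarith)
    have e' := shiftSum_le k (show x - h ≤ x by linarith)
    rw [sub_sub_cancel] at e e'
    rw [← hℓ] at e
    have e1 : h * (aK k * (x * ℓ ^ 35) - C * (x * ℓ ^ 34)) ≤ h * sharpSum k x := by
      have := (abs_le.mp e).1
      linarith
    have e2 := le_of_mul_le_mul_left e1 hhpos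
    have : 0 ≤ (|aK k| * (35 * 2 ^ 34 + 2 ^ 35) + C * (2 * 2 ^ 34 - 1)) * (x * ℓ ^ 34) := by
      have : (0 : ℝ) ≤ 2 * 2 ^ 34 - 1 := by norm_num
      positivity
    linarith
  · set y' := x + h with hy'
    set L := Real.log y' with hL
    have hy0 : 0 < y' := by linarith
    have hℓL : ℓ ≤ L := Real.log_le_log hx0 (by linarith)
    have hL1 : L - ℓ ≤ 1 := by
      rw [hL, hℓ, ← Real.log_div hy0.ne' hx0.ne']
      refine (Real.log_le_sub_one_of_pos (by positivity)).trans ?_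
      rw [sub_le_iff_le_add, div_le_iff₀ hx0]
      linarith
    have hL2 : L ≤ 2 * ℓ := by linarith
    have e := hmain x y' (by linarith) (by linarith) (hB y' (by linarith))
      (by rw [hy', add_sub_cancel_left, ← hy', ← hL]; nlinarith)
      (by rw [hy', add_sub_cancel_left, ← hy', ← hL]; nlinarith)
    have e' := le_shiftSum k hx0.le (show x ≤ y' by linarith)
    have hsub : y' - x = h := by rw [hy', add_sub_cancel_left]
    rw [hsub] at e e'
    rw [← hL] at e
    have e1 : h * sharpSum k x ≤ h * (aK k * (y' * L ^ 35) + C * (y' * L ^ 34)) := by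
      have := (abs_le.mp e).2
      linarith
    have e2 := le_of_mul_le_mul_left e1 hhpos
    have hp34 : L ^ 34 ≤ 2 ^ 34 * ℓ ^ 34 := by
      rw [← mul_pow]; exact pow_le_pow_left₀ (by linarith) hL2 34
    have hp35 : L ^ 35 ≤ 2 ^ 35 * ℓ ^ 35 := by
      rw [← mul_pow]; exact pow_le_pow_left₀ (by linarith) hL2 35
    have hdiff0 : 0 ≤ y' * L ^ 35 - x * ℓ ^ 35 := by
      have : ℓ ^ 35 ≤ L ^ 35 := pow_le_pow_left₀ hℓ0.le hℓL 35
      rw [sub_nonneg]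
      exact mul_le_mul (by linarith) this (by positivity) hy0.le
    have hdiff : y' * L ^ 35 - x * ℓ ^ 35 ≤ (35 * 2 ^ 34 + 2 ^ 35) * (x * ℓ ^ 34) := by
      have d1 : L ^ 35 - ℓ ^ 35 ≤ 35 * (2 ^ 34 * ℓ ^ 34) := by
        have := pow_sub_pow_le hℓ0.le hℓL 34
        push_cast at this
        calc L ^ 35 - ℓ ^ 35 ≤ (34 + 1) * L ^ 34 * (L - ℓ) := this
          _ ≤ (34 + 1) * L ^ 34 * 1 := by
            refine mul_le_mul_of_nonneg_left hL1 (mul_nonneg (by norm_num) (pow_nonneg ?_ _))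
            linarith
          _ = 35 * L ^ 34 := by ring
          _ ≤ _ := by linarith
      have d2 : h * L ^ 35 ≤ 2 ^ 35 * (x * ℓ ^ 34) := by
        calc h * L ^ 35 ≤ h * (2 ^ 35 * ℓ ^ 35) := mul_le_mul_of_nonneg_left hp35 hhpos.le
          _ = 2 ^ 35 * (h * ℓ * ℓ ^ 34) := by ring
          _ = _ := by rw [hhℓ]
      have d3 := mul_le_mul_of_nonneg_left d1 hx0.le
      calc y' * L ^ 35 - x * ℓ ^ 35 = x * (L ^ 35 - ℓ ^ 35) + h * L ^ 35 := by rw [hy']; ring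
        _ ≤ x * (35 * (2 ^ 34 * ℓ ^ 34)) + 2 ^ 35 * (x * ℓ ^ 34) := add_le_add d3 d2
        _ = _ := by ring
    have f1 : aK k * (y' * L ^ 35 - x * ℓ ^ 35) ≤
        |aK k| * ((35 * 2 ^ 34 + 2 ^ 35) * (x * ℓ ^ 34)) :=
      (mul_le_mul_of_nonneg_right (le_abs_self _) hdiff0).trans
        (mul_le_mul_of_nonneg_left hdiff (abs_nonneg _))
    have f2 : C * (y' * L ^ 34) ≤ C * (2 * x * (2 ^ 34 * ℓ ^ 34)) := by
      refine mul_le_mul_of_nonneg_left (mul_le_mul (by linarith) hp34 ?_ (by linarith)) hC.le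
      exact pow_nonneg (by linarith) _
    linarith

/-- The sum of `(φ (p - 1) / (p - 1)) ^ k` over primes `p ≤ x`. -/
noncomputable def primeSum (k : ℕ) (x : ℝ) : ℝ :=
  ∑ p ∈ (Finset.Ioc 0 ⌊x⌋₊).filter Nat.Prime, ((Nat.totient (p - 1) : ℝ) / (p - 1 : ℕ)) ^ k

lemma abs_primeSum_sub_sharpSum_le (k : ℕ) {x : ℝ} (hx : 1 ≤ x) :
    |Real.log x ^ 36 * primeSum k x - sharpSum k x| ≤
      Real.log x ^ 35 * (Chebyshev.psi x - Chebyshev.theta x) +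
        36 * Real.log x ^ 36 * (Nat.primeCounting ⌊x⌋₊ - Chebyshev.theta x / Real.log x) := by
  set ℓ := Real.log x with hℓ
  have hℓ0 : 0 ≤ ℓ := Real.log_nonneg hx
  set f : ℕ → ℝ := fun n ↦ ((Nat.totient (n - 1) : ℝ) / (n - 1 : ℕ)) ^ k with hf
  have hf0 (n : ℕ) : 0 ≤ f n := totient_div_pow_nonneg _ _
  have hf1 (n : ℕ) : f n ≤ 1 := totient_div_pow_le_one _ _
  have hlog (n : ℕ) (hn : n ∈ Finset.Ioc 0 ⌊x⌋₊) : Real.log n ≤ ℓ := by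
    rw [Finset.mem_Ioc] at hn
    exact Real.log_le_log (by exact_mod_cast hn.1)
      ((Nat.cast_le.mpr hn.2).trans (Nat.floor_le (by linarith)))
  have hlog0 (n : ℕ) : 0 ≤ Real.log n := Real.log_natCast_nonneg n
  set A := ∑ n ∈ (Finset.Ioc 0 ⌊x⌋₊).filter (fun n ↦ ¬ n.Prime), lam 35 n * f n with hA
  set B := ∑ p ∈ (Finset.Ioc 0 ⌊x⌋₊).filter Nat.Prime, (ℓ ^ 36 - Real.log p ^ 36) * f p with hB
  have hsplit : sharpSum k x =
      ∑ p ∈ (Finset.Ioc 0 ⌊x⌋₊).filter Nat.Prime, Real.log p ^ 36 * f p + A := by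
    rw [sharpSum, show Finset.Icc 1 ⌊x⌋₊ = Finset.Ioc 0 ⌊x⌋₊ from rfl,
      ← Finset.sum_filter_add_sum_filter_not _ Nat.Prime]
    congr 1
    refine Finset.sum_congr rfl fun p hp ↦ ?_
    rw [lam, ArithmeticFunction.vonMangoldt_apply_prime (Finset.mem_filter.mp hp).2,
      ← pow_succ']
  have e : ℓ ^ 36 * primeSum k x - sharpSum k x = B - A := by
    rw [hsplit, hB, primeSum, Finset.mul_sum]
    simp_rw [sub_mul, Finset.sum_sub_distrib]
    ring
  have hA0 : 0 ≤ A := Finset.sum_nonneg fun n _ ↦ mul_nonneg (lam_nonneg _ _) (hf0 n)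
  have hA1 : A ≤ ℓ ^ 35 * (Chebyshev.psi x - Chebyshev.theta x) := by
    rw [Chebyshev.psi_sub_theta_eq_sum_not_prime, Finset.mul_sum]
    refine Finset.sum_le_sum fun n hn ↦ ?_
    have h1 := pow_le_pow_left₀ (hlog0 n) (hlog n (Finset.mem_filter.mp hn).1) 35
    calc lam 35 n * f n ≤ lam 35 n := mul_le_of_le_one_right (lam_nonneg _ _) (hf1 n)
      _ = Real.log n ^ 35 * ArithmeticFunction.vonMangoldt n := by rw [lam, mul_comm]
      _ ≤ _ := mul_le_mul_of_nonneg_right h1 ArithmeticFunction.vonMangoldt_nonneg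
  have hpow (p : ℕ) (hp : p ∈ Finset.Ioc 0 ⌊x⌋₊) : 0 ≤ ℓ ^ 36 - Real.log p ^ 36 :=
    sub_nonneg.mpr (pow_le_pow_left₀ (hlog0 p) (hlog p hp) 36)
  have hB0 : 0 ≤ B := Finset.sum_nonneg fun p hp ↦
    mul_nonneg (hpow p (Finset.mem_filter.mp hp).1) (hf0 p)
  have hπ : ((Finset.Ioc 0 ⌊x⌋₊).filter Nat.Prime).card = Nat.primeCounting ⌊x⌋₊ := by
    rw [Nat.primeCounting, Nat.primeCounting', Nat.count_eq_card_filter_range]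
    congr 1
    ext p
    simp only [Finset.mem_filter, Finset.mem_Ioc, Finset.mem_range]
    exact ⟨fun h ↦ ⟨by omega, h.2⟩, fun h ↦ ⟨⟨h.2.pos, by omega⟩, h.2⟩⟩
  have hB1 : B ≤ 36 * ℓ ^ 35 * (ℓ * Nat.primeCounting ⌊x⌋₊ - Chebyshev.theta x) := by
    have h2 : ℓ * Nat.primeCounting ⌊x⌋₊ - Chebyshev.theta x =
        ∑ p ∈ (Finset.Ioc 0 ⌊x⌋₊).filter Nat.Prime, (ℓ - Real.log p) := by
      rw [Finset.sum_sub_distrib, Finset.sum_const, hπ, nsmul_eq_mul, Chebyshev.theta, mul_comm]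
    rw [h2, Finset.mul_sum]
    refine Finset.sum_le_sum fun p hp ↦ ?_
    have hp' := (Finset.mem_filter.mp hp).1
    have h3 := pow_sub_pow_le (hlog0 p) (hlog p hp') 35
    push_cast at h3
    exact (mul_le_of_le_one_right (hpow p hp') (hf1 p)).trans (by linarith)
  have hB2 : ℓ ^ 35 * (ℓ * Nat.primeCounting ⌊x⌋₊ - Chebyshev.theta x) =
      ℓ ^ 36 * (Nat.primeCounting ⌊x⌋₊ - Chebyshev.theta x / ℓ) := by
    rcases hℓ0.eq_or_lt with h0 | h0
    · rw [← h0]; norm_num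
    · rw [pow_succ ℓ 35, mul_assoc, mul_sub ℓ, mul_div_cancel₀ _ h0.ne']
  rw [e, abs_le]
  constructor <;> nlinarith

/-- The asymptotic formula for `primeSum`. -/
theorem exists_abs_primeSum_sub_le {k : ℕ} (hk : 1 ≤ k) : ∃ C : ℝ, 0 < C ∧ ∀ᶠ x : ℝ in atTop,
    |primeSum k x - aK k * (x / Real.log x)| ≤ C * (x / Real.log x ^ 2) := by
  obtain ⟨C, hC, h⟩ := exists_abs_sharpSum_sub_le hk
  obtain ⟨C', hC', h'⟩ := Chebyshev.primeCounting_sub_theta_div_log_isBigO.exists_pos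
  have hlog : ∀ᶠ x : ℝ in atTop, Real.log x ^ 4 ≤ x := by
    filter_upwards [(Real.isLittleO_pow_log_id_atTop (n := 4)).bound one_pos,
      eventually_ge_atTop 1] with x hx hx1
    rwa [one_mul, Real.norm_of_nonneg (pow_nonneg (Real.log_nonneg hx1) _), id,
      Real.norm_of_nonneg (by linarith)] at hx
  refine ⟨C + 2 + 36 * C', by positivity, ?_⟩
  filter_upwards [h, h'.bound, hlog, eventually_ge_atTop 1,
    Real.tendsto_log_atTop.eventually_ge_atTop 1] with x h1 h2 h3 hx1 hℓ1
  have h4 := abs_primeSum_sub_sharpSum_le k hx1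
  have h5 := Chebyshev.psi_sub_theta_le hx1
  set ℓ := Real.log x
  have hx0 : 0 < x := by linarith
  have hℓ0 : 0 < ℓ := by linarith
  have h6 : ℓ ^ 2 ≤ √x := Real.le_sqrt_of_sq_le (by rw [← pow_mul]; exact h3)
  have h7 : ℓ ^ 35 * (Chebyshev.psi x - Chebyshev.theta x) ≤ 2 * (x * ℓ ^ 34) := by
    calc _ ≤ ℓ ^ 35 * (2 * √x * ℓ) := by gcongr
      _ = 2 * ℓ ^ 34 * √x * ℓ ^ 2 := by ring
      _ ≤ 2 * ℓ ^ 34 * √x * √x := by gcongr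
      _ = 2 * ℓ ^ 34 * (√x * √x) := by ring
      _ = _ := by rw [Real.mul_self_sqrt hx0.le]; ring
  have h8 : 36 * ℓ ^ 36 * (Nat.primeCounting ⌊x⌋₊ - Chebyshev.theta x / ℓ) ≤
      36 * C' * (x * ℓ ^ 34) := by
    rw [Real.norm_of_nonneg (show 0 ≤ x / ℓ ^ 2 by positivity)] at h2
    calc _ ≤ 36 * ℓ ^ 36 * (C' * (x / ℓ ^ 2)) := by
          gcongr; exact (Real.le_norm_self _).trans h2
      _ = 36 * C' * (x * (ℓ ^ 34 * ℓ ^ 2 / ℓ ^ 2)) := by ring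
      _ = _ := by rw [mul_div_cancel_right₀ _ (by positivity)]
  have h9 : |ℓ ^ 36 * primeSum k x - aK k * (x * ℓ ^ 35)| ≤
      (C + 2 + 36 * C') * (x * ℓ ^ 34) := by
    refine (abs_sub_le _ (sharpSum k x) _).trans ?_
    linarith
  have e1 : ℓ ^ 36 * (primeSum k x - aK k * (x / ℓ)) =
      ℓ ^ 36 * primeSum k x - aK k * (x * ℓ ^ 35) := by
    rw [mul_sub, pow_succ ℓ 35]
    congr 1
    calc _ = aK k * (x * ℓ ^ 35) * (ℓ / ℓ) := by ring
      _ = _ := by rw [div_self hℓ0.ne', mul_one]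
  have e2 : ℓ ^ 36 * ((C + 2 + 36 * C') * (x / ℓ ^ 2)) = (C + 2 + 36 * C') * (x * ℓ ^ 34) := by
    calc _ = (C + 2 + 36 * C') * (x * ℓ ^ 34) * (ℓ ^ 2 / ℓ ^ 2) := by ring
      _ = _ := by rw [div_self (by positivity), mul_one]
  have hpos : 0 < ℓ ^ 36 := by positivity
  rw [← e1, ← e2, abs_mul, abs_of_pos hpos] at h9
  exact le_of_mul_le_mul_left h9 hpos

end PrimeSums

/-- For every fixed `k ≥ 1`,
`Σ_{p ≤ x, p prime} (φ(p−1)/(p−1))^k = a_k · x/log x + O(x/(log x)²)` as `x → ∞`. -/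
theorem totient_ratio_power_sum_over_primes (k : ℕ) (hk : 1 ≤ k) :
    ∃ C : ℝ, 0 < C ∧ ∃ x₀ : ℝ, ∀ x : ℝ, x₀ ≤ x →
      |(∑ p ∈ (Finset.range (⌊x⌋₊ + 1)).filter Nat.Prime,
          ((Nat.totient (p - 1) : ℝ) / ((p : ℝ) - 1)) ^ k)
        - aK k * (x / Real.log x)|
      ≤ C * (x / (Real.log x) ^ 2) := by
  obtain ⟨C, hC, h⟩ := PrimeSums.exists_abs_primeSum_sub_le hk
  obtain ⟨x₀, hx₀⟩ := Filter.eventually_atTop.mp h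
  refine ⟨C, hC, x₀, fun x hx ↦ ?_⟩
  have e : ∑ p ∈ (Finset.range (⌊x⌋₊ + 1)).filter Nat.Prime,
      ((Nat.totient (p - 1) : ℝ) / ((p : ℝ) - 1)) ^ k = PrimeSums.primeSum k x := by
    refine Finset.sum_congr ?_ fun p hp ↦ ?_
    · ext p
      simp only [Finset.mem_filter, Finset.mem_Ioc, Finset.mem_range]
      exact ⟨fun h ↦ ⟨⟨h.2.pos, by omega⟩, h.2⟩, fun h ↦ ⟨by omega, h.2⟩⟩
    · rw [Nat.cast_pred (Finset.mem_filter.mp hp).2.pos]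
  rw [e]
  exact hx₀ x hx
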